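/- Assume in addition ∫_ℝ (1+|x|²) J(x) dx < ∞. Let 1 < q < 2, λ, μ > 0 and φ ∈ L¹(ℝ), let u = u^μ_λ be the classical solution of the rescaled regularized problem, and let ω : [0,∞) → [0,∞) be a nondecreasing function with ω(r) → 0 as r → 0 such that ∫_ℝ |φ(x+h) − φ(x)| dx ≤ ω(|h|) for every h ∈ ℝ (an L¹-modulus of continuity of φ); set ω_λ(r) = ω(λ r). Then for every t > 0: (i) ∫_ℝ |u(t,x+h) − u(t,x)| dx ≤ ω_λ(|h|) for every h ∈ ℝ; (ii) there exists C(q, J, ‖φ‖_{L¹(ℝ)}) > 0 such that for every k > 0, ∫_ℝ |u(t+k,x) − u(t,x)| dx ≤ C(q, J, ‖φ‖_{L¹(ℝ)})·( (λ^{q−2} + μ)·k^{1/3} + k^{2/3}·t^{−1+1/q} ) + 4·ω_λ(k^{1/3}). -/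

import Mathlib

open MeasureTheory Filter ENNReal

/-- `u` is a classical solution of the rescaled regularized problem
`u_t + |u|^{q-1} u_x = λ^q (J_λ ∗ u - u) + μ u_xx` with initial datum
`φ_λ(x) = λ φ(λ x)`, where `J_λ(x) = λ J(λ x)`. -/
def IsRescaledSol (J : ℝ → ℝ) (q lam μ : ℝ) (φ : ℝ → ℝ) (u : ℝ → ℝ → ℝ) : Prop :=
  (∀ t : ℝ, 0 ≤ t → Integrable (u t)) ∧
  (∀ t₀ : ℝ, 0 ≤ t₀ →
    Tendsto (fun t => ∫ x, |u t x - u t₀ x|) (nhdsWithin t₀ (Set.Ici 0)) (nhds 0)) ∧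
  (∀ t : ℝ, 0 < t → ContDiff ℝ 2 (u t)) ∧
  (∀ x : ℝ, ContDiffOn ℝ 1 (fun s => u s x) (Set.Ioi 0)) ∧
  (∀ t : ℝ, 0 < t → ∀ x : ℝ,
    deriv (fun s => u s x) t + |u t x| ^ (q - 1) * deriv (u t) x
      = lam ^ q * ((∫ y, lam * J (lam * (x - y)) * u t y) - u t x)
        + μ * deriv (deriv (u t)) x) ∧
  (u 0 =ᵐ[volume] fun x => lam * φ (lam * x))

/-- `ω` is an `L¹`-modulus of continuity of `φ`. -/
def IsL1Modulus (φ ω : ℝ → ℝ) : Prop :=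
  (∀ r, 0 ≤ ω r) ∧ (∀ r s : ℝ, 0 ≤ r → r ≤ s → ω r ≤ ω s) ∧
  Filter.Tendsto ω (nhdsWithin 0 (Set.Ici 0)) (nhds 0) ∧
  (∀ h : ℝ, ∫ x, |φ (x + h) - φ x| ≤ ω |h|)

/-- last point of `S` before `r` -/
noncomputable def gapL (S : Set ℝ) (r : ℝ) : ℝ := sSup (S ∩ Set.Iic r)
/-- first point of `S` after `r` -/
noncomputable def gapR (S : Set ℝ) (r : ℝ) : ℝ := sInf (S ∩ Set.Ici r)

lemma gapL_spec {S : Set ℝ} (hS : IsClosed S) {s r : ℝ} (hs : s ∈ S) (hsr : s ≤ r) :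
    gapL S r ∈ S ∧ gapL S r ≤ r ∧ s ≤ gapL S r ∧ ∀ x ∈ S, x ≤ r → x ≤ gapL S r := by
  have hne : (S ∩ Set.Iic r).Nonempty := ⟨s, hs, hsr⟩
  have hbd : BddAbove (S ∩ Set.Iic r) := ⟨r, fun x hx => hx.2⟩
  have hm := (hS.inter isClosed_Iic).csSup_mem hne hbd
  exact ⟨hm.1, hm.2, le_csSup hbd ⟨hs, hsr⟩, fun x hx hxr => le_csSup hbd ⟨hx, hxr⟩⟩

lemma gapR_spec {S : Set ℝ} (hS : IsClosed S) {t r : ℝ} (ht : t ∈ S) (hrt : r ≤ t) :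
    gapR S r ∈ S ∧ r ≤ gapR S r ∧ gapR S r ≤ t ∧ ∀ x ∈ S, r ≤ x → gapR S r ≤ x := by
  have hne : (S ∩ Set.Ici r).Nonempty := ⟨t, ht, hrt⟩
  have hbd : BddBelow (S ∩ Set.Ici r) := ⟨r, fun x hx => hx.2⟩
  have hm := (hS.inter isClosed_Ici).csInf_mem hne hbd
  exact ⟨hm.1, hm.2, csInf_le hbd ⟨ht, hrt⟩, fun x hx hxr => csInf_le hbd ⟨hx, hxr⟩⟩

lemma gap_eq {S : Set ℝ} (hS : IsClosed S) {s t r x : ℝ} (hs : s ∈ S) (ht : t ∈ S)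
    (hr : r ∈ Set.Icc s t) (hx : x ∈ Set.Ioo (gapL S r) (gapR S r)) :
    x ∉ S ∧ gapL S x = gapL S r ∧ gapR S x = gapR S r := by
  obtain ⟨a1, a2, a3, a4⟩ := gapL_spec hS hs hr.1
  obtain ⟨b1, b2, b3, b4⟩ := gapR_spec hS ht hr.2
  have hxS : x ∉ S := by
    intro h
    rcases le_total x r with h1 | h1
    · exact absurd (a4 x h h1) (not_le.2 hx.1)
    · exact absurd (b4 x h h1) (not_le.2 hx.2)
  have hsx : s ≤ x := a3.trans hx.1.le
  have hxt : x ≤ t := hx.2.le.trans b3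
  obtain ⟨c1, c2, c3, c4⟩ := gapL_spec hS hs hsx
  obtain ⟨d1, d2, d3, d4⟩ := gapR_spec hS ht hxt
  refine ⟨hxS, le_antisymm ?_ (c4 _ a1 hx.1.le), le_antisymm (d4 _ b1 hx.2.le) ?_⟩
  · rcases le_total (gapL S x) r with h | h
    · exact a4 _ c1 h
    · exact absurd (c2.trans_lt hx.2) (not_lt.2 (b4 _ c1 h))
  · rcases le_total r (gapR S x) with h | h
    · exact b4 _ d1 h
    · exact absurd (hx.1.trans_le d2) (not_lt.2 (a4 _ d1 h))

lemma gapL_lt {S : Set ℝ} (hS : IsClosed S) {s t r : ℝ} (hs : s ∈ S) (ht : t ∈ S)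
    (hr : r ∈ Set.Icc s t) (hrS : r ∉ S) : gapL S r < r ∧ r < gapR S r := by
  obtain ⟨a1, a2, a3, a4⟩ := gapL_spec hS hs hr.1
  obtain ⟨b1, b2, b3, b4⟩ := gapR_spec hS ht hr.2
  constructor
  · exact lt_of_le_of_ne a2 (fun h => hrS (h ▸ a1))
  · exact lt_of_le_of_ne b2 (fun h => hrS (h ▸ b1))

/-- measurability of the gap end points on the interval -/
lemma gapL_meas {S : Set ℝ} (hS : IsClosed S) {s t : ℝ} (hs : s ∈ S) :
    Measurable (fun r => gapL S (max s (min r t))) := by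
  apply Monotone.measurable
  intro x y hxy
  have h : max s (min x t) ≤ max s (min y t) := by gcongr
  obtain ⟨a1, a2, a3, a4⟩ := gapL_spec hS hs (le_max_left s (min x t))
  exact (gapL_spec hS hs (le_max_left s (min y t))).2.2.2 _ a1 (a2.trans h)

lemma gapR_meas {S : Set ℝ} (hS : IsClosed S) {s t : ℝ} (hst : s ≤ t) (ht : t ∈ S) :
    Measurable (fun r => gapR S (max s (min r t))) := by
  apply Monotone.measurable
  intro x y hxy
  have h : max s (min x t) ≤ max s (min y t) := by gcongr
  have hy : max s (min y t) ≤ t := max_le hst (min_le_right _ _)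
  obtain ⟨a1, a2, a3, a4⟩ := gapR_spec hS ht hy
  exact (gapR_spec hS ht (h.trans hy)).2.2.2 _ a1 (h.trans a2)

open Classical in
/-- the modified derivative: the derivative on `S`, the mean slope on the gaps -/
noncomputable def gapD (S : Set ℝ) (s t : ℝ) (g G : ℝ → ℝ) (r : ℝ) : ℝ :=
  if r ∈ S then g r else
    (G (gapR S (max s (min r t))) - G (gapL S (max s (min r t)))) /
      (gapR S (max s (min r t)) - gapL S (max s (min r t)))

lemma gapD_bound {S : Set ℝ} (hS : IsClosed S) {s t : ℝ} (hs : s ∈ S) (ht : t ∈ S)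
    {g G : ℝ → ℝ} {L : ℝ} (hL : 0 ≤ L) (hb : ∀ r ∈ Set.Icc s t, |g r| ≤ L)
    (hG : ∀ r₁ ∈ Set.Icc s t, ∀ r₂ ∈ Set.Icc s t, r₁ ≤ r₂ → ∫ x in r₁..r₂, g x = G r₂ - G r₁)
    {r : ℝ} (hr : r ∈ Set.Icc s t) : |gapD S s t g G r| ≤ L := by
  unfold gapD
  have hcl : max s (min r t) = r := by rw [min_eq_left hr.2, max_eq_right hr.1]
  rw [hcl]
  split_ifs with h
  · exact hb r hr
  · obtain ⟨h1, h2⟩ := gapL_lt hS hs ht hr h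
    have a := gapL_spec hS hs hr.1
    have b := gapR_spec hS ht hr.2
    have hα : gapL S r ∈ Set.Icc s t := ⟨a.2.2.1, a.2.1.trans hr.2⟩
    have hβ : gapR S r ∈ Set.Icc s t := ⟨hr.1.trans b.2.1, b.2.2.1⟩
    have hlt : gapL S r < gapR S r := h1.trans h2
    rw [← hG _ hα _ hβ hlt.le, abs_div, abs_of_pos (sub_pos.2 hlt), div_le_iff₀ (sub_pos.2 hlt)]
    have := intervalIntegral.norm_integral_le_of_norm_le_const (a := gapL S r) (b := gapR S r)
      (f := g) (C := L) (fun x hx => by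
        rw [Set.uIoc_of_le hlt.le] at hx
        exact hb x ⟨hα.1.trans hx.1.le, hx.2.trans hβ.2⟩)
    rwa [Real.norm_eq_abs, abs_of_pos (sub_pos.2 hlt)] at this

lemma gapD_integral {S : Set ℝ} (hS : IsClosed S) {s t : ℝ} (hst : s ≤ t) (hs : s ∈ S) (ht : t ∈ S)
    {g G : ℝ → ℝ} {L : ℝ} (hL : 0 ≤ L) (hg : Measurable g) (hGm : Measurable G)
    (hb : ∀ r ∈ Set.Icc s t, |g r| ≤ L)
    (hG : ∀ r₁ ∈ Set.Icc s t, ∀ r₂ ∈ Set.Icc s t, r₁ ≤ r₂ → ∫ x in r₁..r₂, g x = G r₂ - G r₁) :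
    ∫ r in s..t, gapD S s t g G r = G t - G s := by
  have hDm : Measurable (gapD S s t g G) := by
    unfold gapD
    refine Measurable.ite hS.measurableSet hg ?_
    have h1 := gapL_meas hS hs (t := t)
    have h2 := gapR_meas hS hst ht
    exact ((hGm.comp h2).sub (hGm.comp h1)).div (h2.sub h1)
  have hgi : IntegrableOn g (Set.Icc s t) := by
    refine Measure.integrableOn_of_bounded (M := L) (by simp) hg.aestronglyMeasurable ?_
    exact (ae_restrict_iff' measurableSet_Icc).2 (Eventually.of_forall fun r hr => hb r hr)
  have hDi : IntegrableOn (gapD S s t g G) (Set.Icc s t) := by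
    refine Measure.integrableOn_of_bounded (M := L) (by simp) hDm.aestronglyMeasurable ?_
    exact (ae_restrict_iff' measurableSet_Icc).2
      (Eventually.of_forall fun r hr => gapD_bound hS hs ht hL hb hG hr)
  rw [← hG s ⟨le_rfl, hst⟩ t ⟨hst, le_rfl⟩ hst]
  rw [intervalIntegral.integral_of_le hst, intervalIntegral.integral_of_le hst]
  have hsub : Set.Ioc s t ⊆ Set.Icc s t := Set.Ioc_subset_Icc_self
  rw [← sub_eq_zero, ← integral_sub (hDi.mono_set hsub) (hgi.mono_set hsub)]
  set E : ℝ → ℝ := fun r => gapD S s t g G r - g r with hE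
  have hEi : IntegrableOn E (Set.Icc s t) := hDi.sub hgi
  set T : Set (ℝ × ℝ) := {p | ∃ r ∈ Set.Icc s t, r ∉ S ∧ p = (gapL S r, gapR S r)} with hT
  have hdisj : T.PairwiseDisjoint (fun p => Set.Ioo p.1 p.2) := by
    rintro p ⟨r, hr, hrS, rfl⟩ p' ⟨r', hr', hrS', rfl⟩ hne
    rw [Function.onFun, Set.disjoint_left]
    intro x hx hx'
    obtain ⟨-, e1, e2⟩ := gap_eq hS hs ht hr hx
    obtain ⟨-, e1', e2'⟩ := gap_eq hS hs ht hr' hx'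
    exact hne (by rw [← e1, ← e2, e1', e2'])
  have hcount : T.Countable := by
    refine hdisj.countable_of_isOpen (fun _ _ => isOpen_Ioo) ?_
    rintro p ⟨r, hr, hrS, rfl⟩
    exact ⟨r, gapL_lt hS hs ht hr hrS⟩
  have hU : ⋃ p ∈ T, Set.Ioo p.1 p.2 ⊆ Set.Icc s t := by
    intro x hx
    simp only [Set.mem_iUnion] at hx
    obtain ⟨p, ⟨r, hr, hrS, rfl⟩, hx⟩ := hx
    exact ⟨(gapL_spec hS hs hr.1).2.2.1.trans hx.1.le, hx.2.le.trans (gapR_spec hS ht hr.2).2.2.1⟩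
  have hUI : ⋃ p ∈ T, Set.Ioo p.1 p.2 ⊆ Set.Ioc s t := by
    intro x hx
    refine ⟨?_, (hU hx).2⟩
    simp only [Set.mem_iUnion] at hx
    obtain ⟨p, ⟨r, hr, hrS, rfl⟩, hx⟩ := hx
    exact (gapL_spec hS hs hr.1).2.2.1.trans_lt hx.1
  have hzero : ∀ x ∈ Set.Ioc s t \ ⋃ p ∈ T, Set.Ioo p.1 p.2, E x = 0 := by
    rintro x ⟨hx, hx'⟩
    have hxS : x ∈ S := by
      by_contra h
      exact hx' (Set.mem_biUnion (x := (gapL S x, gapR S x)) ⟨x, hsub hx, h, rfl⟩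
        (gapL_lt hS hs ht (hsub hx) h))
    simp [hE, gapD, hxS]
  have hmeas : MeasurableSet (⋃ p ∈ T, Set.Ioo p.1 p.2) :=
    MeasurableSet.biUnion hcount (fun _ _ => measurableSet_Ioo)
  rw [setIntegral_eq_of_subset_of_forall_diff_eq_zero measurableSet_Ioc hUI hzero]
  haveI := hcount.to_subtype
  rw [Set.biUnion_eq_iUnion] at hmeas hU ⊢
  rw [integral_iUnion (fun _ => measurableSet_Ioo) ?_ (hEi.mono_set hU)]
  · rw [← tsum_zero (α := ℝ) (β := T)]
    congr 1
    funext p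
    obtain ⟨p, r, hr, hrS, rfl⟩ := p
    have hlt := gapL_lt hS hs ht hr hrS
    have a := gapL_spec hS hs hr.1
    have b := gapR_spec hS ht hr.2
    have hα : gapL S r ∈ Set.Icc s t := ⟨a.2.2.1, a.2.1.trans hr.2⟩
    have hβ : gapR S r ∈ Set.Icc s t := ⟨hr.1.trans b.2.1, b.2.2.1⟩
    have hsub' : Set.Ioo (gapL S r) (gapR S r) ⊆ Set.Icc s t := fun x hx =>
      ⟨hα.1.trans hx.1.le, hx.2.le.trans hβ.2⟩
    simp only
    rw [hE, integral_sub (hDi.mono_set hsub') (hgi.mono_set hsub')]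
    have e1 : ∫ x in Set.Ioo (gapL S r) (gapR S r), gapD S s t g G x
        = ∫ x in Set.Ioo (gapL S r) (gapR S r),
          (G (gapR S r) - G (gapL S r)) / (gapR S r - gapL S r) := by
      refine setIntegral_congr_fun measurableSet_Ioo (fun x hx => ?_)
      obtain ⟨h1, h2, h3⟩ := gap_eq hS hs ht hr hx
      have hx' := hsub' hx
      have hcl : max s (min x t) = x := by rw [min_eq_left hx'.2, max_eq_right hx'.1]
      simp only [gapD, h1, if_false, hcl, h2, h3]
    rw [e1, ← integral_Ioc_eq_integral_Ioo, ← integral_Ioc_eq_integral_Ioo,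
      ← intervalIntegral.integral_of_le (hlt.1.trans hlt.2).le,
      ← intervalIntegral.integral_of_le (hlt.1.trans hlt.2).le, hG _ hα _ hβ (hlt.1.trans hlt.2).le,
      intervalIntegral.integral_const, smul_eq_mul]
    have : gapR S r - gapL S r ≠ 0 := (sub_pos.2 (hlt.1.trans hlt.2)).ne'
    field_simp
    ring
  · intro p p' hne
    exact hdisj p.2 p'.2 (fun h => hne (Subtype.ext h))

section AL
variable {ι : Type*} {a b : ℝ} (m : ι → ℝ → ℝ) (C : ι → ℝ)

/-- increments controlled by the constants -/
def EI (s t : ℝ) : Prop := ∀ i, m i t - m i s ≤ C i * (t - s)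

/-- locally good times -/
def GoodT (a b t : ℝ) : Prop :=
  ∃ δ > 0, ∀ t₁ ∈ Set.Icc a b, ∀ t₂ ∈ Set.Icc a b, |t₁ - t| < δ → |t₂ - t| < δ → t₁ ≤ t₂ → EI m C t₁ t₂

variable {m C}

lemma EI.trans {s t r : ℝ} (h1 : EI m C s t) (h2 : EI m C t r) : EI m C s r := fun i => by
  have := h1 i; have := h2 i; nlinarith

lemma EI.refl (s : ℝ) : EI m C s s := fun i => by simp

lemma EI_of_good (hcont : ∀ i, ContinuousOn (m i) (Set.Icc a b)) {c d : ℝ} (hac : a ≤ c) (hdb : d ≤ b)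
    (hcd : c ≤ d) (hg : ∀ t ∈ Set.Icc c d, GoodT m C a b t) : EI m C c d := by
  have hsub : Set.Icc c d ⊆ Set.Icc a b := Set.Icc_subset_Icc hac hdb
  have : Set.Icc c d ⊆ {t | EI m C c t} := by
    apply IsClosed.Icc_subset_of_forall_mem_nhdsWithin
    · have : {t | EI m C c t} ∩ Set.Icc c d
          = Set.Icc c d ∩ ⋂ i, (Set.Icc c d ∩ (fun t => m i t - m i c - C i * (t - c)) ⁻¹' Set.Iic 0) := by
        ext t
        simp only [Set.mem_inter_iff, Set.mem_setOf_eq, EI, Set.mem_iInter, Set.mem_preimage, Set.mem_Iic]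
        constructor
        · rintro ⟨h1, h2⟩
          exact ⟨h2, fun i => ⟨h2, by linarith [h1 i]⟩⟩
        · rintro ⟨h1, h2⟩
          exact ⟨fun i => by linarith [(h2 i).2], h1⟩
      rw [this]
      refine isClosed_Icc.inter (isClosed_iInter fun i => ?_)
      refine ContinuousOn.preimage_isClosed_of_isClosed ?_ isClosed_Icc isClosed_Iic
      exact (((hcont i).mono hsub).sub continuousOn_const).sub (by fun_prop)
    · exact EI.refl c
    · rintro x ⟨hx, hx'⟩
      obtain ⟨δ, hδ, h⟩ := hg x ⟨hx'.1, hx'.2.le⟩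
      have : Set.Ioo x (min (x + δ) d) ∈ nhdsWithin x (Set.Ioi x) :=
        Ioo_mem_nhdsGT (lt_min (by linarith) hx'.2)
      filter_upwards [this] with z hz
      have hz2 := lt_min_iff.1 hz.2
      refine EI.trans hx (h x (hsub ⟨hx'.1, hx'.2.le⟩) z (hsub ⟨hx'.1.trans hz.1.le, hz2.2.le⟩) (by simpa) ?_ hz.1.le)
      rw [abs_lt]; constructor <;> linarith [hz.1]
  exact this ⟨hcd, le_rfl⟩

lemma EI_of_good_open (hcont : ∀ i, ContinuousOn (m i) (Set.Icc a b)) {c d : ℝ} (hac : a ≤ c) (hdb : d ≤ b)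
    (hcd : c ≤ d) (hg : ∀ t ∈ Set.Ioo c d, GoodT m C a b t) : EI m C c d := by
  rcases hcd.eq_or_lt with rfl | hlt
  · exact EI.refl _
  have hsub : Set.Icc c d ⊆ Set.Icc a b := Set.Icc_subset_Icc hac hdb
  intro i
  have h1 : ∀ c' ∈ Set.Ioo c d, m i d - m i c' ≤ C i * (d - c') := by
    intro c' hc'
    have hh : Tendsto (fun d' => m i d' - m i c' - C i * (d' - c')) (nhdsWithin d (Set.Ioo c' d))
        (nhds (m i d - m i c' - C i * (d - c'))) := by
      have := ((hcont i) d (hsub ⟨hcd, le_rfl⟩)).mono (s := Set.Ioo c' d) (fun z (hz : z ∈ Set.Ioo c' d) => hsub ⟨hc'.1.le.trans hz.1.le, hz.2.le⟩)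
      have h2 : ContinuousWithinAt (fun d' => C i * (d' - c')) (Set.Ioo c' d) d := by fun_prop
      exact (this.sub continuousWithinAt_const).sub h2
    haveI : (nhdsWithin d (Set.Ioo c' d)).NeBot := right_nhdsWithin_Ioo_neBot hc'.2
    have := le_of_tendsto hh (b := 0) (by
      filter_upwards [self_mem_nhdsWithin] with d' hd'
      have := EI_of_good hcont (hac.trans hc'.1.le) (hd'.2.le.trans hdb) hd'.1.le
        (fun t ht => hg t ⟨hc'.1.trans_le ht.1, ht.2.trans_lt hd'.2⟩) i
      linarith)
    linarith
  have hh : Tendsto (fun c' => m i d - m i c' - C i * (d - c')) (nhdsWithin c (Set.Ioo c d))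
      (nhds (m i d - m i c - C i * (d - c))) := by
    have := ((hcont i) c (hsub ⟨le_rfl, hcd⟩)).mono (s := Set.Ioo c d) (fun z (hz : z ∈ Set.Ioo c d) => hsub ⟨hz.1.le, hz.2.le⟩)
    have h2 : ContinuousWithinAt (fun c' => C i * (d - c')) (Set.Ioo c d) c := by fun_prop
    exact (continuousWithinAt_const.sub this).sub h2
  haveI : (nhdsWithin c (Set.Ioo c d)).NeBot := left_nhdsWithin_Ioo_neBot hlt
  have := le_of_tendsto hh (b := 0) (by
    filter_upwards [self_mem_nhdsWithin] with c' hc'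
    linarith [h1 c' hc'])
  linarith

end AL

/-- the gap step -/
lemma gap_step {Ω : Type*} [MeasurableSpace Ω] (ν : Measure Ω) [SFinite ν] {s t : ℝ}
    (hst : s ≤ t) (y y' : ℝ → Ω → ℝ) (C B : ℝ)
    (hym : Measurable (Function.uncurry y)) (hym' : Measurable (Function.uncurry y'))
    (hbd : ∀ ω, ∃ L, ∀ r ∈ Set.Icc s t, |y' r ω| ≤ L)
    (hinc : ∀ ω, ∀ r₁ ∈ Set.Icc s t, ∀ r₂ ∈ Set.Icc s t, r₁ ≤ r₂ →
      ∫ r in r₁..r₂, y' r ω = y r₂ ω - y r₁ ω)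
    (hyi : ∀ r ∈ Set.Icc s t, Integrable (y r) ν)
    (hC : ∀ r ∈ Set.Icc s t, ∫ ω, y' r ω ∂ν ≤ C)
    (S : Set ℝ) (hS : IsClosed S) (hs : s ∈ S) (ht : t ∈ S)
    (hS1 : ∀ r ∈ S ∩ Set.Icc s t, Integrable (y' r) ν ∧ ∫ ω, |y' r ω| ∂ν ≤ B)
    (hS2 : ∀ α ∈ S ∩ Set.Icc s t, ∀ β ∈ S ∩ Set.Icc s t, α < β → (∀ r ∈ Set.Ioo α β, r ∉ S) →
      ∫ ω, |y β ω - y α ω| ∂ν ≤ B * (β - α) ∧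
      (∫ ω, y β ω ∂ν) - ∫ ω, y α ω ∂ν ≤ C * (β - α)) :
    (∫ ω, y t ω ∂ν) - ∫ ω, y s ω ∂ν ≤ C * (t - s) := by
  set D : ℝ → Ω → ℝ := fun r ω => gapD S s t (fun r => y' r ω) (fun r => y r ω) r with hD
  have hDm : Measurable (Function.uncurry D) := by
    have h1 := gapL_meas hS hs (t := t)
    have h2 := gapR_meas hS hst ht
    simp only [hD, gapD, Function.uncurry_def]
    refine Measurable.ite (hS.measurableSet.preimage measurable_fst) hym' ?_
    have e1 : Measurable fun p : ℝ × Ω => y (gapR S (max s (min p.1 t))) p.2 :=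
      hym.comp ((h2.comp measurable_fst).prodMk measurable_snd)
    have e2 : Measurable fun p : ℝ × Ω => y (gapL S (max s (min p.1 t))) p.2 :=
      hym.comp ((h1.comp measurable_fst).prodMk measurable_snd)
    exact (e1.sub e2).div ((h2.comp measurable_fst).sub (h1.comp measurable_fst))
  have hDint : ∀ ω, ∫ r in s..t, D r ω = y t ω - y s ω := by
    intro ω
    obtain ⟨L, hL⟩ := hbd ω
    have hL0 : 0 ≤ L := (abs_nonneg _).trans (hL s ⟨le_rfl, hst⟩)
    exact gapD_integral hS hst hs ht hL0 (hym'.comp (measurable_id.prodMk measurable_const))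
      (hym.comp (measurable_id.prodMk measurable_const)) hL (hinc ω)
  have hDr : ∀ r ∈ Set.Icc s t, Integrable (D r) ν ∧ ∫ ω, |D r ω| ∂ν ≤ B ∧ ∫ ω, D r ω ∂ν ≤ C := by
    intro r hr
    have hcl : max s (min r t) = r := by rw [min_eq_left hr.2, max_eq_right hr.1]
    by_cases hrS : r ∈ S
    · have : D r = y' r := by funext ω; simp [hD, gapD, hrS]
      rw [this]
      exact ⟨(hS1 r ⟨hrS, hr⟩).1, (hS1 r ⟨hrS, hr⟩).2, hC r hr⟩
    · obtain ⟨h1, h2⟩ := gapL_lt hS hs ht hr hrS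
      have ha := gapL_spec hS hs hr.1
      have hb := gapR_spec hS ht hr.2
      set α := gapL S r
      set β := gapR S r
      have hα : α ∈ Set.Icc s t := ⟨ha.2.2.1, ha.2.1.trans hr.2⟩
      have hβ : β ∈ Set.Icc s t := ⟨hr.1.trans hb.2.1, hb.2.2.1⟩
      have hlt : 0 < β - α := by linarith
      have : D r = fun ω => (y β ω - y α ω) / (β - α) := by
        funext ω; simp [hD, gapD, hrS, hcl, α, β]
      rw [this]
      obtain ⟨k1, k2⟩ := hS2 α ⟨ha.1, hα⟩ β ⟨hb.1, hβ⟩ (by linarith) (fun x hx hxS => by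
        rcases le_total x r with h | h
        · linarith [ha.2.2.2 x hxS h, hx.1]
        · linarith [hb.2.2.2 x hxS h, hx.2])
      refine ⟨((hyi β hβ).sub (hyi α hα)).div_const _, ?_, ?_⟩
      · simp_rw [abs_div, abs_of_pos hlt]
        rw [integral_div, div_le_iff₀ hlt]; exact k1
      · rw [integral_div, div_le_iff₀ hlt, integral_sub (hyi β hβ) (hyi α hα)]; exact k2
  have hprod : Integrable (Function.uncurry D) ((volume.restrict (Set.Ioc s t)).prod ν) := by
    rw [integrable_prod_iff hDm.aestronglyMeasurable]
    refine ⟨(ae_restrict_iff' measurableSet_Ioc).2 (Eventually.of_forall fun r hr =>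
      (hDr r (Set.Ioc_subset_Icc_self hr)).1), ?_⟩
    refine Measure.integrableOn_of_bounded (M := B) (by simp) ?_ ?_
    · exact (hDm.norm.stronglyMeasurable.integral_prod_right').aestronglyMeasurable
    · refine (ae_restrict_iff' measurableSet_Ioc).2 (Eventually.of_forall fun r hr => ?_)
      have := (hDr r (Set.Ioc_subset_Icc_self hr)).2.1
      simp only [Function.uncurry, Real.norm_eq_abs]
      rw [abs_of_nonneg (integral_nonneg fun _ => abs_nonneg _)]
      exact this
  have e1 : (∫ ω, y t ω ∂ν) - ∫ ω, y s ω ∂ν = ∫ ω, (∫ r in Set.Ioc s t, D r ω) ∂ν := by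
    rw [← integral_sub (hyi t ⟨hst, le_rfl⟩) (hyi s ⟨le_rfl, hst⟩)]
    congr 1; funext ω
    rw [← hDint ω, intervalIntegral.integral_of_le hst]
  rw [e1, ← integral_integral_swap hprod]
  calc ∫ r in Set.Ioc s t, ∫ ω, D r ω ∂ν ≤ ∫ r in Set.Ioc s t, C := by
        refine setIntegral_mono_on hprod.integral_prod_left (by simp) measurableSet_Ioc
          (fun r hr => (hDr r (Set.Ioc_subset_Icc_self hr)).2.2)
    _ = C * (t - s) := by simp [hst, mul_comm]

lemma AL {Ω ι : Type*} [MeasurableSpace Ω] (ν : Measure Ω) [SFinite ν] {a b : ℝ}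
    (y y' : ι → ℝ → Ω → ℝ) (C : ι → ℝ)
    (hym : ∀ i, Measurable (Function.uncurry (y i)))
    (hym' : ∀ i, Measurable (Function.uncurry (y' i)))
    (hbd : ∀ i ω, ∃ L, ∀ t ∈ Set.Icc a b, |y' i t ω| ≤ L)
    (hinc : ∀ i ω, ∀ s ∈ Set.Icc a b, ∀ t ∈ Set.Icc a b, s ≤ t →
      ∫ r in s..t, y' i r ω = y i t ω - y i s ω)
    (hyi : ∀ i, ∀ t ∈ Set.Icc a b, Integrable (y i t) ν)
    (hcont : ∀ i, ContinuousOn (fun t => ∫ ω, y i t ω ∂ν) (Set.Icc a b))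
    (hC : ∀ i, ∀ t ∈ Set.Icc a b, ∫ ω, y' i t ω ∂ν ≤ C i)
    (S : ℕ → Set ℝ) (hSc : ∀ n, IsClosed (S n)) (hScov : Set.Icc a b ⊆ ⋃ n, S n)
    (hS1 : ∀ i n, ∃ B, ∀ t ∈ S n ∩ Set.Icc a b, Integrable (y' i t) ν ∧ ∫ ω, |y' i t ω| ∂ν ≤ B)
    (hS2 : ∀ i n, ∃ B, ∀ α ∈ S n ∩ Set.Icc a b, ∀ β ∈ Set.Icc a b, α ≤ β →
      (∀ j, (∫ ω, y j β ω ∂ν) - ∫ ω, y j α ω ∂ν ≤ C j * (β - α)) →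
      ∫ ω, |y i β ω - y i α ω| ∂ν ≤ B * (β - α)) :
    ∀ i, ∀ s ∈ Set.Icc a b, ∀ t ∈ Set.Icc a b, s ≤ t →
      (∫ ω, y i t ω ∂ν) - ∫ ω, y i s ω ∂ν ≤ C i * (t - s) := by
  set m : ι → ℝ → ℝ := fun i t => ∫ ω, y i t ω ∂ν with hm
  set Bad : Set ℝ := Set.Icc a b ∩ {t | ¬ GoodT m C a b t} with hBad
  have hBadc : IsClosed Bad := by
    refine isClosed_Icc.inter ?_
    rw [← isOpen_compl_iff, Metric.isOpen_iff]
    intro t ht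
    simp only [Set.mem_compl_iff, Set.mem_setOf_eq, not_not] at ht
    obtain ⟨δ, hδ, h⟩ := ht
    refine ⟨δ / 2, by positivity, fun t' ht' => ?_⟩
    simp only [Set.mem_compl_iff, Set.mem_setOf_eq, not_not]
    rw [Metric.mem_ball, Real.dist_eq] at ht'
    refine ⟨δ / 2, by positivity, fun t₁ h₁ t₂ h₂ k₁ k₂ hle => h t₁ h₁ t₂ h₂ ?_ ?_ hle⟩
    · calc |t₁ - t| ≤ |t₁ - t'| + |t' - t| := abs_sub_le _ _ _
        _ < δ := by linarith
    · calc |t₂ - t| ≤ |t₂ - t'| + |t' - t| := abs_sub_le _ _ _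
        _ < δ := by linarith
  have hBe : Bad = ∅ := by
    by_contra hne
    have hne := Set.nonempty_iff_ne_empty.2 hne
    haveI : Nonempty Bad := hne.to_subtype
    haveI : CompleteSpace Bad := hBadc.completeSpace_coe
    obtain ⟨n, ⟨t0, ht0⟩⟩ := nonempty_interior_of_iUnion_of_closed
      (f := fun n => (Subtype.val : Bad → ℝ) ⁻¹' S n)
      (fun n => (hSc n).preimage continuous_subtype_val)
      (by
        rw [← Set.preimage_iUnion]
        ext x; simp only [Set.mem_preimage, Set.mem_univ, iff_true]
        exact hScov x.2.1)
    rw [mem_interior_iff_mem_nhds, Metric.mem_nhds_iff] at ht0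
    obtain ⟨ε, hε, hball⟩ := ht0
    have hb : ∀ x ∈ Bad, |x - t0| < ε → x ∈ S n := fun x hx hxt =>
      hball (show (⟨x, hx⟩ : Bad) ∈ Metric.ball t0 ε by
        rw [Metric.mem_ball, Subtype.dist_eq, Real.dist_eq]; exact hxt)
    refine t0.2.2 ⟨ε, hε, fun t₁ h₁ t₂ h₂ k₁ k₂ hle => ?_⟩
    by_cases hemp : ∃ x ∈ Bad, x ∈ Set.Icc t₁ t₂
    swap
    · refine EI_of_good hcont h₁.1 h₂.2 hle (fun t ht => ?_)
      by_contra hg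
      exact hemp ⟨t, ⟨⟨h₁.1.trans ht.1, ht.2.trans h₂.2⟩, hg⟩, ht⟩
    obtain ⟨x, hx, hx12⟩ := hemp
    have hR := gapR_spec hBadc hx hx12.1
    have hL := gapL_spec hBadc hx hx12.2
    set s := gapR Bad t₁
    set t := gapL Bad t₂
    have hst : s ≤ t := hR.2.2.1.trans hL.2.2.1
    have g1 : EI m C t₁ s := EI_of_good_open hcont h₁.1 hR.1.1.2 hR.2.1 (fun r hr => by
      by_contra hg
      exact absurd (hR.2.2.2 r ⟨⟨h₁.1.trans hr.1.le, hr.2.le.trans hR.1.1.2⟩, hg⟩ hr.1.le) (not_le.2 hr.2))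
    have g3 : EI m C t t₂ := EI_of_good_open hcont hL.1.1.1 h₂.2 hL.2.1 (fun r hr => by
      by_contra hg
      exact absurd (hL.2.2.2 r ⟨⟨hL.1.1.1.trans hr.1.le, hr.2.le.trans h₂.2⟩, hg⟩ hr.2.le) (not_le.2 hr.1))
    refine g1.trans (EI.trans ?_ g3)
    have hsub : Set.Icc s t ⊆ Set.Icc a b := Set.Icc_subset_Icc hR.1.1.1 hL.1.1.2
    have hSn : ∀ x ∈ Bad ∩ Set.Icc s t, x ∈ S n := fun x hx => hb x hx.1 (by
      rw [abs_lt] at k₁ k₂ ⊢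
      constructor <;> linarith [hx.2.1, hx.2.2, hR.2.1, hL.2.1])
    intro i
    obtain ⟨B1, hB1⟩ := hS1 i n
    obtain ⟨B2, hB2⟩ := hS2 i n
    refine gap_step ν hst (y i) (y' i) (C i) (max B1 B2) (hym i) (hym' i)
      (fun ω => (hbd i ω).imp fun L h t ht => h t (hsub ht))
      (fun ω r₁ hr₁ r₂ hr₂ => hinc i ω r₁ (hsub hr₁) r₂ (hsub hr₂))
      (fun r hr => hyi i r (hsub hr)) (fun r hr => hC i r (hsub hr)) Bad hBadc hR.1 hL.1 ?_ ?_
    · intro r hr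
      obtain ⟨q1, q2⟩ := hB1 r ⟨hSn r hr, hsub hr.2⟩
      exact ⟨q1, q2.trans (le_max_left _ _)⟩
    · intro α hα β hβ hlt hgap
      have hE : EI m C α β := EI_of_good_open hcont hα.1.1.1 hβ.1.1.2 hlt.le (fun r hr => by
        by_contra hg
        exact hgap r hr ⟨⟨hα.1.1.1.trans hr.1.le, hr.2.le.trans hβ.1.1.2⟩, hg⟩)
      refine ⟨(hB2 α ⟨hSn α hα, hsub hα.2⟩ β (hsub hβ.2) hlt.le hE).trans ?_, hE i⟩
      exact mul_le_mul_of_nonneg_right (le_max_right _ _) (by linarith)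
  intro i s hs t ht hst
  refine EI_of_good hcont hs.1 ht.2 hst (fun r hr => ?_) i
  by_contra hg
  have : r ∈ Bad := ⟨⟨hs.1.trans hr.1, hr.2.trans ht.2⟩, hg⟩
  rw [hBe] at this; exact this

/-- sign function -/
noncomputable def sg (r : ℝ) : ℝ := r / |r|

lemma abs_sg_le (r : ℝ) : |sg r| ≤ 1 := by
  unfold sg
  rw [abs_div, abs_abs]
  exact div_self_le_one _

lemma sg_mul_self (r : ℝ) : sg r * r = |r| := by
  unfold sg
  rcases eq_or_ne r 0 with rfl | h
  · simp
  · have : |r| ≠ 0 := abs_ne_zero.2 h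
    field_simp
    rw [sq_abs]

lemma measurable_sg : Measurable sg := by
  unfold sg
  exact measurable_id.div (by fun_prop)

lemma sg_pos {r : ℝ} (h : 0 < r) : sg r = 1 := by
  unfold sg; rw [abs_of_pos h, div_self h.ne']

lemma sg_neg {r : ℝ} (h : r < 0) : sg r = -1 := by
  unfold sg; rw [abs_of_neg h, div_neg, div_self h.ne]

lemma sg_zero : sg 0 = 0 := by simp [sg]

lemma sg_strictMono {f : ℝ → ℝ} (hf : StrictMono f) (a b : ℝ) : sg (f a - f b) = sg (a - b) := by
  rcases lt_trichotomy a b with h | h | h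
  · rw [sg_neg (sub_neg.2 h), sg_neg (sub_neg.2 (hf h))]
  · subst h; simp
  · rw [sg_pos (sub_pos.2 h), sg_pos (sub_pos.2 (hf h))]

/-- regularised absolute value -/
noncomputable def bt (n : ℕ) (r : ℝ) : ℝ := √(r ^ 2 + (1 / ((n : ℝ) + 1)) ^ 2)
/-- its derivative -/
noncomputable def bt1 (n : ℕ) (r : ℝ) : ℝ := r / bt n r
/-- its second derivative -/
noncomputable def bt2 (n : ℕ) (r : ℝ) : ℝ := (1 / ((n : ℝ) + 1)) ^ 2 / (bt n r) ^ 3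

lemma bt_pos (n : ℕ) (r : ℝ) : 0 < bt n r := by
  unfold bt; positivity

lemma bt_sq (n : ℕ) (r : ℝ) : bt n r ^ 2 = r ^ 2 + (1 / ((n : ℝ) + 1)) ^ 2 := by
  unfold bt; rw [Real.sq_sqrt]; positivity

lemma bt_hasDerivAt (n : ℕ) (r : ℝ) : HasDerivAt (bt n) (bt1 n r) r := by
  have h : HasDerivAt (fun r : ℝ => r ^ 2 + (1 / ((n : ℝ) + 1)) ^ 2) (2 * r) r := by
    simpa using (hasDerivAt_pow 2 r).add_const ((1 / ((n : ℝ) + 1)) ^ 2)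
  have := h.sqrt (by positivity)
  refine this.congr_deriv ?_
  unfold bt1 bt
  have : 0 < √(r ^ 2 + (1 / ((n : ℝ) + 1)) ^ 2) := by positivity
  field_simp

lemma bt1_hasDerivAt (n : ℕ) (r : ℝ) : HasDerivAt (bt1 n) (bt2 n r) r := by
  have := (hasDerivAt_id r).div (bt_hasDerivAt n r) (bt_pos n r).ne'
  refine this.congr_deriv ?_
  symm
  unfold bt2 bt1
  have h := bt_pos n r
  have h2 := bt_sq n r
  rw [div_eq_div_iff (by positivity) (by positivity)]
  simp only [id]
  have : (1 * bt n r - r * (r / bt n r)) = (bt n r ^ 2 - r ^ 2) / bt n r := by field_simp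
  have e : bt n r ^ 2 - r ^ 2 = (1 / ((n : ℝ) + 1)) ^ 2 := by linarith
  rw [this, e]; field_simp

lemma bt_cont (n : ℕ) : Continuous (bt n) := by unfold bt; fun_prop
lemma bt1_cont (n : ℕ) : Continuous (bt1 n) := by
  unfold bt1; exact continuous_id.div (bt_cont n) (fun r => (bt_pos n r).ne')
lemma bt2_cont (n : ℕ) : Continuous (bt2 n) := by
  unfold bt2; exact continuous_const.div ((bt_cont n).pow 3) (fun r => pow_ne_zero 3 (bt_pos n r).ne')
lemma bt2_nonneg (n : ℕ) (r : ℝ) : 0 ≤ bt2 n r := by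
  unfold bt2; have := bt_pos n r; positivity

lemma abs_le_bt (n : ℕ) (r : ℝ) : |r| ≤ bt n r := by
  unfold bt; rw [← Real.sqrt_sq_eq_abs]; apply Real.sqrt_le_sqrt; nlinarith [sq_nonneg (1 / ((n : ℝ) + 1))]

lemma bt_le (n : ℕ) (r : ℝ) : bt n r ≤ |r| + 1 := by
  have h1 : (1 / ((n : ℝ) + 1)) ≤ 1 := by
    rw [div_le_one (by positivity)]; linarith [n.cast_nonneg (α := ℝ)]
  have h0 : 0 ≤ (1 / ((n : ℝ) + 1)) := by positivity
  unfold bt; rw [Real.sqrt_le_left (by positivity)]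
  nlinarith [abs_nonneg r, sq_abs r]

lemma abs_bt1_le (n : ℕ) (r : ℝ) : |bt1 n r| ≤ 1 := by
  unfold bt1; rw [abs_div, abs_of_pos (bt_pos n r)]
  exact (div_le_one (bt_pos n r)).2 (abs_le_bt n r)

lemma bt_tendsto (r : ℝ) : Tendsto (fun n => bt n r) atTop (nhds |r|) := by
  have h : Tendsto (fun n : ℕ => 1 / ((n : ℝ) + 1)) atTop (nhds 0) := tendsto_one_div_add_atTop_nhds_zero_nat
  have h2 := ((h.pow 2).const_add (r ^ 2)).sqrt
  simpa [bt, Real.sqrt_sq_eq_abs] using h2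

lemma bt1_tendsto (r : ℝ) : Tendsto (fun n => bt1 n r) atTop (nhds (sg r)) := by
  rcases eq_or_ne r 0 with rfl | h
  · simp [bt1, sg]
  · exact tendsto_const_nhds.div (bt_tendsto r) (abs_ne_zero.2 h)

lemma cs_int {f : ℝ → ℝ} {ℓ : ℝ} (hf : Continuous f) (hs : ∀ x, ℓ < |x| → f x = 0) : Integrable f := by
  apply hf.integrable_of_hasCompactSupport
  refine HasCompactSupport.of_support_subset_isCompact (K := Set.Icc (-ℓ) ℓ) isCompact_Icc ?_
  intro x hx
  by_contra h
  apply hx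
  apply hs
  by_contra h'
  exact h (abs_le.1 (not_lt.1 h'))

lemma int_zero {F F' : ℝ → ℝ} {ℓ : ℝ} (hF : ∀ x, HasDerivAt F (F' x) x) (hc : Continuous F')
    (hs : ∀ x, ℓ < |x| → F x = 0) : ∫ x, F' x = 0 := by
  have hFc : Continuous F := continuous_iff_continuousAt.2 fun x => (hF x).continuousAt
  refine integral_eq_zero_of_hasDerivAt_of_integrable hF (cs_int (ℓ := ℓ) hc fun x hx => ?_) (cs_int hFc hs)
  have : F =ᶠ[nhds x] fun _ => 0 := by
    have : {z : ℝ | ℓ < |z|} ∈ nhds x := (isOpen_lt continuous_const continuous_abs).mem_nhds hx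
    filter_upwards [this] with z hz using hs z hz
  exact (hF x).unique ((hasDerivAt_const x (0 : ℝ)).congr_of_eventuallyEq this)

/-- `w` is C² with derivatives `w1, w2` -/
structure D2 (w w1 w2 : ℝ → ℝ) : Prop where
  d1 : ∀ x, HasDerivAt w (w1 x) x
  d2 : ∀ x, HasDerivAt w1 (w2 x) x
  c2 : Continuous w2

lemma D2.c1 {w w1 w2 : ℝ → ℝ} (h : D2 w w1 w2) : Continuous w1 :=
  continuous_iff_continuousAt.2 fun x => (h.d2 x).continuousAt
lemma D2.c0 {w w1 w2 : ℝ → ℝ} (h : D2 w w1 w2) : Continuous w :=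
  continuous_iff_continuousAt.2 fun x => (h.d1 x).continuousAt
lemma D2.sub {w w1 w2 v v1 v2 : ℝ → ℝ} (h : D2 w w1 w2) (h' : D2 v v1 v2) :
    D2 (fun x => w x - v x) (fun x => w1 x - v1 x) (fun x => w2 x - v2 x) :=
  ⟨fun x => (h.d1 x).sub (h'.d1 x), fun x => (h.d2 x).sub (h'.d2 x), h.c2.sub h'.c2⟩
lemma D2.shift {w w1 w2 : ℝ → ℝ} (h : D2 w w1 w2) (c : ℝ) :
    D2 (fun x => w (x + c)) (fun x => w1 (x + c)) (fun x => w2 (x + c)) :=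
  ⟨fun x => (h.d1 (x + c)).comp_add_const x c, fun x => (h.d2 (x + c)).comp_add_const x c,
    h.c2.comp (by fun_prop)⟩

/-- cutoff functions: vanish outside `[-ℓ, ℓ]` with derivatives controlled by `D` -/
structure Cut (ζ ζ1 ζ2 : ℝ → ℝ) (ℓ D : ℝ) : Prop extends D2 ζ ζ1 ζ2 where
  z0 : ∀ x, ℓ < |x| → ζ x = 0
  z1 : ∀ x, ℓ < |x| → ζ1 x = 0
  z2 : ∀ x, ℓ < |x| → ζ2 x = 0
  nn : ∀ x, 0 ≤ ζ x
  le1 : ∀ x, ζ x ≤ 1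
  b1 : ∀ x, |ζ1 x| ≤ D
  b2 : ∀ x, |ζ2 x| ≤ D ^ 2
  hℓ : 0 < ℓ
  hD : 0 < D

section fixed
variable {χ χ1 χ2 w w1 w2 : ℝ → ℝ} {ℓ : ℝ}

lemma kato_gen (hχ : D2 χ χ1 χ2) (hs : ∀ x, ℓ < |x| → χ x = 0) (hs1 : ∀ x, ℓ < |x| → χ1 x = 0)
    (hs2 : ∀ x, ℓ < |x| → χ2 x = 0)
    (hw : D2 w w1 w2) {β β1 β2 : ℝ → ℝ} (hβ : D2 β β1 β2) :
    ∫ x, χ x * (β1 (w x) * w2 x) = (∫ x, χ2 x * β (w x)) - ∫ x, χ x * (β2 (w x) * w1 x ^ 2) := by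
  have c := hχ.c0; have c1 := hχ.c1; have c2 := hχ.c2
  have d := hw.c0; have d1 := hw.c1; have d2 := hw.c2
  have b0 := hβ.c0; have b1 := hβ.c1; have b2 := hβ.c2
  have h1 := int_zero (ℓ := ℓ) (F := fun x => χ x * (β1 (w x) * w1 x) - χ1 x * β (w x))
    (F' := fun x => (χ1 x * (β1 (w x) * w1 x) + χ x * (β2 (w x) * w1 x * w1 x + β1 (w x) * w2 x))
      - (χ2 x * β (w x) + χ1 x * (β1 (w x) * w1 x)))
    (fun x => ((hχ.d1 x).mul (((hβ.d2 (w x)).comp x (hw.d1 x)).mul (hw.d2 x))).sub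
      ((hχ.d2 x).mul ((hβ.d1 (w x)).comp x (hw.d1 x)))) (by fun_prop)
    (fun x hx => by simp [hs x hx, hs1 x hx])
  have i1 : Integrable (fun x => χ x * (β1 (w x) * w2 x)) :=
    cs_int (ℓ := ℓ) (by fun_prop) (fun x hx => by simp [hs x hx])
  have i2 : Integrable (fun x => χ2 x * β (w x)) :=
    cs_int (ℓ := ℓ) (by fun_prop) (fun x hx => by simp [hs2 x hx])
  have i3 : Integrable (fun x => χ x * (β2 (w x) * w1 x ^ 2)) :=
    cs_int (ℓ := ℓ) (by fun_prop) (fun x hx => by simp [hs x hx])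
  have e : (fun x => (χ1 x * (β1 (w x) * w1 x) + χ x * (β2 (w x) * w1 x * w1 x + β1 (w x) * w2 x))
      - (χ2 x * β (w x) + χ1 x * (β1 (w x) * w1 x))) = fun x =>
      (χ x * (β1 (w x) * w2 x) - χ2 x * β (w x)) + χ x * (β2 (w x) * w1 x ^ 2) := by
    funext x; ring
  rw [e] at h1
  have i12 : Integrable (fun x => χ x * (β1 (w x) * w2 x) - χ2 x * β (w x)) := i1.sub i2
  rw [integral_add i12 i3, integral_sub i1 i2] at h1
  linarith

lemma kato_abs (hχ : D2 χ χ1 χ2) (hs : ∀ x, ℓ < |x| → χ x = 0) (hs1 : ∀ x, ℓ < |x| → χ1 x = 0)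
    (hs2 : ∀ x, ℓ < |x| → χ2 x = 0) (hn : ∀ x, 0 ≤ χ x) (hw : D2 w w1 w2) :
    ∫ x, χ x * (sg (w x) * w2 x) ≤ ∫ x, χ2 x * |w x| := by
  have c := hχ.c0; have c1 := hχ.c1; have c2 := hχ.c2
  have d := hw.c0; have d1 := hw.c1; have d2 := hw.c2
  have t1 : Tendsto (fun n => ∫ x, χ x * (bt1 n (w x) * w2 x)) atTop
      (nhds (∫ x, χ x * (sg (w x) * w2 x))) := by
    refine tendsto_integral_of_dominated_convergence (fun x => |χ x * w2 x|) ?_ ?_ ?_ ?_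
    · intro n
      have := (bt1_cont n).comp d
      exact (c.mul (this.mul d2)).aestronglyMeasurable
    · exact (cs_int (ℓ := ℓ) (by fun_prop) (fun x hx => by simp [hs x hx])).abs
    · intro n; refine Eventually.of_forall fun x => ?_
      rw [Real.norm_eq_abs, abs_mul, abs_mul, abs_mul]
      have := abs_bt1_le n (w x)
      have h1 := abs_nonneg (χ x); have h2 := abs_nonneg (w2 x)
      calc |χ x| * (|bt1 n (w x)| * |w2 x|) ≤ |χ x| * (1 * |w2 x|) := by gcongr
        _ = _ := by ring
    · exact Eventually.of_forall fun x => ((bt1_tendsto (w x)).mul_const _).const_mul _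
  have t2 : Tendsto (fun n => ∫ x, χ2 x * bt n (w x)) atTop (nhds (∫ x, χ2 x * |w x|)) := by
    refine tendsto_integral_of_dominated_convergence (fun x => |χ2 x| * (|w x| + 1)) ?_ ?_ ?_ ?_
    · intro n
      exact (c2.mul ((bt_cont n).comp d)).aestronglyMeasurable
    · exact (cs_int (ℓ := ℓ) (by fun_prop) (fun x hx => by simp [hs2 x hx]))
    · intro n; refine Eventually.of_forall fun x => ?_
      rw [Real.norm_eq_abs, abs_mul, abs_of_pos (bt_pos n (w x))]
      exact mul_le_mul_of_nonneg_left (bt_le n _) (abs_nonneg _)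
    · exact Eventually.of_forall fun x => (bt_tendsto (w x)).const_mul _
  refine le_of_tendsto_of_tendsto' t1 t2 (fun n => ?_)
  rw [kato_gen hχ hs hs1 hs2 hw ⟨bt_hasDerivAt n, bt1_hasDerivAt n, bt2_cont n⟩]
  have : 0 ≤ ∫ x, χ x * (bt2 n (w x) * w1 x ^ 2) :=
    integral_nonneg fun x => mul_nonneg (hn x) (mul_nonneg (bt2_nonneg n _) (sq_nonneg _))
  linarith

lemma flux_gen (hχ : ∀ x, HasDerivAt χ (χ1 x) x) (c1 : Continuous χ1) (hs : ∀ x, ℓ < |x| → χ x = 0)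
    (hs1 : ∀ x, ℓ < |x| → χ1 x = 0) (hw : ∀ x, HasDerivAt w (w1 x) x) (d1 : Continuous w1)
    {β β1 : ℝ → ℝ} (hβ : ∀ x, HasDerivAt β (β1 x) x) (hb1 : Continuous β1) :
    ∫ x, χ x * (β1 (w x) * w1 x) = - ∫ x, χ1 x * β (w x) := by
  have c : Continuous χ := continuous_iff_continuousAt.2 fun x => (hχ x).continuousAt
  have d : Continuous w := continuous_iff_continuousAt.2 fun x => (hw x).continuousAt
  have b0 : Continuous β := continuous_iff_continuousAt.2 fun x => (hβ x).continuousAt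
  have h1 := int_zero (ℓ := ℓ) (F := fun x => χ x * β (w x))
    (F' := fun x => χ1 x * β (w x) + χ x * (β1 (w x) * w1 x))
    (fun x => (hχ x).mul ((hβ (w x)).comp x (hw x))) (by fun_prop)
    (fun x hx => by simp [hs x hx])
  have i1 : Integrable (fun x => χ x * (β1 (w x) * w1 x)) :=
    cs_int (ℓ := ℓ) (by fun_prop) (fun x hx => by simp [hs x hx])
  have i2 : Integrable (fun x => χ1 x * β (w x)) :=
    cs_int (ℓ := ℓ) (by fun_prop) (fun x hx => by simp [hs1 x hx])
  rw [integral_add i2 i1] at h1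
  linarith

lemma flux_abs (hχ : ∀ x, HasDerivAt χ (χ1 x) x) (c1 : Continuous χ1) (hs : ∀ x, ℓ < |x| → χ x = 0)
    (hs1 : ∀ x, ℓ < |x| → χ1 x = 0) (hw : ∀ x, HasDerivAt w (w1 x) x) (d1 : Continuous w1) :
    ∫ x, χ x * (sg (w x) * w1 x) = - ∫ x, χ1 x * |w x| := by
  have c : Continuous χ := continuous_iff_continuousAt.2 fun x => (hχ x).continuousAt
  have d : Continuous w := continuous_iff_continuousAt.2 fun x => (hw x).continuousAt
  have t1 : Tendsto (fun n => ∫ x, χ x * (bt1 n (w x) * w1 x)) atTop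
      (nhds (∫ x, χ x * (sg (w x) * w1 x))) := by
    refine tendsto_integral_of_dominated_convergence (fun x => |χ x * w1 x|) ?_ ?_ ?_ ?_
    · intro n
      have := (bt1_cont n).comp d
      exact (c.mul (this.mul d1)).aestronglyMeasurable
    · exact (cs_int (ℓ := ℓ) (by fun_prop) (fun x hx => by simp [hs x hx])).abs
    · intro n; refine Eventually.of_forall fun x => ?_
      rw [Real.norm_eq_abs, abs_mul, abs_mul, abs_mul]
      have := abs_bt1_le n (w x)
      have h1 := abs_nonneg (χ x); have h2 := abs_nonneg (w1 x)
      calc |χ x| * (|bt1 n (w x)| * |w1 x|) ≤ |χ x| * (1 * |w1 x|) := by gcongr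
        _ = _ := by ring
    · exact Eventually.of_forall fun x => ((bt1_tendsto (w x)).mul_const _).const_mul _
  have t2 : Tendsto (fun n => ∫ x, χ1 x * bt n (w x)) atTop (nhds (∫ x, χ1 x * |w x|)) := by
    refine tendsto_integral_of_dominated_convergence (fun x => |χ1 x| * (|w x| + 1)) ?_ ?_ ?_ ?_
    · intro n
      exact (c1.mul ((bt_cont n).comp d)).aestronglyMeasurable
    · exact (cs_int (ℓ := ℓ) (by fun_prop) (fun x hx => by simp [hs1 x hx]))
    · intro n; refine Eventually.of_forall fun x => ?_
      rw [Real.norm_eq_abs, abs_mul, abs_of_pos (bt_pos n (w x))]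
      exact mul_le_mul_of_nonneg_left (bt_le n _) (abs_nonneg _)
    · exact Eventually.of_forall fun x => (bt_tendsto (w x)).const_mul _
  refine tendsto_nhds_unique t1 ((t2.neg).congr fun n => ?_)
  exact (flux_gen hχ c1 hs hs1 hw d1 (bt_hasDerivAt n) (bt1_cont n)).symm

end fixed

lemma sg_time {c c1 : ℝ → ℝ} {s t : ℝ} (hst : s ≤ t) (d : ContinuousOn c (Set.Icc s t))
    (hc : ∀ r ∈ Set.Ioo s t, HasDerivAt c (c1 r) r)
    (h1 : ContinuousOn c1 (Set.Icc s t)) :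
    ∫ r in s..t, sg (c r) * c1 r = |c t| - |c s| := by
  have hu : Set.uIcc s t = Set.Icc s t := Set.uIcc_of_le hst
  have hI : Set.uIoc s t ⊆ Set.Icc s t := by rw [Set.uIoc_of_le hst]; exact Set.Ioc_subset_Icc_self
  have t1 : Tendsto (fun n => ∫ r in s..t, bt1 n (c r) * c1 r) atTop
      (nhds (∫ r in s..t, sg (c r) * c1 r)) := by
    refine intervalIntegral.tendsto_integral_filter_of_dominated_convergence (fun r => |c1 r|) ?_ ?_ ?_ ?_
    · refine Eventually.of_forall fun n => ?_
      have : ContinuousOn (fun r => bt1 n (c r) * c1 r) (Set.Icc s t) :=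
        ((bt1_cont n).comp_continuousOn d).mul h1
      exact (this.mono hI).aestronglyMeasurable measurableSet_uIoc
    · refine Eventually.of_forall fun n => Eventually.of_forall fun r _ => ?_
      rw [Real.norm_eq_abs, abs_mul]
      calc _ ≤ 1 * |c1 r| := mul_le_mul_of_nonneg_right (abs_bt1_le n _) (abs_nonneg _)
        _ = _ := one_mul _
    · apply ContinuousOn.intervalIntegrable; rw [hu]; exact h1.abs
    · exact Eventually.of_forall fun r _ => (bt1_tendsto (c r)).mul_const _
  refine tendsto_nhds_unique t1 (((bt_tendsto (c t)).sub (bt_tendsto (c s))).congr fun n => ?_)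
  symm
  refine intervalIntegral.integral_eq_sub_of_hasDerivAt_of_le (f := fun r => bt n (c r)) hst
    ((bt_cont n).comp_continuousOn d) ?_ ?_
  · intro r hr
    exact (bt_hasDerivAt n (c r)).comp r (hc r hr)
  · apply ContinuousOn.intervalIntegrable; rw [hu]
    exact ((bt1_cont n).comp_continuousOn d).mul h1

/-- primitive vanishing at zero -/
noncomputable def prim (g : ℝ → ℝ) (r : ℝ) : ℝ := ∫ s in (0:ℝ)..r, g s

lemma prim_hasDerivAt {g : ℝ → ℝ} (hg : Continuous g) (r : ℝ) : HasDerivAt (prim g) (g r) r :=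
  intervalIntegral.integral_hasDerivAt_right (hg.intervalIntegrable _ _)
    (hg.stronglyMeasurableAtFilter _ _) hg.continuousAt

lemma prim_cont {g : ℝ → ℝ} (hg : Continuous g) : Continuous (prim g) :=
  continuous_iff_continuousAt.2 fun x => (prim_hasDerivAt hg x).continuousAt

lemma prim_bound {g : ℝ → ℝ} {C r : ℝ} (h : ∀ s, |s| ≤ |r| → |g s| ≤ C) : |prim g r| ≤ C * |r| := by
  have := intervalIntegral.norm_integral_le_of_norm_le_const (a := 0) (b := r) (f := g) (C := C)
    (fun x hx => by
      apply h
      rcases le_total 0 r with h0 | h0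
      · rw [Set.uIoc_of_le h0] at hx
        rw [abs_of_nonneg h0, abs_of_pos hx.1]; exact hx.2
      · rw [Set.uIoc_of_ge h0] at hx
        rw [abs_of_nonpos h0, abs_of_nonpos hx.2]; linarith [hx.1])
  simpa [prim] using this

/-- power weight -/
noncomputable def pw (q r : ℝ) : ℝ := |r| ^ (q - 1)

lemma pw_cont {q : ℝ} (hq : 1 < q) : Continuous (pw q) := by
  unfold pw; exact continuous_abs.rpow_const (fun x => Or.inr (by linarith))

lemma pw_nonneg (q r : ℝ) : 0 ≤ pw q r := Real.rpow_nonneg (abs_nonneg _) _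

lemma pw_mono {q : ℝ} (hq : 1 < q) {s r : ℝ} (h : |s| ≤ |r|) : pw q s ≤ pw q r :=
  Real.rpow_le_rpow (abs_nonneg _) h (by linarith)

lemma pw_pos (q : ℝ) {r : ℝ} (h : r ≠ 0) : 0 < pw q r := Real.rpow_pos_of_pos (abs_pos.2 h) _

/-- flux -/
noncomputable def fl (q : ℝ) : ℝ → ℝ := prim (pw q)

lemma fl_hasDerivAt {q : ℝ} (hq : 1 < q) (r : ℝ) : HasDerivAt (fl q) (pw q r) r :=
  prim_hasDerivAt (pw_cont hq) r

lemma fl_bound {q : ℝ} (hq : 1 < q) (r : ℝ) : |fl q r| ≤ pw q r * |r| :=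
  prim_bound fun s hs => by rw [abs_of_nonneg (pw_nonneg q s)]; exact pw_mono hq hs

lemma fl_strictMono {q : ℝ} (hq : 1 < q) : StrictMono (fl q) := by
  have hc : Continuous (fl q) := prim_cont (pw_cont hq)
  have h1 : StrictMonoOn (fl q) (Set.Iic 0) := by
    refine strictMonoOn_of_deriv_pos (convex_Iic 0) hc.continuousOn (fun x hx => ?_)
    rw [interior_Iic] at hx
    rw [(fl_hasDerivAt hq x).deriv]; exact pw_pos q (ne_of_lt hx)
  have h2 : StrictMonoOn (fl q) (Set.Ici 0) := by
    refine strictMonoOn_of_deriv_pos (convex_Ici 0) hc.continuousOn (fun x hx => ?_)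
    rw [interior_Ici] at hx
    rw [(fl_hasDerivAt hq x).deriv]; exact pw_pos q (ne_of_gt hx)
  exact h1.Iic_union_Ici h2

/-- second derivative of the entropy -/
noncomputable def th2 (q r : ℝ) : ℝ := (1 + r ^ 2) ^ (q - 5 / 2)
/-- derivative of the entropy -/
noncomputable def th1 (q : ℝ) : ℝ → ℝ := prim (th2 q)
/-- entropy -/
noncomputable def th0 (q : ℝ) : ℝ → ℝ := prim (th1 q)
/-- entropy flux -/
noncomputable def thG (q : ℝ) : ℝ → ℝ := prim (fun s => th1 q s * pw q s)
/-- bound of `th1` -/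
noncomputable def thB (q : ℝ) : ℝ := ∫ r, th2 q r

lemma th2_cont (q : ℝ) : Continuous (th2 q) := by
  unfold th2
  exact Continuous.rpow_const (by fun_prop) (fun x => Or.inl (by positivity))

lemma th2_nonneg (q r : ℝ) : 0 ≤ th2 q r := by unfold th2; positivity

lemma th2_int {q : ℝ} (hq : q < 2) : Integrable (th2 q) := by
  have := integrable_rpow_neg_one_add_norm_sq (E := ℝ) (μ := volume) (r := 5 - 2 * q)
    (by simp; linarith)
  refine this.congr (Eventually.of_forall fun x => ?_)
  simp only [th2, Real.norm_eq_abs, sq_abs]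
  congr 1; ring

lemma thB_nonneg (q : ℝ) : 0 ≤ thB q := integral_nonneg fun r => th2_nonneg q r

lemma th1_bound {q : ℝ} (hq : q < 2) (r : ℝ) : |th1 q r| ≤ thB q := by
  have h := intervalIntegral.norm_integral_le_integral_norm_uIoc (a := 0) (b := r) (f := th2 q) (μ := volume)
  refine h.trans ?_
  refine (setIntegral_le_integral (th2_int hq).norm (Eventually.of_forall fun x => norm_nonneg _)).trans ?_
  unfold thB
  apply le_of_eq; congr 1; funext x; rw [Real.norm_eq_abs, abs_of_nonneg (th2_nonneg q x)]

lemma th1_cont (q : ℝ) : Continuous (th1 q) := prim_cont (th2_cont q)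
lemma th0_D2 (q : ℝ) : D2 (th0 q) (th1 q) (th2 q) :=
  ⟨prim_hasDerivAt (th1_cont q), prim_hasDerivAt (th2_cont q), th2_cont q⟩
lemma th0_bound {q : ℝ} (hq : q < 2) (r : ℝ) : |th0 q r| ≤ thB q * |r| :=
  prim_bound fun s _ => th1_bound hq s
lemma th0_lip {q : ℝ} (hq : q < 2) (r s : ℝ) : |th0 q r - th0 q s| ≤ thB q * |r - s| := by
  have := Convex.norm_image_sub_le_of_norm_hasDerivWithin_le (f := th0 q) (f' := th1 q) (s := Set.univ)
    (C := thB q) (x := s) (y := r) (fun x _ => ((th0_D2 q).d1 x).hasDerivWithinAt)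
    (fun x _ => th1_bound hq x) convex_univ trivial trivial
  simpa using this
lemma thG_hasDerivAt {q : ℝ} (hq : 1 < q) (r : ℝ) : HasDerivAt (thG q) (th1 q r * pw q r) r :=
  prim_hasDerivAt ((th1_cont q).mul (pw_cont hq)) r
lemma thG_bound {q : ℝ} (hq1 : 1 < q) (hq : q < 2) (r : ℝ) : |thG q r| ≤ thB q * (pw q r * |r|) := by
  rw [← mul_assoc]
  refine prim_bound fun s hs => ?_
  rw [abs_mul, abs_of_nonneg (pw_nonneg q s)]
  exact mul_le_mul (th1_bound hq s) (pw_mono hq1 hs) (pw_nonneg q s) (thB_nonneg q)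

/-- auxiliary power -/
noncomputable def pp (q r : ℝ) : ℝ := (1 + r ^ 2) ^ ((q - 1) / 2)
/-- derivative of the auxiliary power -/
noncomputable def pp1 (q r : ℝ) : ℝ := 2 * r * ((q - 1) / 2) * (1 + r ^ 2) ^ ((q - 1) / 2 - 1)

lemma pp_hasDerivAt (q r : ℝ) : HasDerivAt (pp q) (pp1 q r) r := by
  have h : HasDerivAt (fun r : ℝ => 1 + r ^ 2) (2 * r) r := by
    simpa using (hasDerivAt_pow 2 r).const_add 1
  exact h.rpow_const (Or.inl (by positivity))

lemma pp1_cont (q : ℝ) : Continuous (pp1 q) := by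
  unfold pp1
  exact Continuous.mul (by fun_prop)
    (Continuous.rpow_const (by fun_prop) (fun x => Or.inl (by positivity)))

lemma pp_nonneg (q r : ℝ) : 0 ≤ pp q r := by unfold pp; positivity

lemma pw_le_pp {q : ℝ} (hq : 1 < q) (r : ℝ) : pw q r ≤ pp q r := by
  unfold pw pp
  have : |r| ^ (q - 1) = (r ^ 2) ^ ((q - 1) / 2) := by
    rw [← sq_abs, ← Real.rpow_natCast, ← Real.rpow_mul (abs_nonneg r)]
    congr 1; push_cast; ring
  rw [this]
  exact Real.rpow_le_rpow (by positivity) (by linarith) (by linarith)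

lemma pp_le {q : ℝ} (hq : q < 2) (r : ℝ) : pp q r ≤ 1 + |r| := by
  unfold pp
  calc (1 + r ^ 2) ^ ((q - 1) / 2) ≤ (1 + r ^ 2) ^ ((1 : ℝ) / 2) :=
        Real.rpow_le_rpow_of_exponent_le (by nlinarith [sq_nonneg r]) (by linarith)
    _ = √(1 + r ^ 2) := (Real.sqrt_eq_rpow _).symm
    _ ≤ 1 + |r| := by
      rw [Real.sqrt_le_left (by positivity)]; nlinarith [abs_nonneg r, sq_abs r]

lemma pp1_sq {q : ℝ} (hq1 : 1 < q) (hq : q < 2) (r : ℝ) : pp1 q r ^ 2 ≤ (1 + |r|) * th2 q r := by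
  have hp : (0:ℝ) < 1 + r ^ 2 := by positivity
  have e1 : ((1 + r ^ 2) ^ ((q - 1) / 2 - 1)) ^ 2 * (1 + r ^ 2) = (1 + r ^ 2) ^ (q - 2) := by
    rw [← Real.rpow_natCast, ← Real.rpow_mul hp.le]
    nth_rewrite 2 [← Real.rpow_one (1 + r ^ 2)]
    rw [← Real.rpow_add hp]; congr 1; push_cast; ring
  have e2 : (1 + r ^ 2) ^ (q - 2) = √(1 + r ^ 2) * th2 q r := by
    unfold th2
    rw [Real.sqrt_eq_rpow, ← Real.rpow_add hp]; congr 1; ring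
  have e3 : √(1 + r ^ 2) ≤ 1 + |r| := by
    rw [Real.sqrt_le_left (by positivity)]; nlinarith [abs_nonneg r, sq_abs r]
  have hq' : (q - 1) ^ 2 ≤ 1 := by nlinarith
  set X := (1 + r ^ 2) ^ ((q - 1) / 2 - 1)
  have : pp1 q r ^ 2 = (q - 1) ^ 2 * (X ^ 2 * r ^ 2) := by unfold pp1; ring
  rw [this]
  calc (q - 1) ^ 2 * (X ^ 2 * r ^ 2) ≤ 1 * (X ^ 2 * (1 + r ^ 2)) := by
        gcongr; linarith
    _ = √(1 + r ^ 2) * th2 q r := by rw [one_mul, e1, e2]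
    _ ≤ _ := mul_le_mul_of_nonneg_right e3 (th2_nonneg q r)

lemma sup_le_int {F F' : ℝ → ℝ} {ℓ : ℝ} (hF : ∀ x, HasDerivAt F (F' x) x) (hc : Continuous F')
    (hi : Integrable F') (hs : ∀ x, ℓ < |x| → F x = 0) (x : ℝ) : F x ≤ ∫ y, |F' y| := by
  set c : ℝ := -(|x| + |ℓ| + 1) with hcd
  have hcx : c ≤ x := by have := neg_abs_le x; have := abs_nonneg ℓ; linarith
  have hFc : F c = 0 := hs c (by
    rw [hcd, abs_neg, abs_of_pos (by positivity)]; linarith [le_abs_self ℓ, abs_nonneg x])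
  have h1 := intervalIntegral.integral_eq_sub_of_hasDerivAt (a := c) (b := x) (fun y _ => hF y)
    (hc.intervalIntegrable _ _)
  rw [hFc, sub_zero] at h1
  rw [← h1, intervalIntegral.integral_of_le hcx]
  calc ∫ y in Set.Ioc c x, F' y ≤ ∫ y in Set.Ioc c x, |F' y| :=
        setIntegral_mono hi.integrableOn hi.abs.integrableOn (fun y => le_abs_self _)
    _ ≤ _ := setIntegral_le_integral hi.abs (Eventually.of_forall fun y => abs_nonneg _)

lemma absorb {q : ℝ} (hq1 : 1 < q) (hq : q < 2) {ζ ζ1 ζ2 : ℝ → ℝ} {ℓ D : ℝ} (hζ : Cut ζ ζ1 ζ2 ℓ D)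
    {z z1 z2 : ℝ → ℝ} (hz : D2 z z1 z2) (hi : Integrable z) {M : ℝ} (hM : ∫ x, |z x| ≤ M)
    {κ : ℝ} (hκ : 0 < κ) :
    ∫ x, ζ x * (pw q (z x) * |z x|) ≤
      M * (D * (2 * ℓ + M) + (2 * ℓ + M) / (2 * κ) + κ / 2 * ∫ x, ζ x ^ 2 * (th2 q (z x) * z1 x ^ 2)) := by
  have c := hζ.c0; have c1 := hζ.c1
  have d := hz.c0; have d1 := hz.c1
  have hpp : Continuous (pp q) := continuous_iff_continuousAt.2 fun x => (pp_hasDerivAt q x).continuousAt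
  have hpp1 := pp1_cont q
  have hpw := pw_cont hq1
  have hth := th2_cont q
  have hM0 : 0 ≤ M := (integral_nonneg fun x => abs_nonneg _).trans hM
  have hFi : Integrable (fun x => ζ1 x * pp q (z x) + ζ x * (pp1 q (z x) * z1 x)) :=
    cs_int (ℓ := ℓ) (by fun_prop) (fun x hx => by simp [hζ.z0 x hx, hζ.z1 x hx])
  have i3 : Integrable (fun x => ζ x ^ 2 * (th2 q (z x) * z1 x ^ 2)) :=
    cs_int (ℓ := ℓ) (by fun_prop) (fun x hx => by simp [hζ.z0 x hx])
  set 𝓔 := ∫ x, ζ x ^ 2 * (th2 q (z x) * z1 x ^ 2) with h𝓔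
  set Q := D * (2 * ℓ + M) + (2 * ℓ + M) / (2 * κ) + κ / 2 * 𝓔 with hQ
  have hbound : ∀ x, |ζ1 x * pp q (z x) + ζ x * (pp1 q (z x) * z1 x)| ≤
      (D + 1 / (2 * κ)) * ((Set.Icc (-ℓ) ℓ).indicator (fun _ => (1:ℝ)) x + |z x|)
        + κ / 2 * (ζ x ^ 2 * (th2 q (z x) * z1 x ^ 2)) := by
    intro x
    have hD := hζ.hD
    have hE : 0 ≤ ζ x ^ 2 * (th2 q (z x) * z1 x ^ 2) :=
      mul_nonneg (sq_nonneg _) (mul_nonneg (th2_nonneg q _) (sq_nonneg _))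
    by_cases hx : ℓ < |x|
    · rw [hζ.z0 x hx, hζ.z1 x hx]
      have : (0:ℝ) ≤ (Set.Icc (-ℓ) ℓ).indicator (fun _ => (1:ℝ)) x :=
        Set.indicator_nonneg (fun _ _ => zero_le_one) x
      simp only [zero_mul, add_zero, abs_zero, ne_eq, OfNat.ofNat_ne_zero, not_false_eq_true, zero_pow, mul_zero]
      positivity
    · have hmem : x ∈ Set.Icc (-ℓ) ℓ := abs_le.1 (not_lt.1 hx)
      rw [Set.indicator_of_mem hmem]
      have a1 : |ζ1 x * pp q (z x)| ≤ D * (1 + |z x|) := by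
        rw [abs_mul, abs_of_nonneg (pp_nonneg q _)]
        exact mul_le_mul (hζ.b1 x) (pp_le hq _) (pp_nonneg q _) hD.le
      have a2 : |ζ x * (pp1 q (z x) * z1 x)| ≤
          (1 + |z x|) / (2 * κ) + κ / 2 * (ζ x ^ 2 * (th2 q (z x) * z1 x ^ 2)) := by
        apply abs_le_of_sq_le_sq _ (by positivity)
        set U := 1 + |z x|
        set V := ζ x ^ 2 * (th2 q (z x) * z1 x ^ 2) with hV
        have b1 : (ζ x * (pp1 q (z x) * z1 x)) ^ 2 ≤ U * V := by
          have : (ζ x * (pp1 q (z x) * z1 x)) ^ 2 = (ζ x ^ 2 * z1 x ^ 2) * pp1 q (z x) ^ 2 := by ring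
          rw [this, hV]
          calc _ ≤ (ζ x ^ 2 * z1 x ^ 2) * (U * th2 q (z x)) :=
                mul_le_mul_of_nonneg_left (pp1_sq hq1 hq _) (by positivity)
            _ = _ := by ring
        have b2 : (U / (2 * κ) + κ / 2 * V) ^ 2 = (U / (2 * κ) - κ / 2 * V) ^ 2 + U * V := by
          field_simp; ring
        nlinarith [sq_nonneg (U / (2 * κ) - κ / 2 * V)]
      calc _ ≤ _ := abs_add_le _ _
        _ ≤ _ := add_le_add a1 a2
        _ = _ := by ring
  have hind : Integrable ((Set.Icc (-ℓ) ℓ).indicator (fun _ => (1:ℝ))) :=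
    (integrable_indicator_iff measurableSet_Icc).2 (by simp)
  have hsup : ∀ x, ζ x * pp q (z x) ≤ Q := by
    intro x
    refine (sup_le_int (ℓ := ℓ) (F := fun x => ζ x * pp q (z x))
      (F' := fun x => ζ1 x * pp q (z x) + ζ x * (pp1 q (z x) * z1 x))
      (fun x => (hζ.d1 x).mul ((pp_hasDerivAt q (z x)).comp x (hz.d1 x))) (by fun_prop) hFi
      (fun x hx => by simp [hζ.z0 x hx]) x).trans ?_
    have i12 : Integrable (fun x => (D + 1 / (2 * κ)) *
        ((Set.Icc (-ℓ) ℓ).indicator (fun _ => (1:ℝ)) x + |z x|)) := (hind.add hi.abs).const_mul _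
    refine (integral_mono hFi.abs (i12.add (i3.const_mul (κ / 2))) hbound).trans ?_
    simp only [Pi.add_apply]
    rw [integral_add i12 (i3.const_mul _), integral_const_mul, integral_const_mul,
      integral_add hind hi.abs, integral_indicator measurableSet_Icc]
    have : ∫ x in Set.Icc (-ℓ) ℓ, (1:ℝ) = 2 * ℓ := by
      have := hζ.hℓ
      simp [this.le]; ring
    rw [this, hQ]
    have hD := hζ.hD
    have : (D + 1 / (2 * κ)) * (2 * ℓ + ∫ x, |z x|) ≤ (D + 1 / (2 * κ)) * (2 * ℓ + M) := by gcongr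
    calc _ ≤ (D + 1 / (2 * κ)) * (2 * ℓ + M) + κ / 2 * 𝓔 := by linarith
      _ = _ := by ring
  have hQ0 : 0 ≤ Q := (mul_nonneg (hζ.nn 0) (pp_nonneg q _)).trans (hsup 0)
  calc ∫ x, ζ x * (pw q (z x) * |z x|) ≤ ∫ x, Q * |z x| := by
        refine integral_mono (cs_int (ℓ := ℓ) (by fun_prop) (fun x hx => by simp [hζ.z0 x hx]))
          (hi.abs.const_mul _) (fun x => ?_)
        simp only
        rw [← mul_assoc]
        refine mul_le_mul_of_nonneg_right (le_trans ?_ (hsup x)) (abs_nonneg _)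
        exact mul_le_mul_of_nonneg_left (pw_le_pp hq1 _) (hζ.nn x)
    _ = Q * ∫ x, |z x| := integral_const_mul _ _
    _ ≤ Q * M := mul_le_mul_of_nonneg_left hM hQ0
    _ = _ := mul_comm _ _

/-- admissible kernels -/
structure Ker (k : ℝ → ℝ) (m1 : ℝ) : Prop where
  nn : ∀ x, 0 ≤ k x
  int : Integrable k
  mass : ∫ x, k x = 1
  int1 : Integrable (fun x => |x| * k x)
  hm1 : ∫ x, |x| * k x ≤ m1

/-- convolution -/
noncomputable def cv (k w : ℝ → ℝ) (x : ℝ) : ℝ := ∫ y, k (x - y) * w y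

section cv
variable {k w v : ℝ → ℝ} {m1 : ℝ}

lemma cv_prod (hk : Integrable k) (hw : Integrable w) :
    Integrable (fun p : ℝ × ℝ => k (p.1 - p.2) * w p.2) (volume.prod volume) := by
  have := hw.convolution_integrand (ContinuousLinearMap.mul ℝ ℝ) hk
  refine this.congr (Eventually.of_forall fun p => ?_)
  simp [mul_comm]

lemma cv_int (hk : Integrable k) (hw : Integrable w) : Integrable (cv k w) :=
  (cv_prod hk hw).integral_prod_left

lemma cv_ae (hk : Integrable k) (hw : Integrable w) :
    ∀ᵐ x, Integrable (fun y => k (x - y) * w y) := (cv_prod hk hw).prod_right_ae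

lemma cv_mass (hk : Ker k m1) (y : ℝ) : ∫ x, k (x - y) = 1 := by
  rw [integral_sub_right_eq_self (fun x => k x) y, hk.mass]

lemma abs_cv_le (hk : Ker k m1) (x : ℝ) : |cv k w x| ≤ cv k (fun y => |w y|) x := by
  unfold cv
  rw [← Real.norm_eq_abs]
  refine (norm_integral_le_integral_norm _).trans (le_of_eq ?_)
  congr 1; funext y; rw [norm_mul, Real.norm_eq_abs, Real.norm_eq_abs, abs_of_nonneg (hk.nn _)]

lemma cv_norm (hk : Ker k m1) (hw : Integrable w) : ∫ x, |cv k w x| ≤ ∫ x, |w x| := by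
  calc ∫ x, |cv k w x| ≤ ∫ x, cv k (fun y => |w y|) x :=
        integral_mono (cv_int hk.int hw).abs (cv_int hk.int hw.abs) (fun x => abs_cv_le hk x)
    _ = ∫ y, ∫ x, k (x - y) * |w y| := integral_integral_swap (cv_prod hk.int hw.abs)
    _ = ∫ y, |w y| := by
      congr 1; funext y; rw [integral_mul_const, cv_mass hk, one_mul]

lemma cv_sub (hk : Integrable k) (hw : Integrable w) (hv : Integrable v) :
    ∀ᵐ x, cv k (fun y => w y - v y) x = cv k w x - cv k v x := by
  filter_upwards [cv_ae hk hw, cv_ae hk hv] with x h1 h2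
  unfold cv
  rw [← integral_sub h1 h2]
  congr 1; funext y; ring

lemma cv_shift (h x : ℝ) : cv k (fun y => w (y + h)) x = cv k w (x + h) := by
  unfold cv
  rw [← integral_add_right_eq_self (fun y => k (x + h - y) * w y) h]
  congr 1; funext y
  rw [show x + h - (y + h) = x - y by ring]

lemma nonloc (hk : Ker k m1) (hw : Integrable w) {χ : ℝ → ℝ} {L : ℝ} (hL : 0 ≤ L)
    (hc : Continuous χ) (hn : ∀ x, 0 ≤ χ x) (h1 : ∀ x, χ x ≤ 1) (hl : ∀ x y, |χ x - χ y| ≤ L * |x - y|) :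
    ∫ x, χ x * (sg (w x) * (cv k w x - w x)) ≤ L * m1 * ∫ x, |w x| := by
  have hb : ∀ {g : ℝ → ℝ}, Integrable g → Integrable (fun x => χ x * g x) := fun hg =>
    hg.bdd_mul hc.aestronglyMeasurable (c := 1) (Eventually.of_forall fun x => by
      rw [Real.norm_eq_abs, abs_of_nonneg (hn x)]; exact h1 x)
  have hsgm : AEStronglyMeasurable (fun x => sg (w x)) :=
    (measurable_sg.comp_aemeasurable hw.aestronglyMeasurable.aemeasurable).aestronglyMeasurable
  have hi1 : Integrable (fun x => sg (w x) * (cv k w x - w x)) :=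
    ((cv_int hk.int hw).sub hw).bdd_mul hsgm (c := 1) (Eventually.of_forall fun x => abs_sg_le _)
  have hP := cv_prod hk.int hw.abs
  have hP' : Integrable (fun p : ℝ × ℝ => χ p.1 * (k (p.1 - p.2) * |w p.2|)) (volume.prod volume) :=
    hP.bdd_mul (hc.comp continuous_fst).aestronglyMeasurable (c := 1) (Eventually.of_forall fun x => by
      rw [Real.norm_eq_abs, abs_of_nonneg (hn _)]; exact h1 _)
  have step1 : ∫ x, χ x * (sg (w x) * (cv k w x - w x)) ≤
      ∫ x, (χ x * cv k (fun y => |w y|) x - χ x * |w x|) := by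
    refine integral_mono (hb hi1) ((hb (cv_int hk.int hw.abs)).sub (hb hw.abs)) (fun x => ?_)
    simp only
    rw [← mul_sub, mul_sub (sg (w x)), sg_mul_self]
    refine mul_le_mul_of_nonneg_left ?_ (hn x)
    have : sg (w x) * cv k w x ≤ |cv k w x| := by
      calc _ ≤ |sg (w x) * cv k w x| := le_abs_self _
        _ = |sg (w x)| * |cv k w x| := abs_mul _ _
        _ ≤ 1 * |cv k w x| := mul_le_mul_of_nonneg_right (abs_sg_le _) (abs_nonneg _)
        _ = _ := one_mul _
    linarith [abs_cv_le hk (w := w) x]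
  have step2 : ∫ x, χ x * cv k (fun y => |w y|) x = ∫ y, (∫ x, χ x * k (x - y)) * |w y| := by
    calc ∫ x, χ x * cv k (fun y => |w y|) x = ∫ x, ∫ y, χ x * (k (x - y) * |w y|) := by
          congr 1; funext x; unfold cv; rw [integral_const_mul]
      _ = ∫ y, ∫ x, χ x * (k (x - y) * |w y|) := integral_integral_swap hP'
      _ = _ := by
        congr 1; funext y; rw [← integral_mul_const]; congr 1; funext x; ring
  have step3 : ∀ y, ∫ x, χ x * k (x - y) ≤ χ y + L * m1 := by
    intro y
    have j1 : Integrable (fun x => k (x - y)) := hk.int.comp_sub_right y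
    have j2 : Integrable (fun x => |x - y| * k (x - y)) := hk.int1.comp_sub_right y
    calc ∫ x, χ x * k (x - y) ≤ ∫ x, (χ y * k (x - y) + L * (|x - y| * k (x - y))) := by
          refine integral_mono (hb j1) ((j1.const_mul _).add (j2.const_mul _)) (fun x => ?_)
          simp only
          have := hl x y
          have h2 : χ x ≤ χ y + L * |x - y| := by linarith [le_abs_self (χ x - χ y)]
          have h3 := mul_le_mul_of_nonneg_right h2 (hk.nn (x - y))
          linarith
      _ = χ y + L * ∫ x, |x| * k x := by
          rw [integral_add (j1.const_mul _) (j2.const_mul _), integral_const_mul, integral_const_mul,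
            cv_mass hk, mul_one, integral_sub_right_eq_self (fun x => |x| * k x) y]
      _ ≤ _ := by have := mul_le_mul_of_nonneg_left hk.hm1 hL; linarith
  have j4 : Integrable (fun y => (∫ x, χ x * k (x - y)) * |w y|) := by
    have := hP'.integral_prod_right
    refine this.congr (Eventually.of_forall fun y => ?_)
    simp only
    rw [← integral_mul_const]; congr 1; funext x; ring
  have j5 : Integrable (fun y => (χ y + L * m1) * |w y|) := by
    have := (hb hw.abs).add (hw.abs.const_mul (L * m1))
    refine this.congr (Eventually.of_forall fun y => ?_)
    simp only [Pi.add_apply]; ring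
  rw [integral_sub (hb (cv_int hk.int hw.abs)) (hb hw.abs), step2] at step1
  refine step1.trans ?_
  have : ∫ y, (∫ x, χ x * k (x - y)) * |w y| ≤ ∫ y, (χ y + L * m1) * |w y| :=
    integral_mono j4 j5 (fun y => mul_le_mul_of_nonneg_right (step3 y) (abs_nonneg _))
  have e : ∫ y, (χ y + L * m1) * |w y| = (∫ x, χ x * |w x|) + L * m1 * ∫ x, |w x| := by
    rw [← integral_const_mul, ← integral_add (hb hw.abs) (hw.abs.const_mul _)]
    congr 1; funext y; ring
  linarith

end cv

/-- the spatial operator -/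
noncomputable def Lop (q μ Λ : ℝ) (k A A1 A2 : ℝ → ℝ) (x : ℝ) : ℝ :=
  μ * A2 x + Λ * (cv k A x - A x) - pw q (A x) * A1 x

section core
variable {q μ Λ ℓ D m1 M : ℝ} {k ζ ζ1 ζ2 A A1 A2 B B1 B2 : ℝ → ℝ}

lemma Cut.sq (hζ : Cut ζ ζ1 ζ2 ℓ D) :
    D2 (fun x => ζ x ^ 2) (fun x => 2 * (ζ x * ζ1 x)) (fun x => 2 * (ζ1 x * ζ1 x + ζ x * ζ2 x)) := by
  have c := hζ.c0; have c1 := hζ.c1; have c2 := hζ.c2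
  refine ⟨fun x => ?_, fun x => ((hζ.d1 x).mul (hζ.d2 x)).const_mul 2, by fun_prop⟩
  refine ((hζ.d1 x).pow 2).congr_deriv ?_
  simp; ring

lemma Cut.sq_le (hζ : Cut ζ ζ1 ζ2 ℓ D) (x : ℝ) : ζ x ^ 2 ≤ 1 := by
  have := hζ.nn x; have := hζ.le1 x; nlinarith

lemma Cut.sq1 (hζ : Cut ζ ζ1 ζ2 ℓ D) (x : ℝ) : |2 * (ζ x * ζ1 x)| ≤ 2 * D * ζ x := by
  rw [abs_mul, abs_mul, abs_of_nonneg (hζ.nn x), abs_two]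
  have := mul_le_mul_of_nonneg_left (hζ.b1 x) (hζ.nn x); linarith

lemma Cut.sq2 (hζ : Cut ζ ζ1 ζ2 ℓ D) (x : ℝ) : |2 * (ζ1 x * ζ1 x + ζ x * ζ2 x)| ≤ 4 * D ^ 2 := by
  have h1 := hζ.b1 x; have h2 := hζ.b2 x
  have h3 : |ζ1 x * ζ1 x| ≤ D ^ 2 := by rw [abs_mul]; nlinarith [abs_nonneg (ζ1 x)]
  have h4 : |ζ x * ζ2 x| ≤ D ^ 2 := by
    rw [abs_mul, abs_of_nonneg (hζ.nn x)]
    nlinarith [abs_nonneg (ζ2 x), hζ.nn x, hζ.le1 x]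
  rw [abs_mul, abs_two]
  have := abs_add_le (ζ1 x * ζ1 x) (ζ x * ζ2 x)
  linarith

lemma Cut.sq_lip (hζ : Cut ζ ζ1 ζ2 ℓ D) (x y : ℝ) : |ζ x ^ 2 - ζ y ^ 2| ≤ 2 * D * |x - y| := by
  have := Convex.norm_image_sub_le_of_norm_hasDerivWithin_le (f := fun x => ζ x ^ 2)
    (f' := fun x => 2 * (ζ x * ζ1 x)) (s := Set.univ)
    (C := 2 * D) (x := y) (y := x) (fun x _ => (hζ.sq.d1 x).hasDerivWithinAt)
    (fun x _ => by
      refine (hζ.sq1 x).trans ?_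
      have := hζ.hD; have := hζ.le1 x; nlinarith) convex_univ trivial trivial
  simpa using this

/-- integrability of the localized operator -/
lemma Lop_int (hq1 : 1 < q) (hk : Integrable k) (hζ : Cut ζ ζ1 ζ2 ℓ D) (hA : D2 A A1 A2)
    (hAi : Integrable A) : Integrable (fun x => ζ x ^ 2 * Lop q μ Λ k A A1 A2 x) := by
  have c := hζ.c0
  have d := hA.c0; have d1 := hA.c1; have d2 := hA.c2
  have hpw := pw_cont hq1
  have i1 : Integrable (fun x => ζ x ^ 2 * (μ * A2 x - Λ * A x - pw q (A x) * A1 x)) :=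
    cs_int (ℓ := ℓ) (by fun_prop) (fun x hx => by simp [hζ.z0 x hx])
  have i2 : Integrable (fun x => ζ x ^ 2 * (Λ * cv k A x)) :=
    ((cv_int hk hAi).const_mul Λ).bdd_mul (c.pow 2).aestronglyMeasurable (c := 1)
      (Eventually.of_forall fun x => by
        rw [Real.norm_eq_abs, abs_of_nonneg (sq_nonneg _)]; exact hζ.sq_le x)
  refine (i1.add i2).congr (Eventually.of_forall fun x => ?_)
  simp only [Pi.add_apply, Lop]; ring

lemma mul_bdd_int {s g χ : ℝ → ℝ} {c : ℝ} (hs : AEStronglyMeasurable s) (hb : ∀ x, |s x| ≤ c)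
    (hg : Integrable (fun x => χ x * g x)) : Integrable (fun x => χ x * (s x * g x)) := by
  refine (hg.bdd_mul hs (c := c) (Eventually.of_forall hb)).congr (Eventually.of_forall fun x => ?_)
  simp only; ring

lemma coreE (hq1 : 1 < q) (hq : q < 2) (hμ : 0 < μ) (hΛ : 0 < Λ) (hk : Ker k m1)
    (hζ : Cut ζ ζ1 ζ2 ℓ D) (hA : D2 A A1 A2) (hAi : Integrable A) (hM : ∫ x, |A x| ≤ M) :
    ∫ x, ζ x ^ 2 * (th1 q (A x) * Lop q μ Λ k A A1 A2 x) ≤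
      μ * (4 * D ^ 2 * thB q * M - ∫ x, ζ x ^ 2 * (th2 q (A x) * A1 x ^ 2))
      + 2 * thB q * Λ * M + 2 * D * thB q * ∫ x, ζ x * (pw q (A x) * |A x|) := by
  have c := hζ.c0; have c1 := hζ.c1; have c2 := hζ.c2
  have d := hA.c0; have d1 := hA.c1; have d2 := hA.c2
  have hpw := pw_cont hq1
  have t1 := th1_cont q; have t2 := th2_cont q
  have t0 := (th0_D2 q).c0
  have tG : Continuous (thG q) := continuous_iff_continuousAt.2 fun x => (thG_hasDerivAt hq1 x).continuousAt
  have hB := thB_nonneg q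
  have hD := hζ.hD
  have hcvi := cv_int hk.int hAi
  have i1 : Integrable (fun x => ζ x ^ 2 * (th1 q (A x) * A2 x)) :=
    cs_int (ℓ := ℓ) (by fun_prop) (fun x hx => by simp [hζ.z0 x hx])
  have i2 : Integrable (fun x => (ζ x ^ 2 * th1 q (A x)) * (cv k A x - A x)) := by
    refine (hcvi.sub hAi).bdd_mul (c := thB q) (Continuous.aestronglyMeasurable (by fun_prop))
      (Eventually.of_forall fun x => ?_)
    rw [Real.norm_eq_abs, abs_mul, abs_of_nonneg (sq_nonneg _)]
    calc _ ≤ 1 * thB q := mul_le_mul (hζ.sq_le x) (th1_bound hq _) (abs_nonneg _) zero_le_one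
      _ = _ := one_mul _
  have i3 : Integrable (fun x => ζ x ^ 2 * (th1 q (A x) * pw q (A x) * A1 x)) :=
    cs_int (ℓ := ℓ) (by fun_prop) (fun x hx => by simp [hζ.z0 x hx])
  have e : ∫ x, ζ x ^ 2 * (th1 q (A x) * Lop q μ Λ k A A1 A2 x) =
      μ * (∫ x, ζ x ^ 2 * (th1 q (A x) * A2 x))
      + Λ * (∫ x, (ζ x ^ 2 * th1 q (A x)) * (cv k A x - A x))
      - ∫ x, ζ x ^ 2 * (th1 q (A x) * pw q (A x) * A1 x) := by
    have i12 : Integrable (fun x => μ * (ζ x ^ 2 * (th1 q (A x) * A2 x))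
      + Λ * ((ζ x ^ 2 * th1 q (A x)) * (cv k A x - A x))) := (i1.const_mul μ).add (i2.const_mul Λ)
    rw [← integral_const_mul, ← integral_const_mul, ← integral_add (i1.const_mul μ) (i2.const_mul Λ),
      ← integral_sub i12 i3]
    congr 1; funext x; unfold Lop; ring
  have p1 := kato_gen (ℓ := ℓ) hζ.sq (fun x hx => by simp [hζ.z0 x hx]) (fun x hx => by simp [hζ.z0 x hx])
    (fun x hx => by simp [hζ.z0 x hx, hζ.z1 x hx]) hA (th0_D2 q)
  have p1' : ∫ x, 2 * (ζ1 x * ζ1 x + ζ x * ζ2 x) * th0 q (A x) ≤ 4 * D ^ 2 * thB q * M := by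
    calc ∫ x, 2 * (ζ1 x * ζ1 x + ζ x * ζ2 x) * th0 q (A x) ≤ ∫ x, 4 * D ^ 2 * thB q * |A x| := by
          refine integral_mono (cs_int (ℓ := ℓ) (by fun_prop) (fun x hx => by simp [hζ.z0 x hx, hζ.z1 x hx]))
            (hAi.abs.const_mul _) (fun x => ?_)
          refine (le_abs_self _).trans ?_
          rw [abs_mul, mul_assoc (4 * D ^ 2)]
          exact mul_le_mul (hζ.sq2 x) (th0_bound hq _) (abs_nonneg _) (by positivity)
      _ = 4 * D ^ 2 * thB q * ∫ x, |A x| := integral_const_mul _ _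
      _ ≤ _ := by gcongr
  have p2 : ∫ x, (ζ x ^ 2 * th1 q (A x)) * (cv k A x - A x) ≤ 2 * thB q * M := by
    calc ∫ x, (ζ x ^ 2 * th1 q (A x)) * (cv k A x - A x) ≤ ∫ x, thB q * (|cv k A x| + |A x|) := by
          refine integral_mono i2 ((hcvi.abs.add hAi.abs).const_mul _) (fun x => ?_)
          refine (le_abs_self _).trans ?_
          rw [abs_mul, abs_mul, abs_of_nonneg (sq_nonneg _)]
          refine mul_le_mul ?_ (abs_sub _ _) (abs_nonneg _) hB
          calc _ ≤ 1 * thB q := mul_le_mul (hζ.sq_le x) (th1_bound hq _) (abs_nonneg _) zero_le_one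
            _ = _ := one_mul _
      _ = thB q * ((∫ x, |cv k A x|) + ∫ x, |A x|) := by
          rw [integral_const_mul, integral_add hcvi.abs hAi.abs]
      _ ≤ thB q * (M + M) := by
          have := cv_norm hk hAi
          gcongr; linarith
      _ = _ := by ring
  have p3 := flux_gen (ℓ := ℓ) hζ.sq.d1 hζ.sq.c1 (fun x hx => by simp [hζ.z0 x hx])
    (fun x hx => by simp [hζ.z0 x hx]) hA.d1 hA.c1 (fun x => thG_hasDerivAt hq1 x) (t1.mul hpw)
  have p3' : ∫ x, 2 * (ζ x * ζ1 x) * thG q (A x) ≤ 2 * D * thB q * ∫ x, ζ x * (pw q (A x) * |A x|) := by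
    rw [← integral_const_mul]
    refine integral_mono (cs_int (ℓ := ℓ) (by fun_prop) (fun x hx => by simp [hζ.z0 x hx]))
      (cs_int (ℓ := ℓ) (by fun_prop) (fun x hx => by simp [hζ.z0 x hx])) (fun x => ?_)
    refine (le_abs_self _).trans ?_
    rw [abs_mul]
    have := mul_le_mul (hζ.sq1 x) (thG_bound hq1 hq (A x)) (abs_nonneg _)
      (mul_nonneg (by positivity) (hζ.nn x))
    linarith
  rw [e, p1, p3]
  have := mul_le_mul_of_nonneg_left p1' hμ.le
  have := mul_le_mul_of_nonneg_left p2 hΛ.le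
  linarith

lemma coreS (hq1 : 1 < q) (hμ : 0 < μ) (hΛ : 0 < Λ) (hk : Ker k m1)
    (hζ : Cut ζ ζ1 ζ2 ℓ D) (hA : D2 A A1 A2) (hAi : Integrable A) (hM : ∫ x, |A x| ≤ M)
    (hB : D2 B B1 B2) (hBi : Integrable B) (hMB : ∫ x, |B x| ≤ M) :
    ∫ x, ζ x ^ 2 * (sg (A x - B x) * (Lop q μ Λ k A A1 A2 x - Lop q μ Λ k B B1 B2 x)) ≤
      8 * μ * D ^ 2 * M + 4 * Λ * M * D * m1
      + 2 * D * ((∫ x, ζ x * (pw q (A x) * |A x|)) + ∫ x, ζ x * (pw q (B x) * |B x|)) := by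
  have c := hζ.c0; have c1 := hζ.c1; have c2 := hζ.c2
  have d := hA.c0; have d1 := hA.c1; have d2 := hA.c2
  have b := hB.c0; have b1 := hB.c1; have b2 := hB.c2
  have hpw := pw_cont hq1
  have hfl : Continuous (fl q) := prim_cont hpw
  have hD := hζ.hD
  have hm1 : 0 ≤ m1 := (integral_nonneg fun x => mul_nonneg (abs_nonneg _) (hk.nn x)).trans hk.hm1
  have hwi : Integrable (fun x => A x - B x) := hAi.sub hBi
  have hw1 : ∫ x, |A x - B x| ≤ 2 * M := by
    calc ∫ x, |A x - B x| ≤ ∫ x, (|A x| + |B x|) :=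
          integral_mono hwi.abs (hAi.abs.add hBi.abs) (fun x => abs_sub _ _)
      _ = _ := integral_add hAi.abs hBi.abs
      _ ≤ _ := by linarith
  have hsm : AEStronglyMeasurable (fun x => sg (A x - B x)) :=
    (measurable_sg.comp (d.sub b).measurable).aestronglyMeasurable
  have hsb : ∀ x, |sg (A x - B x)| ≤ 1 := fun x => abs_sg_le _
  have hcvi := cv_int hk.int hwi
  have i1 : Integrable (fun x => ζ x ^ 2 * (sg (A x - B x) * (A2 x - B2 x))) :=
    mul_bdd_int hsm hsb (cs_int (ℓ := ℓ) (by fun_prop) (fun x hx => by simp [hζ.z0 x hx]))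
  have i2 : Integrable (fun x => ζ x ^ 2 * (sg (A x - B x) * (cv k (fun y => A y - B y) x - (A x - B x)))) := by
    refine mul_bdd_int hsm hsb ((hcvi.sub hwi).bdd_mul (c.pow 2).aestronglyMeasurable (c := 1)
      (Eventually.of_forall fun x => by
        rw [Real.norm_eq_abs, abs_of_nonneg (sq_nonneg _)]; exact hζ.sq_le x))
  have i3 : Integrable (fun x => ζ x ^ 2 * (sg (A x - B x) * (pw q (A x) * A1 x - pw q (B x) * B1 x))) :=
    mul_bdd_int hsm hsb (cs_int (ℓ := ℓ) (by fun_prop) (fun x hx => by simp [hζ.z0 x hx]))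
  have e : ∫ x, ζ x ^ 2 * (sg (A x - B x) * (Lop q μ Λ k A A1 A2 x - Lop q μ Λ k B B1 B2 x)) =
      μ * (∫ x, ζ x ^ 2 * (sg (A x - B x) * (A2 x - B2 x)))
      + Λ * (∫ x, ζ x ^ 2 * (sg (A x - B x) * (cv k (fun y => A y - B y) x - (A x - B x))))
      - ∫ x, ζ x ^ 2 * (sg (A x - B x) * (pw q (A x) * A1 x - pw q (B x) * B1 x)) := by
    have i12 : Integrable (fun x => μ * (ζ x ^ 2 * (sg (A x - B x) * (A2 x - B2 x)))
      + Λ * (ζ x ^ 2 * (sg (A x - B x) * (cv k (fun y => A y - B y) x - (A x - B x))))) :=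
      (i1.const_mul μ).add (i2.const_mul Λ)
    rw [← integral_const_mul, ← integral_const_mul, ← integral_add (i1.const_mul μ) (i2.const_mul Λ),
      ← integral_sub i12 i3]
    refine integral_congr_ae ?_
    filter_upwards [cv_sub hk.int hAi hBi] with x hx
    rw [hx]; unfold Lop; ring
  have p1 := kato_abs (ℓ := ℓ) hζ.sq (fun x hx => by simp [hζ.z0 x hx]) (fun x hx => by simp [hζ.z0 x hx])
    (fun x hx => by simp [hζ.z0 x hx, hζ.z1 x hx]) (fun x => sq_nonneg _) (hA.sub hB)
  have p1' : ∫ x, 2 * (ζ1 x * ζ1 x + ζ x * ζ2 x) * |A x - B x| ≤ 4 * D ^ 2 * (2 * M) := by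
    calc ∫ x, 2 * (ζ1 x * ζ1 x + ζ x * ζ2 x) * |A x - B x| ≤ ∫ x, 4 * D ^ 2 * |A x - B x| := by
          refine integral_mono (cs_int (ℓ := ℓ) (by fun_prop) (fun x hx => by simp [hζ.z0 x hx, hζ.z1 x hx]))
            (hwi.abs.const_mul _) (fun x => ?_)
          exact mul_le_mul_of_nonneg_right ((le_abs_self _).trans (hζ.sq2 x)) (abs_nonneg _)
      _ = 4 * D ^ 2 * ∫ x, |A x - B x| := integral_const_mul _ _
      _ ≤ _ := by gcongr
  have p2 := nonloc hk hwi (χ := fun x => ζ x ^ 2) (L := 2 * D) (by positivity) (c.pow 2)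
    (fun x => sq_nonneg _) hζ.sq_le hζ.sq_lip
  have p2' : 2 * D * m1 * ∫ x, |A x - B x| ≤ 2 * D * m1 * (2 * M) := by gcongr
  have p3 := flux_abs (ℓ := ℓ) hζ.sq.d1 hζ.sq.c1 (fun x hx => by simp [hζ.z0 x hx])
    (fun x hx => by simp [hζ.z0 x hx]) (w := fun x => fl q (A x) - fl q (B x))
    (w1 := fun x => pw q (A x) * A1 x - pw q (B x) * B1 x)
    (fun x => ((fl_hasDerivAt hq1 (A x)).comp x (hA.d1 x)).sub ((fl_hasDerivAt hq1 (B x)).comp x (hB.d1 x)))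
    (by fun_prop)
  simp only [sg_strictMono (fl_strictMono hq1)] at p3
  have iA : Integrable (fun x => ζ x * (pw q (A x) * |A x|)) :=
    cs_int (ℓ := ℓ) (by fun_prop) (fun x hx => by simp [hζ.z0 x hx])
  have iB : Integrable (fun x => ζ x * (pw q (B x) * |B x|)) :=
    cs_int (ℓ := ℓ) (by fun_prop) (fun x hx => by simp [hζ.z0 x hx])
  have p3' : ∫ x, 2 * (ζ x * ζ1 x) * |fl q (A x) - fl q (B x)| ≤
      2 * D * ((∫ x, ζ x * (pw q (A x) * |A x|)) + ∫ x, ζ x * (pw q (B x) * |B x|)) := by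
    rw [← integral_add iA iB, ← integral_const_mul]
    refine integral_mono (cs_int (ℓ := ℓ) (by fun_prop) (fun x hx => by simp [hζ.z0 x hx]))
      ((iA.add iB).const_mul _) (fun x => ?_)
    refine (le_abs_self _).trans ?_
    rw [abs_mul, abs_abs]
    have h1 : |fl q (A x) - fl q (B x)| ≤ pw q (A x) * |A x| + pw q (B x) * |B x| :=
      (abs_sub _ _).trans (add_le_add (fl_bound hq1 _) (fl_bound hq1 _))
    have := mul_le_mul (hζ.sq1 x) h1 (abs_nonneg _) (mul_nonneg (by positivity) (hζ.nn x))
    linarith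
  rw [e, p3]
  have := mul_le_mul_of_nonneg_left (p1.trans p1') hμ.le
  have := mul_le_mul_of_nonneg_left (p2.trans p2') hΛ.le
  linarith

/-- the error constant -/
noncomputable def errC (q μ Λ m1 M ℓ D κ : ℝ) : ℝ :=
  8 * μ * D ^ 2 * M * (1 + κ * thB q) + 4 * Λ * M * D * m1 + 4 * κ * thB q * Λ * M
  + 4 * (1 + κ * thB q) * (D ^ 2 * M * (2 * ℓ + M)
    + D ^ 2 * M ^ 2 * (2 * ℓ + M) * (1 + κ * thB q) / (2 * κ * μ))

lemma core (hq1 : 1 < q) (hq : q < 2) (hμ : 0 < μ) (hΛ : 0 < Λ) (hk : Ker k m1)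
    (hζ : Cut ζ ζ1 ζ2 ℓ D) (hA : D2 A A1 A2) (hAi : Integrable A) (hM : ∫ x, |A x| ≤ M)
    (hB : D2 B B1 B2) (hBi : Integrable B) (hMB : ∫ x, |B x| ≤ M) (hM0 : 0 < M) {κ : ℝ} (hκ : 0 < κ) :
    ∫ x, ζ x ^ 2 * (sg (A x - B x) * (Lop q μ Λ k A A1 A2 x - Lop q μ Λ k B B1 B2 x)
      + κ * (th1 q (A x) * Lop q μ Λ k A A1 A2 x) + κ * (th1 q (B x) * Lop q μ Λ k B B1 B2 x)) ≤
      errC q μ Λ m1 M ℓ D κ := by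
  have hLA := Lop_int (μ := μ) (Λ := Λ) hq1 hk.int hζ hA hAi
  have hLB := Lop_int (μ := μ) (Λ := Λ) hq1 hk.int hζ hB hBi
  have d := hA.c0; have b := hB.c0
  have hD := hζ.hD
  have hBn := thB_nonneg q
  have hsm : AEStronglyMeasurable (fun x => sg (A x - B x)) :=
    (measurable_sg.comp (d.sub b).measurable).aestronglyMeasurable
  have i1 : Integrable (fun x => ζ x ^ 2 * (sg (A x - B x) *
      (Lop q μ Λ k A A1 A2 x - Lop q μ Λ k B B1 B2 x))) := by
    refine mul_bdd_int hsm (fun x => abs_sg_le _) ((hLA.sub hLB).congr (Eventually.of_forall fun x => ?_))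
    simp only [Pi.sub_apply]; ring
  have i2 : Integrable (fun x => κ * (ζ x ^ 2 * (th1 q (A x) * Lop q μ Λ k A A1 A2 x))) :=
    (mul_bdd_int ((th1_cont q).comp d).aestronglyMeasurable (fun x => th1_bound hq _) hLA).const_mul κ
  have i3 : Integrable (fun x => κ * (ζ x ^ 2 * (th1 q (B x) * Lop q μ Λ k B B1 B2 x))) :=
    (mul_bdd_int ((th1_cont q).comp b).aestronglyMeasurable (fun x => th1_bound hq _) hLB).const_mul κ
  have e : (fun x => ζ x ^ 2 * (sg (A x - B x) * (Lop q μ Λ k A A1 A2 x - Lop q μ Λ k B B1 B2 x)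
      + κ * (th1 q (A x) * Lop q μ Λ k A A1 A2 x) + κ * (th1 q (B x) * Lop q μ Λ k B B1 B2 x))) =
      fun x => (ζ x ^ 2 * (sg (A x - B x) * (Lop q μ Λ k A A1 A2 x - Lop q μ Λ k B B1 B2 x))
        + κ * (ζ x ^ 2 * (th1 q (A x) * Lop q μ Λ k A A1 A2 x)))
        + κ * (ζ x ^ 2 * (th1 q (B x) * Lop q μ Λ k B B1 B2 x)) := by
    funext x; ring
  have i12 := i1.add i2
  simp only [Pi.add_def] at i12
  rw [e, integral_add i12 i3, integral_add i1 i2, integral_const_mul, integral_const_mul]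
  have s1 := coreS hq1 hμ hΛ hk hζ hA hAi hM hB hBi hMB
  have s2 := mul_le_mul_of_nonneg_left (coreE hq1 hq hμ hΛ hk hζ hA hAi hM) hκ.le
  have s3 := mul_le_mul_of_nonneg_left (coreE hq1 hq hμ hΛ hk hζ hB hBi hMB) hκ.le
  set P := 1 + κ * thB q with hP
  have hP0 : 0 < P := by positivity
  set η := κ * μ / (2 * P) with hη
  have hη0 : 0 < η := by positivity
  have a1 := absorb hq1 hq hζ hA hAi hM (κ := 2 * η / (D * M)) (by positivity)
  have a2 := absorb hq1 hq hζ hB hBi hMB (κ := 2 * η / (D * M)) (by positivity)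
  set EA := ∫ x, ζ x ^ 2 * (th2 q (A x) * A1 x ^ 2)
  set EB := ∫ x, ζ x ^ 2 * (th2 q (B x) * B1 x ^ 2)
  set FA := ∫ x, ζ x * (pw q (A x) * |A x|)
  set FB := ∫ x, ζ x * (pw q (B x) * |B x|)
  have hX : ∀ E : ℝ, D * (M * (D * (2 * ℓ + M) + (2 * ℓ + M) / (2 * (2 * η / (D * M))) +
      2 * η / (D * M) / 2 * E)) = D ^ 2 * M * (2 * ℓ + M)
    + D ^ 2 * M ^ 2 * (2 * ℓ + M) * P / (2 * κ * μ) + η * E := by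
    intro E; rw [hη]; field_simp
  have a1' := mul_le_mul_of_nonneg_left a1 hD.le
  have a2' := mul_le_mul_of_nonneg_left a2 hD.le
  rw [hX] at a1' a2'
  have hηP : 2 * P * η = κ * μ := by rw [hη]; field_simp
  have a3 := mul_le_mul_of_nonneg_left (add_le_add a1' a2') (by positivity : (0:ℝ) ≤ 2 * P)
  unfold errC
  rw [← hP]
  set X := D ^ 2 * M * (2 * ℓ + M) + D ^ 2 * M ^ 2 * (2 * ℓ + M) * P / (2 * κ * μ)
  have a4 : 2 * P * (X + η * EA + (X + η * EB)) = 4 * P * X + κ * μ * (EA + EB) := by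
    rw [← hηP]; ring
  rw [a4] at a3
  have a5 : 2 * P * (D * FA + D * FB) = 2 * D * (FA + FB) + κ * (2 * D * thB q * FA) + κ * (2 * D * thB q * FB) := by
    rw [hP]; ring
  rw [a5] at a3
  have a6 : 8 * μ * D ^ 2 * M * P = 8 * μ * D ^ 2 * M + 2 * (κ * (μ * (4 * D ^ 2 * thB q * M))) := by
    rw [hP]; ring
  linarith

end core

lemma sg_ii {c c1 : ℝ → ℝ} (hc : Continuous c) (h1 : Continuous c1) (s t : ℝ) :
    IntervalIntegrable (fun r => sg (c r) * c1 r) volume s t := by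
  have h := h1.intervalIntegrable (μ := volume) s t
  rw [intervalIntegrable_iff] at h ⊢
  exact h.bdd_mul (c := 1) (measurable_sg.comp hc.measurable).aestronglyMeasurable
    (Eventually.of_forall fun x => abs_sg_le _)

/-- curves on a compact time interval, extended by clamping -/
structure CC (q μ Λ : ℝ) (k e : ℝ → ℝ) (w wt w1 w2 : ℝ → ℝ → ℝ) (a b M : ℝ) : Prop where
  cw : ∀ x, Continuous (fun t => w t x)
  cwt : ∀ x, Continuous (fun t => wt t x)
  mwt : ∀ t, Measurable (wt t)
  dt : ∀ x, ∀ t ∈ Set.Ioo a b, HasDerivAt (fun s => w s x) (wt t x) t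
  int : ∀ t, Integrable (w t)
  bd : ∀ t, ∫ x, |w t x| ≤ M
  l1 : ∀ t0, Tendsto (fun t => ∫ x, |w t x - w t0 x|) (nhds t0) (nhds 0)
  d2 : ∀ t, D2 (w t) (w1 t) (w2 t)
  eq : ∀ t x, wt t x = Lop q μ Λ k (w t) (w1 t) (w2 t) x + e x
  ei : Integrable e

/-- times with controlled time derivative -/
def SS (ζ : ℝ → ℝ) (wt : ℝ → ℝ → ℝ) (n : ℕ) : Set ℝ :=
  {t | ∫⁻ x, ENNReal.ofReal (ζ x ^ 2 * |wt t x|) ≤ n}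

lemma cont_of_l1 {Ω : Type*} [MeasurableSpace Ω] {ν : Measure Ω} {y : ℝ → Ω → ℝ} {g : ℝ → ℝ → ℝ}
    (hy : ∀ t, Integrable (y t) ν) (h : ∀ t0 t, ∫ x, |y t x - y t0 x| ∂ν ≤ g t0 t)
    (hg : ∀ t0, Tendsto (g t0) (nhds t0) (nhds 0)) : Continuous (fun t => ∫ x, y t x ∂ν) := by
  refine continuous_iff_continuousAt.2 fun t0 => ?_
  refine tendsto_iff_norm_sub_tendsto_zero.2 ?_
  refine squeeze_zero (fun _ => norm_nonneg _) (fun t => ?_) (hg t0)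
  rw [← integral_sub (hy t) (hy t0)]
  exact (norm_integral_le_integral_norm _).trans (h t0 t)

section st
variable {q μ Λ : ℝ} {k e : ℝ → ℝ} {w wt w1 w2 : ℝ → ℝ → ℝ} {a b M m1 ℓ D : ℝ} {ζ ζ1 ζ2 : ℝ → ℝ}

lemma CC.wt_int (h : CC q μ Λ k e w wt w1 w2 a b M) (hq1 : 1 < q) (hk : Ker k m1)
    (hζ : Cut ζ ζ1 ζ2 ℓ D) (t : ℝ) : Integrable (fun x => ζ x ^ 2 * wt t x) := by
  have i1 := Lop_int (μ := μ) (Λ := Λ) hq1 hk.int hζ (h.d2 t) (h.int t)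
  have i2 : Integrable (fun x => ζ x ^ 2 * e x) := h.ei.bdd_mul (hζ.c0.pow 2).aestronglyMeasurable
    (c := 1) (Eventually.of_forall fun x => by
        rw [Real.norm_eq_abs, abs_of_nonneg (sq_nonneg _)]; exact hζ.sq_le x)
  refine (i1.add i2).congr (Eventually.of_forall fun x => ?_)
  simp only [Pi.add_apply, h.eq]; ring

lemma CC.wt_abs_int (h : CC q μ Λ k e w wt w1 w2 a b M) (hq1 : 1 < q) (hk : Ker k m1)
    (hζ : Cut ζ ζ1 ζ2 ℓ D) (t : ℝ) : Integrable (fun x => ζ x ^ 2 * |wt t x|) := by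
  refine (h.wt_int hq1 hk hζ t).abs.congr (Eventually.of_forall fun x => ?_)
  simp only [abs_mul, abs_of_nonneg (sq_nonneg (ζ x))]

lemma CC.ss_iff (h : CC q μ Λ k e w wt w1 w2 a b M) (hq1 : 1 < q) (hk : Ker k m1)
    (hζ : Cut ζ ζ1 ζ2 ℓ D) (t : ℝ) (n : ℕ) : t ∈ SS ζ wt n ↔ ∫ x, ζ x ^ 2 * |wt t x| ≤ n := by
  unfold SS
  rw [Set.mem_setOf_eq, ← ofReal_integral_eq_lintegral_ofReal (h.wt_abs_int hq1 hk hζ t)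
    (Eventually.of_forall fun x => mul_nonneg (sq_nonneg _) (abs_nonneg _))]
  rw [← ENNReal.ofReal_natCast n, ENNReal.ofReal_le_ofReal_iff (Nat.cast_nonneg n)]

lemma CC.ss_closed (h : CC q μ Λ k e w wt w1 w2 a b M)
    (hζ : Cut ζ ζ1 ζ2 ℓ D) (n : ℕ) : IsClosed (SS ζ wt n) := by
  refine IsSeqClosed.isClosed ?_
  intro ts t hts ht
  have hm : ∀ j, Measurable (fun x => ENNReal.ofReal (ζ x ^ 2 * |wt (ts j) x|)) := fun j =>
    ENNReal.measurable_ofReal.comp (((hζ.c0.pow 2).measurable).mul (h.mwt _).abs)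
  have hf := lintegral_liminf_le (μ := volume) (u := atTop) hm
  refine le_trans (le_of_eq ?_) (hf.trans ?_)
  · congr 1; funext x
    refine (Tendsto.liminf_eq ?_).symm
    refine (ENNReal.continuous_ofReal.tendsto _).comp ?_
    exact (((h.cwt x).tendsto t).comp ht).abs.const_mul _
  · refine (liminf_le_liminf (v := fun _ => (n : ℝ≥0∞)) (Eventually.of_forall fun j => hts j)).trans ?_
    simp

lemma CC.ss_cover (h : CC q μ Λ k e w wt w1 w2 a b M) (hq1 : 1 < q) (hk : Ker k m1)
    (hζ : Cut ζ ζ1 ζ2 ℓ D) (t : ℝ) : ∃ n, ∀ m, n ≤ m → t ∈ SS ζ wt m := by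
  obtain ⟨n, hn⟩ := exists_nat_ge (∫ x, ζ x ^ 2 * |wt t x|)
  exact ⟨n, fun m hm => (h.ss_iff hq1 hk hζ t m).2 (hn.trans (by exact_mod_cast hm))⟩

lemma CC.th_time (h : CC q μ Λ k e w wt w1 w2 a b M) (x : ℝ) {s t : ℝ} (hs : s ∈ Set.Icc a b)
    (ht : t ∈ Set.Icc a b) (hst : s ≤ t) :
    ∫ r in s..t, th1 q (w r x) * wt r x = th0 q (w t x) - th0 q (w s x) := by
  have c := h.cw x; have c1 := h.cwt x
  have t1 := th1_cont q; have t0 := (th0_D2 q).c0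
  refine intervalIntegral.integral_eq_sub_of_hasDerivAt_of_le (f := fun r => th0 q (w r x)) hst
    (Continuous.continuousOn (by fun_prop)) (fun r hr => ?_) (Continuous.intervalIntegrable (by fun_prop) _ _)
  exact ((th0_D2 q).d1 (w r x)).comp r (h.dt x r ⟨hs.1.trans_lt hr.1, hr.2.trans_le ht.2⟩)

lemma CC.th_ii (h : CC q μ Λ k e w wt w1 w2 a b M) (x s t : ℝ) :
    IntervalIntegrable (fun r => th1 q (w r x) * wt r x) volume s t := by
  have c := h.cw x; have c1 := h.cwt x
  have t1 := th1_cont q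
  exact Continuous.intervalIntegrable (by fun_prop) _ _

lemma CC.mw (h : CC q μ Λ k e w wt w1 w2 a b M) : Measurable (Function.uncurry w) :=
  measurable_uncurry_of_continuous_of_measurable h.cw (fun t => (h.d2 t).c0.measurable)

lemma CC.mwtu (h : CC q μ Λ k e w wt w1 w2 a b M) : Measurable (Function.uncurry wt) :=
  measurable_uncurry_of_continuous_of_measurable h.cwt h.mwt

/-- the rate bound of stage 1 -/
lemma stage1_rate (hq1 : 1 < q) (hq : q < 2) (hμ : 0 < μ) (hΛ : 0 < Λ) (hk : Ker k m1)
    (hζ : Cut ζ ζ1 ζ2 ℓ D) (h : CC q μ Λ k e w wt w1 w2 a b M) (hM0 : 0 < M) {κ : ℝ} (hκ : 0 < κ)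
    {n : ℕ} {α : ℝ} (hα : α ∈ SS ζ wt n) (t : ℝ) :
    Integrable (fun x => ζ x ^ 2 * ((sg (w t x - w α x) + κ * th1 q (w t x)) * wt t x)) ∧
    ∫ x, ζ x ^ 2 * ((sg (w t x - w α x) + κ * th1 q (w t x)) * wt t x) ≤
      errC q μ Λ m1 M ℓ D κ + (1 + κ * thB q) * (n + 2 * ∫ x, |e x|) := by
  have hc := core hq1 hq hμ hΛ hk hζ (h.d2 t) (h.int t) (h.bd t) (h.d2 α) (h.int α) (h.bd α) hM0 hκ
  have d := (h.d2 t).c0; have b := (h.d2 α).c0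
  have hBn := thB_nonneg q
  have hsm : AEStronglyMeasurable (fun x => sg (w t x - w α x)) :=
    (measurable_sg.comp (d.sub b).measurable).aestronglyMeasurable
  have hth : ∀ r, κ * |th1 q r| ≤ κ * thB q := fun r => mul_le_mul_of_nonneg_left (th1_bound hq r) hκ.le
  have hb1 : ∀ x, |sg (w t x - w α x) + κ * th1 q (w t x)| ≤ 1 + κ * thB q := fun x => by
    refine (abs_add_le _ _).trans (add_le_add (abs_sg_le _) ?_)
    rw [abs_mul, abs_of_pos hκ]; exact hth _
  have hb2 : ∀ x, |sg (w t x - w α x) - κ * th1 q (w α x)| ≤ 1 + κ * thB q := fun x => by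
    refine (abs_sub _ _).trans (add_le_add (abs_sg_le _) ?_)
    rw [abs_mul, abs_of_pos hκ]; exact hth _
  have t1 := th1_cont q
  have ct1 : Continuous (fun x => κ * th1 q (w t x)) := by fun_prop
  have ca1 : Continuous (fun x => κ * th1 q (w α x)) := by fun_prop
  have i0 : Integrable (fun x => ζ x ^ 2 * ((sg (w t x - w α x) + κ * th1 q (w t x)) * wt t x)) :=
    mul_bdd_int (hsm.add ct1.aestronglyMeasurable) hb1 (h.wt_int hq1 hk hζ t)
  refine ⟨i0, ?_⟩
  have hLA := Lop_int (μ := μ) (Λ := Λ) hq1 hk.int hζ (h.d2 t) (h.int t)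
  have hLB := Lop_int (μ := μ) (Λ := Λ) hq1 hk.int hζ (h.d2 α) (h.int α)
  set LA := Lop q μ Λ k (w t) (w1 t) (w2 t) with hLAd
  set LB := Lop q μ Λ k (w α) (w1 α) (w2 α) with hLBd
  have ic : Integrable (fun x => ζ x ^ 2 * (sg (w t x - w α x) * (LA x - LB x)
      + κ * (th1 q (w t x) * LA x) + κ * (th1 q (w α x) * LB x))) := by
    have j1 := mul_bdd_int (hsm.add ct1.aestronglyMeasurable) hb1 hLA
    have j2 := mul_bdd_int (hsm.sub ca1.aestronglyMeasurable) hb2 hLB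
    refine (j1.sub j2).congr (Eventually.of_forall fun x => ?_)
    simp only [Pi.sub_apply, Pi.add_apply]; ring
  have ia := h.wt_abs_int hq1 hk hζ α
  have hn := (h.ss_iff hq1 hk hζ α n).1 hα
  have key : ∀ x, ζ x ^ 2 * ((sg (w t x - w α x) + κ * th1 q (w t x)) * wt t x) ≤
      ζ x ^ 2 * (sg (w t x - w α x) * (LA x - LB x)
      + κ * (th1 q (w t x) * LA x) + κ * (th1 q (w α x) * LB x))
      + (1 + κ * thB q) * (ζ x ^ 2 * |wt α x| + 2 * |e x|) := by
    intro x
    have e1 : wt t x = LA x + e x := h.eq t x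
    have e2 : wt α x = LB x + e x := h.eq α x
    have hz := hζ.sq_le x
    have hz0 := sq_nonneg (ζ x)
    have f1 : (sg (w t x - w α x) - κ * th1 q (w α x)) * LB x ≤ (1 + κ * thB q) * (|wt α x| + |e x|) := by
      refine (le_abs_self _).trans ?_
      rw [abs_mul]
      refine mul_le_mul (hb2 x) ?_ (abs_nonneg _) (by positivity)
      rw [show LB x = wt α x - e x by rw [e2]; ring]; exact abs_sub _ _
    have f2 : (sg (w t x - w α x) + κ * th1 q (w t x)) * e x ≤ (1 + κ * thB q) * |e x| := by
      refine (le_abs_self _).trans ?_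
      rw [abs_mul]
      exact mul_le_mul_of_nonneg_right (hb1 x) (abs_nonneg _)
    have f3 := mul_le_mul_of_nonneg_left (add_le_add f1 f2) hz0
    have f4 : ζ x ^ 2 * |e x| ≤ 1 * |e x| := mul_le_mul_of_nonneg_right hz (abs_nonneg _)
    have f5 := mul_le_mul_of_nonneg_left f4 (by positivity : 0 ≤ 1 + κ * thB q)
    rw [e1]
    nlinarith
  have i9 : Integrable (fun x => (1 + κ * thB q) * (ζ x ^ 2 * |wt α x| + 2 * |e x|)) :=
    (ia.add (h.ei.abs.const_mul 2)).const_mul (1 + κ * thB q)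
  refine (integral_mono i0 (ic.add i9) key).trans ?_
  simp only [Pi.add_apply]
  rw [integral_add ic i9, integral_const_mul,
    integral_add ia (h.ei.abs.const_mul 2), integral_const_mul]
  refine add_le_add hc ?_
  refine mul_le_mul_of_nonneg_left ?_ (by positivity)
  linarith

lemma stage1 (hq1 : 1 < q) (hq : q < 2) (hμ : 0 < μ) (hΛ : 0 < Λ) (hk : Ker k m1)
    (hζ : Cut ζ ζ1 ζ2 ℓ D) (h : CC q μ Λ k e w wt w1 w2 a b M) (hM0 : 0 < M) :
    ∃ C : ℕ → ℝ, ∀ n, ∀ α ∈ SS ζ wt n ∩ Set.Icc a b, ∀ β ∈ Set.Icc a b, α ≤ β →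
      ∫ x, ζ x ^ 2 * |w β x - w α x| ≤ C n * (β - α) := by
  have hBn := thB_nonneg q
  set κ : ℝ := 1 / (2 * (thB q + 1)) with hκd
  have hκ : 0 < κ := by positivity
  have hκB : κ * thB q ≤ 1 / 2 := by
    rw [hκd, div_mul_eq_mul_div, one_mul, div_le_div_iff₀ (by positivity) (by norm_num)]; linarith
  have t0 := (th0_D2 q).c0
  have t1 := th1_cont q
  have hcζ := hζ.c0
  let CN : ℕ → ℝ := fun n => errC q μ Λ m1 M ℓ D κ + (1 + κ * thB q) * (n + 2 * ∫ x, |e x|)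
  have hζm : ∀ x, ‖ζ x ^ 2‖ ≤ 1 := fun x => by
    rw [Real.norm_eq_abs, abs_of_nonneg (sq_nonneg _)]; exact hζ.sq_le x
  have idf : ∀ t α, Integrable (fun x => ζ x ^ 2 * |w t x - w α x|) := fun t α =>
    ((h.int t).sub (h.int α)).abs.bdd_mul (hcζ.pow 2).aestronglyMeasurable (c := 1)
      (Eventually.of_forall hζm)
  have ith : ∀ t, Integrable (fun x => ζ x ^ 2 * (κ * th0 q (w t x))) := fun t => by
    have cc := (h.d2 t).c0
    exact cs_int (ℓ := ℓ) (by fun_prop) (fun x hx => by simp [hζ.z0 x hx])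
  have iy : ∀ t α, Integrable (fun x => ζ x ^ 2 * (|w t x - w α x| + κ * th0 q (w t x))) := fun t α =>
    ((idf t α).add (ith t)).congr (Eventually.of_forall fun x => by simp only [Pi.add_apply]; ring)
  have hdiff : ∀ α t s x, |ζ x ^ 2 * (|w t x - w α x| + κ * th0 q (w t x))
      - ζ x ^ 2 * (|w s x - w α x| + κ * th0 q (w s x))| ≤ 2 * (ζ x ^ 2 * |w t x - w s x|) := by
    intro α t s x
    rw [← mul_sub, abs_mul, abs_of_nonneg (sq_nonneg _)]
    have g1 : abs (|w t x - w α x| - |w s x - w α x|) ≤ |w t x - w s x| := by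
      refine (abs_abs_sub_abs_le_abs_sub _ _).trans (le_of_eq ?_); congr 1; ring
    have g2 : |κ * (th0 q (w t x) - th0 q (w s x))| ≤ κ * (thB q * |w t x - w s x|) := by
      rw [abs_mul, abs_of_pos hκ]
      exact mul_le_mul_of_nonneg_left (th0_lip hq _ _) hκ.le
    have g3 : |(|w t x - w α x| + κ * th0 q (w t x)) - (|w s x - w α x| + κ * th0 q (w s x))|
        ≤ 2 * |w t x - w s x| := by
      rw [show (|w t x - w α x| + κ * th0 q (w t x)) - (|w s x - w α x| + κ * th0 q (w s x)) =
        (|w t x - w α x| - |w s x - w α x|) + κ * (th0 q (w t x) - th0 q (w s x)) by ring]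
      refine (abs_add_le _ _).trans ?_
      nlinarith [abs_nonneg (w t x - w s x)]
    calc _ ≤ ζ x ^ 2 * (2 * |w t x - w s x|) := mul_le_mul_of_nonneg_left g3 (sq_nonneg _)
      _ = _ := by ring
  have hdiffI : ∀ α t s, ∫ x, |ζ x ^ 2 * (|w t x - w α x| + κ * th0 q (w t x))
      - ζ x ^ 2 * (|w s x - w α x| + κ * th0 q (w s x))| ≤ 2 * ∫ x, ζ x ^ 2 * |w t x - w s x| := by
    intro α t s
    rw [← integral_const_mul]
    exact integral_mono ((iy t α).sub (iy s α)).abs ((idf t s).const_mul 2) (hdiff α t s)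
  have hlow : ∀ α β, (∫ x, ζ x ^ 2 * |w β x - w α x|) ≤ 2 * ((∫ x, ζ x ^ 2 * (|w β x - w α x| + κ * th0 q (w β x)))
      - ∫ x, ζ x ^ 2 * (|w α x - w α x| + κ * th0 q (w α x))) := by
    intro α β
    rw [← integral_sub (iy β α) (iy α α), ← integral_const_mul]
    refine integral_mono (idf β α) (((iy β α).sub (iy α α)).const_mul 2) (fun x => ?_)
    simp only [Pi.sub_apply, sub_self, abs_zero, zero_add]
    have g2 : |κ * (th0 q (w β x) - th0 q (w α x))| ≤ κ * (thB q * |w β x - w α x|) := by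
      rw [abs_mul, abs_of_pos hκ]
      exact mul_le_mul_of_nonneg_left (th0_lip hq _ _) hκ.le
    have g4 : κ * (thB q * |w β x - w α x|) ≤ 1 / 2 * |w β x - w α x| := by
      rw [← mul_assoc]; exact mul_le_mul_of_nonneg_right hκB (abs_nonneg _)
    have g3 : |w β x - w α x| ≤ 2 * (|w β x - w α x| + κ * (th0 q (w β x) - th0 q (w α x))) := by
      linarith [neg_abs_le (κ * (th0 q (w β x) - th0 q (w α x)))]
    calc _ ≤ ζ x ^ 2 * (2 * (|w β x - w α x| + κ * (th0 q (w β x) - th0 q (w α x)))) :=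
          mul_le_mul_of_nonneg_left g3 (sq_nonneg _)
      _ = _ := by ring
  have hAL := AL (ι := {p : ℕ × ℝ // p.2 ∈ SS ζ wt p.1 ∩ Set.Icc a b}) (volume : Measure ℝ) (a := a) (b := b)
    (fun i t x => ζ x ^ 2 * (|w t x - w i.1.2 x| + κ * th0 q (w t x)))
    (fun i t x => ζ x ^ 2 * ((sg (w t x - w i.1.2 x) + κ * th1 q (w t x)) * wt t x))
    (fun i => CN i.1.1) ?_ ?_ ?_ ?_ (fun i t _ => iy t _) ?_
    (fun i t _ => (stage1_rate hq1 hq hμ hΛ hk hζ h hM0 hκ i.2.1 t).2) (SS ζ wt)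
    (h.ss_closed hζ) (fun t _ => Set.mem_iUnion.2 ⟨_, (h.ss_cover hq1 hk hζ t).choose_spec _ le_rfl⟩) ?_ ?_
  · refine ⟨fun n => 2 * CN n, fun n α hα β hβ hle => ?_⟩
    have := hAL ⟨(n, α), hα⟩ α hα.2 β hβ hle
    simp only at this
    have := hlow α β
    linarith
  · intro i
    have m0 := h.mw
    have mz : Measurable (fun p : ℝ × ℝ => ζ p.2 ^ 2) := ((hcζ.pow 2).measurable).comp measurable_snd
    have mu : Measurable (fun p : ℝ × ℝ => w i.1.2 p.2) := ((h.d2 i.1.2).c0.measurable).comp measurable_snd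
    exact mz.mul (((m0.sub mu).abs).add ((t0.measurable.comp m0).const_mul κ))
  · intro i
    have m0 := h.mw
    have mz : Measurable (fun p : ℝ × ℝ => ζ p.2 ^ 2) := ((hcζ.pow 2).measurable).comp measurable_snd
    have mu : Measurable (fun p : ℝ × ℝ => w i.1.2 p.2) := ((h.d2 i.1.2).c0.measurable).comp measurable_snd
    exact mz.mul (((measurable_sg.comp (m0.sub mu)).add ((t1.measurable.comp m0).const_mul κ)).mul h.mwtu)
  · intro i x
    obtain ⟨L, hL⟩ := (isCompact_Icc (a := a) (b := b)).exists_bound_of_continuousOn (h.cwt x).continuousOn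
    refine ⟨(1 + κ * thB q) * L, fun t ht => ?_⟩
    have hLt := hL t ht
    rw [Real.norm_eq_abs] at hLt
    rw [abs_mul, abs_of_nonneg (sq_nonneg _), abs_mul]
    have g1 : |sg (w t x - w i.1.2 x) + κ * th1 q (w t x)| ≤ 1 + κ * thB q := by
      refine (abs_add_le _ _).trans (add_le_add (abs_sg_le _) ?_)
      rw [abs_mul, abs_of_pos hκ]; exact mul_le_mul_of_nonneg_left (th1_bound hq _) hκ.le
    calc _ ≤ 1 * (|sg (w t x - w i.1.2 x) + κ * th1 q (w t x)| * |wt t x|) :=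
          mul_le_mul_of_nonneg_right (hζ.sq_le x) (by positivity)
      _ ≤ _ := by
        rw [one_mul]; exact mul_le_mul g1 hLt (abs_nonneg _) (by positivity)
  · intro i x s hs t ht hst
    have cw := h.cw x; have cwt := h.cwt x
    have s1 := sg_time (c := fun r => w r x - w i.1.2 x) (c1 := fun r => wt r x) hst
      (Continuous.continuousOn (by fun_prop))
      (fun r hr => (h.dt x r ⟨hs.1.trans_lt hr.1, hr.2.trans_le ht.2⟩).sub_const _) cwt.continuousOn
    have s2 := h.th_time x hs ht hst
    have hi1 := sg_ii (c := fun r => w r x - w i.1.2 x) (c1 := fun r => wt r x) (by fun_prop) cwt s t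
    have hi2 := (h.th_ii x s t).const_mul κ
    calc ∫ r in s..t, ζ x ^ 2 * ((sg (w r x - w i.1.2 x) + κ * th1 q (w r x)) * wt r x)
        = ζ x ^ 2 * ∫ r in s..t, (sg (w r x - w i.1.2 x) * wt r x + κ * (th1 q (w r x) * wt r x)) := by
          rw [← intervalIntegral.integral_const_mul]; congr 1; funext r; ring
      _ = _ := by
          rw [intervalIntegral.integral_add hi1 hi2, s1, intervalIntegral.integral_const_mul, s2]; ring
  · intro i
    refine (cont_of_l1 (g := fun t0 t => 2 * ∫ x, |w t x - w t0 x|) (fun t => iy t _)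
      (fun t0 t => (hdiffI _ _ _).trans ?_) (fun t0 => by simpa using (h.l1 t0).const_mul 2)).continuousOn
    refine mul_le_mul_of_nonneg_left (integral_mono (idf t t0) ((h.int t).sub (h.int t0)).abs fun x => ?_)
      (by norm_num)
    calc ζ x ^ 2 * |w t x - w t0 x| ≤ 1 * |w t x - w t0 x| :=
          mul_le_mul_of_nonneg_right (hζ.sq_le x) (abs_nonneg _)
      _ = _ := one_mul _
  · intro i n
    refine ⟨(1 + κ * thB q) * n, fun t ht => ?_⟩
    have i0 := (stage1_rate hq1 hq hμ hΛ hk hζ h hM0 hκ i.2.1 t).1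
    refine ⟨i0, ?_⟩
    have hn := (h.ss_iff hq1 hk hζ t n).1 ht.1
    calc _ ≤ ∫ x, (1 + κ * thB q) * (ζ x ^ 2 * |wt t x|) := by
          refine integral_mono i0.abs ((h.wt_abs_int hq1 hk hζ t).const_mul _) (fun x => ?_)
          simp only
          rw [abs_mul, abs_of_nonneg (sq_nonneg _), abs_mul]
          have g1 : |sg (w t x - w i.1.2 x) + κ * th1 q (w t x)| ≤ 1 + κ * thB q := by
            refine (abs_add_le _ _).trans (add_le_add (abs_sg_le _) ?_)
            rw [abs_mul, abs_of_pos hκ]; exact mul_le_mul_of_nonneg_left (th1_bound hq _) hκ.le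
          calc _ ≤ ζ x ^ 2 * ((1 + κ * thB q) * |wt t x|) :=
                mul_le_mul_of_nonneg_left (mul_le_mul_of_nonneg_right g1 (abs_nonneg _)) (sq_nonneg _)
            _ = _ := by ring
      _ = (1 + κ * thB q) * ∫ x, ζ x ^ 2 * |wt t x| := integral_const_mul _ _
      _ ≤ _ := by gcongr
  · intro i n
    refine ⟨4 * CN n, fun α hα β hβ hle hj => ?_⟩
    have := hj ⟨(n, α), hα⟩
    simp only at this
    have l := hlow α β
    refine (hdiffI _ _ _).trans ?_
    linarith

end st

section meas
variable {π : Measure ℝ} [IsProbabilityMeasure π]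

lemma shear_mp : MeasurePreserving (fun p : ℝ × ℝ => p.2 + p.1) (π.prod volume) volume := by
  have h1 : MeasurePreserving (fun p : ℝ × ℝ => (p.1, p.2 + p.1)) (π.prod volume) (π.prod volume) :=
    (MeasurePreserving.id π).skew_product (g := fun h x => x + h)
      (show Measurable (fun p : ℝ × ℝ => p.2 + p.1) from by fun_prop)
      (Eventually.of_forall fun h => (measurePreserving_add_right (volume : Measure ℝ) h).map_eq)
  exact measurePreserving_snd.comp h1

lemma snd_mp : MeasurePreserving (fun p : ℝ × ℝ => p.2) (π.prod volume) volume := measurePreserving_snd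

lemma mp_int {T : ℝ × ℝ → ℝ} (hT : MeasurePreserving T (π.prod volume) volume) {f : ℝ → ℝ}
    (hf : Integrable f) : Integrable (fun p => f (T p)) (π.prod volume) :=
  (hT.integrable_comp hf.aestronglyMeasurable).2 hf

lemma mp_eq {T : ℝ × ℝ → ℝ} (hT : MeasurePreserving T (π.prod volume) volume) {f : ℝ → ℝ}
    (hf : Integrable f) : ∫ p, f (T p) ∂(π.prod volume) = ∫ x, f x := by
  have h2 : AEStronglyMeasurable f (Measure.map T (π.prod volume)) := by
    rw [hT.map_eq]; exact hf.aestronglyMeasurable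
  have h1 := integral_map hT.measurable.aemeasurable h2
  rw [hT.map_eq] at h1
  exact h1.symm

end meas

/-- the linear part of the operator -/
noncomputable def Gop (μ Λ : ℝ) (k A A2 : ℝ → ℝ) (x : ℝ) : ℝ := μ * A2 x + Λ * (cv k A x - A x)

section pair
variable {q μ Λ σ : ℝ} {k e : ℝ → ℝ} {m1 M ℓ D ℓ' D' : ℝ} {ζ ζ1 ζ2 ξ ξ1 ξ2 A A1 A2 : ℝ → ℝ}

lemma Gop_int (hk : Integrable k) (hζ : Cut ζ ζ1 ζ2 ℓ D) (hA : D2 A A1 A2)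
    (hAi : Integrable A) : Integrable (fun x => ζ x ^ 2 * Gop μ Λ k A A2 x) := by
  have c := hζ.c0
  have d := hA.c0; have d1 := hA.c1; have d2 := hA.c2
  have i1 : Integrable (fun x => ζ x ^ 2 * (μ * A2 x - Λ * A x)) :=
    cs_int (ℓ := ℓ) (by fun_prop) (fun x hx => by simp [hζ.z0 x hx])
  have i2 : Integrable (fun x => ζ x ^ 2 * (Λ * cv k A x)) :=
    ((cv_int hk hAi).const_mul Λ).bdd_mul (c.pow 2).aestronglyMeasurable (c := 1)
      (Eventually.of_forall fun x => by
        rw [Real.norm_eq_abs, abs_of_nonneg (sq_nonneg _)]; exact hζ.sq_le x)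
  refine (i1.add i2).congr (Eventually.of_forall fun x => ?_)
  simp only [Pi.add_apply, Gop]; ring

lemma coreG (hq : q < 2) (hμ : 0 < μ) (hΛ : 0 < Λ) (hk : Ker k m1)
    (hζ : Cut ζ ζ1 ζ2 ℓ D) (hA : D2 A A1 A2) (hAi : Integrable A) (hM : ∫ x, |A x| ≤ M) :
    ∫ x, ζ x ^ 2 * (th1 q (A x) * Gop μ Λ k A A2 x) ≤
      thB q * (4 * μ * D ^ 2 * M + 2 * Λ * M) := by
  have c := hζ.c0; have c1 := hζ.c1; have c2 := hζ.c2
  have d := hA.c0; have d1 := hA.c1; have d2 := hA.c2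
  have t1 := th1_cont q; have t2 := th2_cont q
  have t0 := (th0_D2 q).c0
  have hB := thB_nonneg q
  have hD := hζ.hD
  have hcvi := cv_int hk.int hAi
  have i1 : Integrable (fun x => ζ x ^ 2 * (th1 q (A x) * A2 x)) :=
    cs_int (ℓ := ℓ) (by fun_prop) (fun x hx => by simp [hζ.z0 x hx])
  have i2 : Integrable (fun x => (ζ x ^ 2 * th1 q (A x)) * (cv k A x - A x)) := by
    refine (hcvi.sub hAi).bdd_mul (c := thB q) (Continuous.aestronglyMeasurable (by fun_prop))
      (Eventually.of_forall fun x => ?_)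
    rw [Real.norm_eq_abs, abs_mul, abs_of_nonneg (sq_nonneg _)]
    calc _ ≤ 1 * thB q := mul_le_mul (hζ.sq_le x) (th1_bound hq _) (abs_nonneg _) zero_le_one
      _ = _ := one_mul _
  have e : ∫ x, ζ x ^ 2 * (th1 q (A x) * Gop μ Λ k A A2 x) =
      μ * (∫ x, ζ x ^ 2 * (th1 q (A x) * A2 x))
      + Λ * (∫ x, (ζ x ^ 2 * th1 q (A x)) * (cv k A x - A x)) := by
    rw [← integral_const_mul, ← integral_const_mul, ← integral_add (i1.const_mul μ) (i2.const_mul Λ)]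
    congr 1; funext x; unfold Gop; ring
  have p1 := kato_gen (ℓ := ℓ) hζ.sq (fun x hx => by simp [hζ.z0 x hx]) (fun x hx => by simp [hζ.z0 x hx])
    (fun x hx => by simp [hζ.z0 x hx, hζ.z1 x hx]) hA (th0_D2 q)
  have p0 : 0 ≤ ∫ x, ζ x ^ 2 * (th2 q (A x) * A1 x ^ 2) :=
    integral_nonneg fun x => mul_nonneg (sq_nonneg _) (mul_nonneg (th2_nonneg _ _) (sq_nonneg _))
  have p1' : ∫ x, 2 * (ζ1 x * ζ1 x + ζ x * ζ2 x) * th0 q (A x) ≤ 4 * D ^ 2 * thB q * M := by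
    calc ∫ x, 2 * (ζ1 x * ζ1 x + ζ x * ζ2 x) * th0 q (A x) ≤ ∫ x, 4 * D ^ 2 * thB q * |A x| := by
          refine integral_mono (cs_int (ℓ := ℓ) (by fun_prop) (fun x hx => by simp [hζ.z0 x hx, hζ.z1 x hx]))
            (hAi.abs.const_mul _) (fun x => ?_)
          refine (le_abs_self _).trans ?_
          rw [abs_mul, mul_assoc (4 * D ^ 2)]
          exact mul_le_mul (hζ.sq2 x) (th0_bound hq _) (abs_nonneg _) (by positivity)
      _ = 4 * D ^ 2 * thB q * ∫ x, |A x| := integral_const_mul _ _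
      _ ≤ _ := by gcongr
  have p2 : ∫ x, (ζ x ^ 2 * th1 q (A x)) * (cv k A x - A x) ≤ 2 * thB q * M := by
    calc ∫ x, (ζ x ^ 2 * th1 q (A x)) * (cv k A x - A x) ≤ ∫ x, thB q * (|cv k A x| + |A x|) := by
          refine integral_mono i2 ((hcvi.abs.add hAi.abs).const_mul _) (fun x => ?_)
          refine (le_abs_self _).trans ?_
          rw [abs_mul, abs_mul, abs_of_nonneg (sq_nonneg _)]
          refine mul_le_mul ?_ (abs_sub _ _) (abs_nonneg _) hB
          calc _ ≤ 1 * thB q := mul_le_mul (hζ.sq_le x) (th1_bound hq _) (abs_nonneg _) zero_le_one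
            _ = _ := one_mul _
      _ = thB q * ((∫ x, |cv k A x|) + ∫ x, |A x|) := by
          rw [integral_const_mul, integral_add hcvi.abs hAi.abs]
      _ ≤ thB q * (M + M) := by
          have := cv_norm hk hAi
          gcongr; linarith
      _ = _ := by ring
  rw [e, p1]
  have := mul_le_mul_of_nonneg_left p1' hμ.le
  have := mul_le_mul_of_nonneg_left p0 hμ.le
  have := mul_le_mul_of_nonneg_left p2 hΛ.le
  linarith

lemma Lop_sigma (A A1 A2 : ℝ → ℝ) (x : ℝ) :
    Lop q (σ * μ) (σ * Λ) k A A1 A2 x = Lop q μ Λ k A A1 A2 x + (σ - 1) * Gop μ Λ k A A2 x := by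
  unfold Lop Gop; ring

lemma Lop_shift (h x : ℝ) : Lop q μ Λ k (fun y => A (y + h)) (fun y => A1 (y + h)) (fun y => A2 (y + h)) x =
    Lop q μ Λ k A A1 A2 (x + h) := by
  unfold Lop; rw [cv_shift]

lemma Gop_shift (h x : ℝ) : Gop μ Λ k (fun y => A (y + h)) (fun y => A2 (y + h)) x =
    Gop μ Λ k A A2 (x + h) := by
  unfold Gop; rw [cv_shift]

section pm
variable {π : Measure ℝ} [IsProbabilityMeasure π] {r : ℝ}

lemma pr_ae (hπ : ∀ᵐ h ∂π, |h| ≤ r) : ∀ᵐ p : ℝ × ℝ ∂(π.prod volume), |p.1| ≤ r :=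
  Measure.quasiMeasurePreserving_fst.ae hπ

/-- integrability on the product, shifted factor -/
lemma pr_shift (hπ : ∀ᵐ h ∂π, |h| ≤ r) (hζ : Cut ζ ζ1 ζ2 ℓ D) (hξ : ∀ x, |x| ≤ ℓ + r → ξ x = 1)
    {g : ℝ → ℝ} (hg : Integrable (fun x => ξ x ^ 2 * g x)) {s : ℝ × ℝ → ℝ} {c : ℝ}
    (hs : Measurable s) (hb : ∀ p, |s p| ≤ c) :
    Integrable (fun p => ζ p.2 ^ 2 * (s p * g (p.2 + p.1))) (π.prod volume) := by
  have i1 := mp_int (shear_mp (π := π)) hg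
  have hm : Measurable (fun p : ℝ × ℝ => ζ p.2 ^ 2 * s p) :=
    (((hζ.c0.pow 2).measurable).comp measurable_snd).mul hs
  refine (i1.bdd_mul (c := c) hm.aestronglyMeasurable (Eventually.of_forall fun p => ?_)).congr ?_
  · rw [Real.norm_eq_abs, abs_mul, abs_of_nonneg (sq_nonneg _)]
    calc _ ≤ 1 * c := mul_le_mul (hζ.sq_le _) (hb p) (abs_nonneg _) zero_le_one
      _ = c := one_mul _
  · filter_upwards [pr_ae hπ] with p hp
    by_cases hx : ℓ < |p.2|
    · simp [hζ.z0 _ hx]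
    · rw [hξ (p.2 + p.1) ((abs_add_le _ _).trans (add_le_add (not_lt.1 hx) hp))]; ring

lemma pr_snd (hζ : Cut ζ ζ1 ζ2 ℓ D)
    {g : ℝ → ℝ} (hg : Integrable (fun x => ζ x ^ 2 * g x)) {s : ℝ × ℝ → ℝ} {c : ℝ}
    (hs : Measurable s) (hb : ∀ p, |s p| ≤ c) :
    Integrable (fun p => ζ p.2 ^ 2 * (s p * g p.2)) (π.prod volume) := by
  have i1 := mp_int (snd_mp (π := π)) hg
  refine (i1.bdd_mul (c := c) hs.aestronglyMeasurable (Eventually.of_forall hb)).congr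
    (Eventually.of_forall fun p => ?_)
  simp only; ring

lemma pr_le {F : ℝ × ℝ → ℝ} (hF : Integrable F (π.prod volume)) {c : ℝ}
    (h : ∀ h, ∫ x, F (h, x) ≤ c) : ∫ p, F p ∂(π.prod volume) ≤ c := by
  rw [integral_prod _ hF]
  calc _ ≤ ∫ _h, c ∂π := integral_mono hF.integral_prod_left (integrable_const _) h
    _ = c := by simp

end pm
end pair

section pair
variable {q μ Λ σ : ℝ} {k e : ℝ → ℝ} {m1 M ℓ D ℓ' D' a b : ℝ} {ζ ζ1 ζ2 ξ ξ1 ξ2 : ℝ → ℝ}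
  {A At A1 A2 B Bt B1 B2 : ℝ → ℝ → ℝ}
variable {π : Measure ℝ} [IsProbabilityMeasure π] {r : ℝ}

lemma pair_rate (hq1 : 1 < q) (hq : q < 2) (hμ : 0 < μ) (hΛ : 0 < Λ) (hσ : 1 ≤ σ) (hk : Ker k m1)
    (hζ : Cut ζ ζ1 ζ2 ℓ D) (hξ : Cut ξ ξ1 ξ2 ℓ' D') (hr : 0 ≤ r) (hξ1 : ∀ x, |x| ≤ ℓ + r → ξ x = 1)
    (hA : CC q (σ * μ) (σ * Λ) k (fun _ => 0) A At A1 A2 a b M)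
    (hB : CC q μ Λ k e B Bt B1 B2 a b M) (hM0 : 0 < M) {κ : ℝ} (hκ : 0 < κ)
    (hπ : ∀ᵐ h ∂π, |h| ≤ r) {Γ t : ℝ}
    (hΓ : ∫ p : ℝ × ℝ, ζ p.2 ^ 2 * (sg (A t (p.2 + p.1) - B t p.2) *
      ((σ - 1) * Gop μ Λ k (A t) (A2 t) (p.2 + p.1))) ∂(π.prod volume) ≤ Γ) :
    Integrable (fun p : ℝ × ℝ => ζ p.2 ^ 2 * (sg (A t (p.2 + p.1) - B t p.2) * (At t (p.2 + p.1) - Bt t p.2)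
      + κ * (th1 q (A t (p.2 + p.1)) * At t (p.2 + p.1) + th1 q (B t p.2) * Bt t p.2))) (π.prod volume) ∧
    ∫ p : ℝ × ℝ, ζ p.2 ^ 2 * (sg (A t (p.2 + p.1) - B t p.2) * (At t (p.2 + p.1) - Bt t p.2)
      + κ * (th1 q (A t (p.2 + p.1)) * At t (p.2 + p.1) + th1 q (B t p.2) * Bt t p.2)) ∂(π.prod volume) ≤
      errC q μ Λ m1 M ℓ D κ + Γ + (1 + κ * thB q) * (∫ x, |e x|)
        + κ * (σ - 1) * (thB q * (4 * μ * D ^ 2 * M + 2 * Λ * M)) := by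
  have hBn := thB_nonneg q
  have cA := (hA.d2 t).c0; have cB := (hB.d2 t).c0
  have t1 := th1_cont q
  have hsm : Measurable (fun p : ℝ × ℝ => sg (A t (p.2 + p.1) - B t p.2)) :=
    measurable_sg.comp (Continuous.measurable (by fun_prop))
  have hsb : ∀ p : ℝ × ℝ, |sg (A t (p.2 + p.1) - B t p.2)| ≤ 1 := fun p => abs_sg_le _
  have htA : Measurable (fun p : ℝ × ℝ => th1 q (A t (p.2 + p.1))) := Continuous.measurable (by fun_prop)
  have htB : Measurable (fun p : ℝ × ℝ => th1 q (B t p.2)) := Continuous.measurable (by fun_prop)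
  have hξ1' : ∀ x, |x| ≤ ℓ → ξ x = 1 := fun x hx => hξ1 x (by linarith)
  have iGA := Gop_int (μ := μ) (Λ := Λ) hk.int hξ (hA.d2 t) (hA.int t)
  have iLA := Lop_int (μ := μ) (Λ := Λ) hq1 hk.int hξ (hA.d2 t) (hA.int t)
  have iLB := Lop_int (μ := μ) (Λ := Λ) hq1 hk.int hζ (hB.d2 t) (hB.int t)
  set GA := Gop μ Λ k (A t) (A2 t) with hGA
  set LA := Lop q μ Λ k (A t) (A1 t) (A2 t) with hLA
  set LB := Lop q μ Λ k (B t) (B1 t) (B2 t) with hLB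
  have eA : ∀ x, At t x = LA x + (σ - 1) * GA x := fun x => by
    rw [hA.eq t x, Lop_sigma, add_zero]
  have eB : ∀ x, Bt t x = LB x + e x := fun x => hB.eq t x
  have hκ1 : ∀ z, |κ * th1 q z| ≤ κ * thB q := fun z => by
    rw [abs_mul, abs_of_pos hκ]; exact mul_le_mul_of_nonneg_left (th1_bound hq _) hκ.le
  -- the four pieces
  have j1 : Integrable (fun p : ℝ × ℝ => ζ p.2 ^ 2 * (sg (A t (p.2 + p.1) - B t p.2) * (LA (p.2 + p.1) - LB p.2)
      + κ * (th1 q (A t (p.2 + p.1)) * LA (p.2 + p.1)) + κ * (th1 q (B t p.2) * LB p.2))) (π.prod volume) := by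
    have l1 := pr_shift hπ hζ hξ1 iLA (c := 1 + κ * thB q) (hsm.add (htA.const_mul κ))
      (fun p => (abs_add_le _ _).trans (add_le_add (hsb p) (hκ1 _)))
    have l2 := pr_snd (π := π) hζ iLB (c := 1 + κ * thB q) (hsm.sub (htB.const_mul κ))
      (fun p => (abs_sub _ _).trans (add_le_add (hsb p) (hκ1 _)))
    refine (l1.sub l2).congr (Eventually.of_forall fun p => ?_)
    simp only [Pi.sub_apply, Pi.add_apply]; ring
  have j2 : Integrable (fun p : ℝ × ℝ => ζ p.2 ^ 2 * (sg (A t (p.2 + p.1) - B t p.2) *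
      ((σ - 1) * GA (p.2 + p.1)))) (π.prod volume) := by
    refine ((pr_shift hπ hζ hξ1 iGA hsm hsb).const_mul (σ - 1)).congr (Eventually.of_forall fun p => ?_)
    simp only; ring
  have j3 : Integrable (fun p : ℝ × ℝ => ζ p.2 ^ 2 * (th1 q (A t (p.2 + p.1)) * GA (p.2 + p.1))) (π.prod volume) :=
    pr_shift hπ hζ hξ1 iGA htA (fun p => th1_bound hq _)
  have iez : Integrable (fun x => ζ x ^ 2 * e x) := hB.ei.bdd_mul (hζ.c0.pow 2).aestronglyMeasurable
    (c := 1) (Eventually.of_forall fun x => by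
        rw [Real.norm_eq_abs, abs_of_nonneg (sq_nonneg _)]; exact hζ.sq_le x)
  have j4 : Integrable (fun p : ℝ × ℝ => ζ p.2 ^ 2 * ((κ * th1 q (B t p.2) - sg (A t (p.2 + p.1) - B t p.2))
      * e p.2)) (π.prod volume) :=
    pr_snd hζ iez (c := κ * thB q + 1) ((htB.const_mul κ).sub hsm)
      (fun p => (abs_sub _ _).trans (add_le_add (hκ1 _) (hsb p)))
  have hsplit : (fun p : ℝ × ℝ => ζ p.2 ^ 2 * (sg (A t (p.2 + p.1) - B t p.2) * (At t (p.2 + p.1) - Bt t p.2)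
      + κ * (th1 q (A t (p.2 + p.1)) * At t (p.2 + p.1) + th1 q (B t p.2) * Bt t p.2))) =
      fun p => ((ζ p.2 ^ 2 * (sg (A t (p.2 + p.1) - B t p.2) * (LA (p.2 + p.1) - LB p.2)
      + κ * (th1 q (A t (p.2 + p.1)) * LA (p.2 + p.1)) + κ * (th1 q (B t p.2) * LB p.2))
      + ζ p.2 ^ 2 * (sg (A t (p.2 + p.1) - B t p.2) * ((σ - 1) * GA (p.2 + p.1))))
      + (κ * (σ - 1)) * (ζ p.2 ^ 2 * (th1 q (A t (p.2 + p.1)) * GA (p.2 + p.1))))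
      + ζ p.2 ^ 2 * ((κ * th1 q (B t p.2) - sg (A t (p.2 + p.1) - B t p.2)) * e p.2) := by
    funext p; rw [eA, eB]; ring
  have j12 := j1.add j2
  simp only [Pi.add_def] at j12
  have j3' := j3.const_mul (κ * (σ - 1))
  have j123 := j12.add j3'
  simp only [Pi.add_def] at j123
  have j1234 := j123.add j4
  simp only [Pi.add_def] at j1234
  rw [hsplit]
  refine ⟨j1234, ?_⟩
  rw [integral_add j123 j4, integral_add j12 j3', integral_add j1 j2, integral_const_mul]
  have b1 : ∫ p : ℝ × ℝ, ζ p.2 ^ 2 * (sg (A t (p.2 + p.1) - B t p.2) * (LA (p.2 + p.1) - LB p.2)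
      + κ * (th1 q (A t (p.2 + p.1)) * LA (p.2 + p.1)) + κ * (th1 q (B t p.2) * LB p.2)) ∂(π.prod volume)
      ≤ errC q μ Λ m1 M ℓ D κ := by
    refine pr_le j1 (fun h => ?_)
    have hc := core hq1 hq hμ hΛ hk hζ ((hA.d2 t).shift h) ((hA.int t).comp_add_right h)
      (M := M) (by rw [integral_add_right_eq_self (fun x => |A t x|) h]; exact hA.bd t)
      (hB.d2 t) (hB.int t) (hB.bd t) hM0 hκ
    simp only [Lop_shift] at hc
    exact hc
  have b3 : ∫ p : ℝ × ℝ, ζ p.2 ^ 2 * (th1 q (A t (p.2 + p.1)) * GA (p.2 + p.1)) ∂(π.prod volume)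
      ≤ thB q * (4 * μ * D ^ 2 * M + 2 * Λ * M) := by
    refine pr_le j3 (fun h => ?_)
    have hc := coreG hq hμ hΛ hk hζ ((hA.d2 t).shift h) ((hA.int t).comp_add_right h)
      (M := M) (by rw [integral_add_right_eq_self (fun x => |A t x|) h]; exact hA.bd t)
    simp only [Gop_shift] at hc
    exact hc
  have b4 : ∫ p : ℝ × ℝ, ζ p.2 ^ 2 * ((κ * th1 q (B t p.2) - sg (A t (p.2 + p.1) - B t p.2))
      * e p.2) ∂(π.prod volume) ≤ (1 + κ * thB q) * ∫ x, |e x| := by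
    rw [← mp_eq (snd_mp (π := π)) hB.ei.abs, ← integral_const_mul]
    refine integral_mono j4 ((mp_int (snd_mp (π := π)) hB.ei.abs).const_mul _) (fun p => ?_)
    refine (le_abs_self _).trans ?_
    rw [abs_mul, abs_mul, abs_of_nonneg (sq_nonneg _)]
    have g := (abs_sub (κ * th1 q (B t p.2)) (sg (A t (p.2 + p.1) - B t p.2))).trans (add_le_add (hκ1 _) (hsb p))
    calc _ ≤ 1 * ((κ * thB q + 1) * |e p.2|) :=
          mul_le_mul (hζ.sq_le _) (mul_le_mul_of_nonneg_right g (abs_nonneg _)) (by positivity) zero_le_one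
      _ = _ := by ring
  have b3' := mul_le_mul_of_nonneg_left b3 (mul_nonneg hκ.le (sub_nonneg.2 hσ))
  linarith

lemma pair_cc (hq1 : 1 < q) (hq : q < 2) (hμ : 0 < μ) (hΛ : 0 < Λ) (hσ : 1 ≤ σ) (hk : Ker k m1)
    (hζ : Cut ζ ζ1 ζ2 ℓ D) (hξ : Cut ξ ξ1 ξ2 ℓ' D') (hr : 0 ≤ r) (hξ1 : ∀ x, |x| ≤ ℓ + r → ξ x = 1)
    (hA : CC q (σ * μ) (σ * Λ) k (fun _ => 0) A At A1 A2 a b M)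
    (hB : CC q μ Λ k e B Bt B1 B2 a b M) (hM0 : 0 < M) {κ : ℝ} (hκ : 0 < κ)
    (hπ : ∀ᵐ h ∂π, |h| ≤ r) {Γ : ℝ}
    (hΓ : ∀ t ∈ Set.Icc a b, ∫ p : ℝ × ℝ, ζ p.2 ^ 2 * (sg (A t (p.2 + p.1) - B t p.2) *
      ((σ - 1) * Gop μ Λ k (A t) (A2 t) (p.2 + p.1))) ∂(π.prod volume) ≤ Γ)
    {s t : ℝ} (hs : s ∈ Set.Icc a b) (ht : t ∈ Set.Icc a b) (hst : s ≤ t) :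
    (∫ p : ℝ × ℝ, ζ p.2 ^ 2 * (|A t (p.2 + p.1) - B t p.2|
      + κ * (th0 q (A t (p.2 + p.1)) + th0 q (B t p.2))) ∂(π.prod volume))
    - (∫ p : ℝ × ℝ, ζ p.2 ^ 2 * (|A s (p.2 + p.1) - B s p.2|
      + κ * (th0 q (A s (p.2 + p.1)) + th0 q (B s p.2))) ∂(π.prod volume)) ≤
    (errC q μ Λ m1 M ℓ D κ + Γ + (1 + κ * thB q) * (∫ x, |e x|)
        + κ * (σ - 1) * (thB q * (4 * μ * D ^ 2 * M + 2 * Λ * M))) * (t - s) := by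
  have hBn := thB_nonneg q
  have t0 := (th0_D2 q).c0
  have t1 := th1_cont q
  have hcζ := hζ.c0
  have hσ0 : 0 < σ := by linarith
  obtain ⟨Ca, hCa⟩ := stage1 hq1 hq (mul_pos hσ0 hμ) (mul_pos hσ0 hΛ) hk hξ hA hM0
  obtain ⟨Cb, hCb⟩ := stage1 hq1 hq hμ hΛ hk hξ hB hM0
  have hκ1 : ∀ z, |κ * th1 q z| ≤ κ * thB q := fun z => by
    rw [abs_mul, abs_of_pos hκ]; exact mul_le_mul_of_nonneg_left (th1_bound hq _) hκ.le
  have hξm : ∀ x, ‖ξ x ^ 2‖ ≤ 1 := fun x => by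
    rw [Real.norm_eq_abs, abs_of_nonneg (sq_nonneg _)]; exact hξ.sq_le x
  -- comparison of cutoffs
  have cmp1 : ∀ {g : ℝ → ℝ}, (∀ x, 0 ≤ g x) → ∀ᵐ p : ℝ × ℝ ∂(π.prod volume),
      ζ p.2 ^ 2 * g (p.2 + p.1) ≤ ξ (p.2 + p.1) ^ 2 * g (p.2 + p.1) := by
    intro g hg
    filter_upwards [pr_ae hπ] with p hp
    refine mul_le_mul_of_nonneg_right ?_ (hg _)
    by_cases hx : ℓ < |p.2|
    · rw [hζ.z0 _ hx]; simp [sq_nonneg]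
    · rw [hξ1 (p.2 + p.1) ((abs_add_le _ _).trans (add_le_add (not_lt.1 hx) hp))]
      simpa using hζ.sq_le p.2
  have cmp2 : ∀ x, ζ x ^ 2 ≤ ξ x ^ 2 := by
    intro x
    by_cases hx : ℓ < |x|
    · rw [hζ.z0 _ hx]; simp [sq_nonneg]
    · rw [hξ1 x (by linarith)]; simpa using hζ.sq_le x
  have iT : ∀ {g : ℝ → ℝ}, Integrable g → Integrable (fun p : ℝ × ℝ => g (p.2 + p.1)) (π.prod volume) :=
    fun hg => mp_int shear_mp hg
  have iS : ∀ {g : ℝ → ℝ}, Integrable g → Integrable (fun p : ℝ × ℝ => g p.2) (π.prod volume) :=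
    fun hg => mp_int snd_mp hg
  have hzm : AEStronglyMeasurable (fun p : ℝ × ℝ => ζ p.2 ^ 2) (π.prod volume) :=
    (((hcζ.pow 2).measurable).comp measurable_snd).aestronglyMeasurable
  have hzb : ∀ p : ℝ × ℝ, ‖ζ p.2 ^ 2‖ ≤ 1 := fun p => by
    rw [Real.norm_eq_abs, abs_of_nonneg (sq_nonneg _)]; exact hζ.sq_le _
  have ith : ∀ {w : ℝ → ℝ}, Integrable w → Integrable (fun x => th0 q (w x)) := fun hw =>
    (hw.abs.const_mul (thB q)).mono' (t0.comp_aestronglyMeasurable hw.aestronglyMeasurable)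
      (Eventually.of_forall fun x => th0_bound hq _)
  have iy : ∀ t, Integrable (fun p : ℝ × ℝ => ζ p.2 ^ 2 * (|A t (p.2 + p.1) - B t p.2|
      + κ * (th0 q (A t (p.2 + p.1)) + th0 q (B t p.2)))) (π.prod volume) := fun t =>
    (((iT (hA.int t)).sub (iS (hB.int t))).abs.add (((iT (ith (hA.int t))).add
      (iS (ith (hB.int t)))).const_mul κ)).bdd_mul hzm (c := 1) (Eventually.of_forall hzb)
  have hdiff : ∀ t s (p : ℝ × ℝ), |ζ p.2 ^ 2 * (|A t (p.2 + p.1) - B t p.2|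
      + κ * (th0 q (A t (p.2 + p.1)) + th0 q (B t p.2))) - ζ p.2 ^ 2 * (|A s (p.2 + p.1) - B s p.2|
      + κ * (th0 q (A s (p.2 + p.1)) + th0 q (B s p.2)))| ≤
      (1 + κ * thB q) * (ζ p.2 ^ 2 * |A t (p.2 + p.1) - A s (p.2 + p.1)|
        + ζ p.2 ^ 2 * |B t p.2 - B s p.2|) := by
    intro t s p
    set α := A t (p.2 + p.1); set α' := A s (p.2 + p.1); set β := B t p.2; set β' := B s p.2
    rw [← mul_sub, abs_mul, abs_of_nonneg (sq_nonneg _)]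
    have g1 : abs (|α - β| - |α' - β'|) ≤ |α - α'| + |β - β'| := by
      refine (abs_abs_sub_abs_le_abs_sub _ _).trans ?_
      rw [show α - β - (α' - β') = (α - α') - (β - β') by ring]; exact abs_sub _ _
    have g2 : |κ * (th0 q α - th0 q α')| ≤ κ * (thB q * |α - α'|) := by
      rw [abs_mul, abs_of_pos hκ]; exact mul_le_mul_of_nonneg_left (th0_lip hq _ _) hκ.le
    have g3 : |κ * (th0 q β - th0 q β')| ≤ κ * (thB q * |β - β'|) := by
      rw [abs_mul, abs_of_pos hκ]; exact mul_le_mul_of_nonneg_left (th0_lip hq _ _) hκ.le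
    have g4 : |(|α - β| + κ * (th0 q α + th0 q β)) - (|α' - β'| + κ * (th0 q α' + th0 q β'))| ≤
        (1 + κ * thB q) * (|α - α'| + |β - β'|) := by
      rw [show (|α - β| + κ * (th0 q α + th0 q β)) - (|α' - β'| + κ * (th0 q α' + th0 q β')) =
        (|α - β| - |α' - β'|) + (κ * (th0 q α - th0 q α') + κ * (th0 q β - th0 q β')) by ring]
      refine (abs_add_le _ _).trans ?_
      have := abs_add_le (κ * (th0 q α - th0 q α')) (κ * (th0 q β - th0 q β'))
      linarith
    calc _ ≤ ζ p.2 ^ 2 * ((1 + κ * thB q) * (|α - α'| + |β - β'|)) :=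
          mul_le_mul_of_nonneg_left g4 (sq_nonneg _)
      _ = _ := by ring
  have iξ : ∀ {g : ℝ → ℝ}, Integrable g → Integrable (fun x => ξ x ^ 2 * g x) := fun hg =>
    hg.bdd_mul (hξ.c0.pow 2).aestronglyMeasurable (c := 1) (Eventually.of_forall hξm)
  have idA : ∀ t s, Integrable (fun x => ξ x ^ 2 * |A t x - A s x|) := fun t s =>
    iξ ((hA.int t).sub (hA.int s)).abs
  have idB : ∀ t s, Integrable (fun x => ξ x ^ 2 * |B t x - B s x|) := fun t s =>
    iξ ((hB.int t).sub (hB.int s)).abs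
  have hdiffI : ∀ t s, ∫ p : ℝ × ℝ, |ζ p.2 ^ 2 * (|A t (p.2 + p.1) - B t p.2|
      + κ * (th0 q (A t (p.2 + p.1)) + th0 q (B t p.2))) - ζ p.2 ^ 2 * (|A s (p.2 + p.1) - B s p.2|
      + κ * (th0 q (A s (p.2 + p.1)) + th0 q (B s p.2)))| ∂(π.prod volume) ≤
      (1 + κ * thB q) * ((∫ x, ξ x ^ 2 * |A t x - A s x|) + ∫ x, ξ x ^ 2 * |B t x - B s x|) := by
    intro t s
    have u1 := iT (idA t s)
    have u2 := iS (idB t s)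
    rw [← mp_eq (shear_mp (π := π)) (idA t s), ← mp_eq (snd_mp (π := π)) (idB t s), ← integral_add u1 u2,
      ← integral_const_mul]
    refine integral_mono_ae ((iy t).sub (iy s)).abs ((u1.add u2).const_mul _) ?_
    filter_upwards [cmp1 (g := fun x => |A t x - A s x|) (fun x => abs_nonneg _)] with p hp
    refine (hdiff t s p).trans (mul_le_mul_of_nonneg_left (add_le_add hp ?_) (by positivity))
    exact mul_le_mul_of_nonneg_right (cmp2 _) (abs_nonneg _)
  have mA : Measurable (fun z : ℝ × (ℝ × ℝ) => A z.1 (z.2.2 + z.2.1)) :=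
    hA.mw.comp (show Measurable (fun z : ℝ × (ℝ × ℝ) => (z.1, z.2.2 + z.2.1)) by fun_prop)
  have mAt : Measurable (fun z : ℝ × (ℝ × ℝ) => At z.1 (z.2.2 + z.2.1)) :=
    hA.mwtu.comp (show Measurable (fun z : ℝ × (ℝ × ℝ) => (z.1, z.2.2 + z.2.1)) by fun_prop)
  have mB : Measurable (fun z : ℝ × (ℝ × ℝ) => B z.1 z.2.2) :=
    hB.mw.comp (show Measurable (fun z : ℝ × (ℝ × ℝ) => (z.1, z.2.2)) by fun_prop)
  have mBt : Measurable (fun z : ℝ × (ℝ × ℝ) => Bt z.1 z.2.2) :=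
    hB.mwtu.comp (show Measurable (fun z : ℝ × (ℝ × ℝ) => (z.1, z.2.2)) by fun_prop)
  have mz : Measurable (fun z : ℝ × (ℝ × ℝ) => ζ z.2.2 ^ 2) :=
    ((hcζ.pow 2).measurable).comp (measurable_snd.comp measurable_snd)
  have habs : ∀ t (p : ℝ × ℝ), |ζ p.2 ^ 2 * (sg (A t (p.2 + p.1) - B t p.2) * (At t (p.2 + p.1) - Bt t p.2)
      + κ * (th1 q (A t (p.2 + p.1)) * At t (p.2 + p.1) + th1 q (B t p.2) * Bt t p.2))| ≤
      (1 + κ * thB q) * (ζ p.2 ^ 2 * |At t (p.2 + p.1)| + ζ p.2 ^ 2 * |Bt t p.2|) := by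
    intro t p
    rw [abs_mul, abs_of_nonneg (sq_nonneg _)]
    have g1 : |sg (A t (p.2 + p.1) - B t p.2) + κ * th1 q (A t (p.2 + p.1))| ≤ 1 + κ * thB q :=
      (abs_add_le _ _).trans (add_le_add (abs_sg_le _) (hκ1 _))
    have g2 : |κ * th1 q (B t p.2) - sg (A t (p.2 + p.1) - B t p.2)| ≤ κ * thB q + 1 :=
      (abs_sub _ _).trans (add_le_add (hκ1 _) (abs_sg_le _))
    have g3 := mul_le_mul_of_nonneg_right g1 (abs_nonneg (At t (p.2 + p.1)))
    have g4 := mul_le_mul_of_nonneg_right g2 (abs_nonneg (Bt t p.2))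
    rw [← abs_mul] at g3 g4
    have g5 : |sg (A t (p.2 + p.1) - B t p.2) * (At t (p.2 + p.1) - Bt t p.2)
      + κ * (th1 q (A t (p.2 + p.1)) * At t (p.2 + p.1) + th1 q (B t p.2) * Bt t p.2)| ≤
      (1 + κ * thB q) * (|At t (p.2 + p.1)| + |Bt t p.2|) := by
      rw [show sg (A t (p.2 + p.1) - B t p.2) * (At t (p.2 + p.1) - Bt t p.2)
        + κ * (th1 q (A t (p.2 + p.1)) * At t (p.2 + p.1) + th1 q (B t p.2) * Bt t p.2) =
        (sg (A t (p.2 + p.1) - B t p.2) + κ * th1 q (A t (p.2 + p.1))) * At t (p.2 + p.1) +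
        (κ * th1 q (B t p.2) - sg (A t (p.2 + p.1) - B t p.2)) * Bt t p.2 by ring]
      refine (abs_add_le _ _).trans ?_
      linarith
    calc _ ≤ ζ p.2 ^ 2 * ((1 + κ * thB q) * (|At t (p.2 + p.1)| + |Bt t p.2|)) :=
          mul_le_mul_of_nonneg_left g5 (sq_nonneg _)
      _ = _ := by ring
  have t0m := t0.measurable
  have t1m := t1.measurable
  have sgm := measurable_sg
  have hme1 : Measurable (fun z : ℝ × (ℝ × ℝ) => ζ z.2.2 ^ 2 * (|A z.1 (z.2.2 + z.2.1) - B z.1 z.2.2|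
      + κ * (th0 q (A z.1 (z.2.2 + z.2.1)) + th0 q (B z.1 z.2.2)))) := by
    have e1 := mA.sub mB
    have e2 := e1.abs
    have e3 := (t0m.comp mA).add (t0m.comp mB)
    exact mz.mul (e2.add (e3.const_mul κ))
  have hme2 : Measurable (fun z : ℝ × (ℝ × ℝ) => ζ z.2.2 ^ 2 * (sg (A z.1 (z.2.2 + z.2.1) - B z.1 z.2.2) *
      (At z.1 (z.2.2 + z.2.1) - Bt z.1 z.2.2)
      + κ * (th1 q (A z.1 (z.2.2 + z.2.1)) * At z.1 (z.2.2 + z.2.1) + th1 q (B z.1 z.2.2) * Bt z.1 z.2.2))) := by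
    have e1 := sgm.comp (mA.sub mB)
    have e2 := e1.mul (mAt.sub mBt)
    have e3 := ((t1m.comp mA).mul mAt).add ((t1m.comp mB).mul mBt)
    exact mz.mul (e2.add (e3.const_mul κ))
  have hAL := AL (ι := Unit) (π.prod volume) (a := a) (b := b)
    (fun _ t p => ζ p.2 ^ 2 * (|A t (p.2 + p.1) - B t p.2|
      + κ * (th0 q (A t (p.2 + p.1)) + th0 q (B t p.2))))
    (fun _ t p => ζ p.2 ^ 2 * (sg (A t (p.2 + p.1) - B t p.2) * (At t (p.2 + p.1) - Bt t p.2)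
      + κ * (th1 q (A t (p.2 + p.1)) * At t (p.2 + p.1) + th1 q (B t p.2) * Bt t p.2)))
    (fun _ => errC q μ Λ m1 M ℓ D κ + Γ + (1 + κ * thB q) * (∫ x, |e x|)
        + κ * (σ - 1) * (thB q * (4 * μ * D ^ 2 * M + 2 * Λ * M)))
    (fun _ => hme1) (fun _ => hme2)
    ?_ ?_ (fun _ t _ => iy t) ?_
    (fun _ t ht => (pair_rate hq1 hq hμ hΛ hσ hk hζ hξ hr hξ1 hA hB hM0 hκ hπ (hΓ t ht)).2)
    (fun n => SS ξ At n ∩ SS ξ Bt n)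
    (fun n => (hA.ss_closed hξ n).inter (hB.ss_closed hξ n)) ?_ ?_ ?_
  · exact hAL () s hs t ht hst
  · intro _ p
    obtain ⟨L, hL⟩ := (isCompact_Icc (a := a) (b := b)).exists_bound_of_continuousOn
      (hA.cwt (p.2 + p.1)).continuousOn
    obtain ⟨L', hL'⟩ := (isCompact_Icc (a := a) (b := b)).exists_bound_of_continuousOn
      (hB.cwt p.2).continuousOn
    refine ⟨(1 + κ * thB q) * (ζ p.2 ^ 2 * L + ζ p.2 ^ 2 * L'), fun t ht => (habs t p).trans ?_⟩
    exact mul_le_mul_of_nonneg_left (add_le_add (mul_le_mul_of_nonneg_left (hL t ht) (sq_nonneg _))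
      (mul_le_mul_of_nonneg_left (hL' t ht) (sq_nonneg _))) (by positivity)
  · intro _ p s hs t ht hst
    have cA := hA.cw (p.2 + p.1); have cAt := hA.cwt (p.2 + p.1)
    have cB := hB.cw p.2; have cBt := hB.cwt p.2
    have s1 := sg_time (c := fun r => A r (p.2 + p.1) - B r p.2)
      (c1 := fun r => At r (p.2 + p.1) - Bt r p.2) hst (Continuous.continuousOn (by fun_prop))
      (fun r hr => (hA.dt (p.2 + p.1) r ⟨hs.1.trans_lt hr.1, hr.2.trans_le ht.2⟩).sub
        (hB.dt p.2 r ⟨hs.1.trans_lt hr.1, hr.2.trans_le ht.2⟩)) (Continuous.continuousOn (by fun_prop))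
    have s2 := hA.th_time (p.2 + p.1) hs ht hst
    have s3 := hB.th_time p.2 hs ht hst
    have hi1 := sg_ii (c := fun r => A r (p.2 + p.1) - B r p.2)
      (c1 := fun r => At r (p.2 + p.1) - Bt r p.2) (by fun_prop) (by fun_prop) s t
    have hi2 := hA.th_ii (p.2 + p.1) s t
    have hi3 := hB.th_ii p.2 s t
    rw [intervalIntegral.integral_const_mul, intervalIntegral.integral_add hi1 ((hi2.add hi3).const_mul κ),
      s1, intervalIntegral.integral_const_mul, intervalIntegral.integral_add hi2 hi3, s2, s3]
    ring
  · intro _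
    refine (cont_of_l1 (g := fun t0 t => (1 + κ * thB q) * ((∫ x, |A t x - A t0 x|) + ∫ x, |B t x - B t0 x|))
      iy (fun t0 t => (hdiffI t t0).trans ?_) (fun t0 => by
        simpa using ((hA.l1 t0).add (hB.l1 t0)).const_mul (1 + κ * thB q))).continuousOn
    refine mul_le_mul_of_nonneg_left (add_le_add
      (integral_mono (idA t t0) ((hA.int t).sub (hA.int t0)).abs fun x => ?_)
      (integral_mono (idB t t0) ((hB.int t).sub (hB.int t0)).abs fun x => ?_)) (by positivity)
    · calc ξ x ^ 2 * |A t x - A t0 x| ≤ 1 * |A t x - A t0 x| :=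
          mul_le_mul_of_nonneg_right (hξ.sq_le x) (abs_nonneg _)
        _ = _ := one_mul _
    · calc ξ x ^ 2 * |B t x - B t0 x| ≤ 1 * |B t x - B t0 x| :=
          mul_le_mul_of_nonneg_right (hξ.sq_le x) (abs_nonneg _)
        _ = _ := one_mul _
  · intro t _
    obtain ⟨n1, h1⟩ := hA.ss_cover hq1 hk hξ t
    obtain ⟨n2, h2⟩ := hB.ss_cover hq1 hk hξ t
    exact Set.mem_iUnion.2 ⟨max n1 n2, h1 _ (le_max_left _ _), h2 _ (le_max_right _ _)⟩
  · intro _ n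
    refine ⟨(1 + κ * thB q) * (n + n), fun t ht => ?_⟩
    have i0 := (pair_rate hq1 hq hμ hΛ hσ hk hζ hξ hr hξ1 hA hB hM0 hκ hπ (hΓ t ht.2)).1
    refine ⟨i0, ?_⟩
    have na := (hA.ss_iff hq1 hk hξ t n).1 ht.1.1
    have nb := (hB.ss_iff hq1 hk hξ t n).1 ht.1.2
    have u1 := iT (hA.wt_abs_int hq1 hk hξ t)
    have u2 := iS (hB.wt_abs_int hq1 hk hξ t)
    rw [← mp_eq (shear_mp (π := π)) (hA.wt_abs_int hq1 hk hξ t)] at na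
    rw [← mp_eq (snd_mp (π := π)) (hB.wt_abs_int hq1 hk hξ t)] at nb
    refine le_trans ?_ (mul_le_mul_of_nonneg_left (add_le_add na nb) (by positivity))
    rw [← integral_add u1 u2, ← integral_const_mul]
    refine integral_mono_ae i0.abs ((u1.add u2).const_mul _) ?_
    filter_upwards [cmp1 (g := fun x => |At t x|) (fun x => abs_nonneg _)] with p hp
    refine (habs t p).trans (mul_le_mul_of_nonneg_left (add_le_add hp ?_) (by positivity))
    exact mul_le_mul_of_nonneg_right (cmp2 _) (abs_nonneg _)
  · intro _ n
    refine ⟨(1 + κ * thB q) * (Ca n + Cb n), fun α hα β hβ hle _ => (hdiffI β α).trans ?_⟩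
    have k1 := hCa n α ⟨hα.1.1, hα.2⟩ β hβ hle
    have k2 := hCb n α ⟨hα.1.2, hα.2⟩ β hβ hle
    have := mul_le_mul_of_nonneg_left (add_le_add k1 k2) (by positivity : 0 ≤ 1 + κ * thB q)
    linarith

end pair

lemma D2.of_contDiff {f : ℝ → ℝ} (h : ContDiff ℝ 2 f) : D2 f (deriv f) (deriv (deriv f)) := by
  have h1 : ContDiff ℝ 1 (deriv f) := by
    have := (contDiff_succ_iff_deriv (n := 1) (f := f)).1 (by simpa [one_add_one_eq_two] using h)
    exact this.2.2
  exact ⟨fun x => (h.differentiable (by norm_num) x).hasDerivAt,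
    fun x => (h1.differentiable (by norm_num) x).hasDerivAt, h1.continuous_deriv (by norm_num)⟩

lemma zero_out {f : ℝ → ℝ} {r : ℝ} (h : ∀ x, r < |x| → f x = 0) : ∀ x, r < |x| → deriv f x = 0 := by
  intro x hx
  have : f =ᶠ[nhds x] fun _ => 0 := by
    filter_upwards [(isOpen_lt continuous_const continuous_abs).mem_nhds hx] with y hy using h y hy
  rw [this.deriv_eq]; simp

lemma bump_exists : ∃ η η1 η2 : ℝ → ℝ, ∃ c : ℝ, Cut η η1 η2 2 c ∧ ∀ x, |x| ≤ 1 → η x = 1 := by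
  let f : ContDiffBump (0 : ℝ) := ⟨1, 2, by norm_num, by norm_num⟩
  have hd := D2.of_contDiff (f := f) (f.contDiff (n := 2))
  have z0 : ∀ x, 2 < |x| → f x = 0 := fun x hx => f.zero_of_le_dist (by
    rw [Real.dist_eq, sub_zero]; exact hx.le)
  have z1 := zero_out z0
  have z2 := zero_out z1
  have hb : ∀ g : ℝ → ℝ, Continuous g → (∀ x, 2 < |x| → g x = 0) → ∃ c, ∀ x, |g x| ≤ c := by
    intro g hg hz
    obtain ⟨c, hc⟩ := (isCompact_Icc (a := (-2:ℝ)) (b := 2)).exists_bound_of_continuousOn hg.continuousOn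
    refine ⟨max c 0, fun x => ?_⟩
    by_cases hx : 2 < |x|
    · rw [hz x hx]; simp
    · exact (hc x (abs_le.1 (not_lt.1 hx))).trans (le_max_left _ _)
  obtain ⟨c1, hc1⟩ := hb _ hd.c1 z1
  obtain ⟨c2, hc2⟩ := hb _ hd.c2 z2
  set c := max 1 (max c1 c2)
  have h1c : 1 ≤ c := le_max_left _ _
  refine ⟨f, deriv f, deriv (deriv f), c, ⟨hd, z0, z1, z2, fun x => f.nonneg, fun x => f.le_one, ?_, ?_,
    by norm_num, by linarith⟩, ?_⟩
  · exact fun x => (hc1 x).trans ((le_max_left _ _).trans (le_max_right _ _))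
  · intro x
    have : c2 ≤ c := (le_max_right _ _).trans (le_max_right _ _)
    have := hc2 x
    nlinarith
  · intro x hx
    exact f.one_of_mem_closedBall (by rw [Metric.mem_closedBall, Real.dist_eq, sub_zero]; exact hx)

lemma D2.scale {w w1 w2 : ℝ → ℝ} (h : D2 w w1 w2) (c : ℝ) :
    D2 (fun x => w (c * x)) (fun x => c * w1 (c * x)) (fun x => c ^ 2 * w2 (c * x)) := by
  have hc : ∀ x, HasDerivAt (fun x : ℝ => c * x) c x := fun x => by
    simpa using (hasDerivAt_id x).const_mul c
  refine ⟨fun x => ?_, fun x => ?_, ?_⟩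
  · have := (h.d1 (c * x)).comp x (hc x)
    exact this.congr_deriv (by ring)
  · have := ((h.d2 (c * x)).comp x (hc x)).const_mul c
    exact this.congr_deriv (by ring)
  · exact continuous_const.mul (h.c2.comp (by fun_prop))

lemma D2.cmul {w w1 w2 : ℝ → ℝ} (h : D2 w w1 w2) (c : ℝ) :
    D2 (fun x => c * w x) (fun x => c * w1 x) (fun x => c * w2 x) :=
  ⟨fun x => (h.d1 x).const_mul c, fun x => (h.d2 x).const_mul c, continuous_const.mul h.c2⟩

lemma cut_exists : ∃ c > 0, ∀ R > 0, ∃ ζ ζ1 ζ2 : ℝ → ℝ, Cut ζ ζ1 ζ2 (2 * R) (c / R) ∧ ∀ x, |x| ≤ R → ζ x = 1 := by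
  obtain ⟨η, η1, η2, c, h, h1⟩ := bump_exists
  refine ⟨c, h.hD, fun R hR => ⟨_, _, _, ⟨h.toD2.scale R⁻¹, ?_, ?_, ?_, fun x => h.nn _, fun x => h.le1 _, ?_, ?_, ?_, ?_⟩, ?_⟩⟩
  all_goals have hRi : 0 < R⁻¹ := inv_pos.2 hR
  all_goals have habs : ∀ x, |R⁻¹ * x| = |x| / R := fun x => by
              rw [abs_mul, abs_of_pos hRi]; field_simp
  · intro x hx
    exact h.z0 _ (by rw [habs, lt_div_iff₀ hR]; exact hx)
  · intro x hx
    rw [h.z1 _ (by rw [habs, lt_div_iff₀ hR]; exact hx), mul_zero]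
  · intro x hx
    rw [h.z2 _ (by rw [habs, lt_div_iff₀ hR]; exact hx), mul_zero]
  · intro x
    rw [abs_mul, abs_of_pos hRi]
    calc _ ≤ R⁻¹ * c := mul_le_mul_of_nonneg_left (h.b1 _) hRi.le
      _ = _ := by field_simp
  · intro x
    rw [abs_mul, abs_of_pos (by positivity)]
    calc _ ≤ R⁻¹ ^ 2 * c ^ 2 := mul_le_mul_of_nonneg_left (h.b2 _) (by positivity)
      _ = _ := by field_simp
  · positivity
  · exact div_pos h.hD hR
  · intro x hx
    exact h1 _ (by rw [habs, div_le_one hR]; exact hx)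

lemma errC_eq {q μ Λ m1 M c ε : ℝ} (hε : ε ≠ 0) (hμ : μ ≠ 0) :
    errC q μ Λ m1 M (2 * (1 / ε ^ 2)) (c / (1 / ε ^ 2)) ε =
    8 * μ * (c * ε ^ 2) ^ 2 * M * (1 + ε * thB q) + 4 * Λ * M * (c * ε ^ 2) * m1 + 4 * ε * thB q * Λ * M +
    4 * (1 + ε * thB q) * (M * (4 * c ^ 2 * ε ^ 2 + c ^ 2 * ε ^ 4 * M) +
      M ^ 2 * (4 * c ^ 2 * ε + c ^ 2 * ε ^ 3 * M) * (1 + ε * thB q) / (2 * μ)) := by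
  unfold errC
  field_simp
  ring

section lim
variable {q μ Λ σ : ℝ} {k e : ℝ → ℝ} {m1 M a b : ℝ} {A At A1 A2 B Bt B1 B2 : ℝ → ℝ → ℝ}
variable {π : Measure ℝ} [IsProbabilityMeasure π] {r : ℝ}

lemma pair_lim (hq1 : 1 < q) (hq : q < 2) (hμ : 0 < μ) (hΛ : 0 < Λ) (hσ : 1 ≤ σ) (hk : Ker k m1)
    (hr : 0 ≤ r)
    (hA : CC q (σ * μ) (σ * Λ) k (fun _ => 0) A At A1 A2 a b M)
    (hB : CC q μ Λ k e B Bt B1 B2 a b M) (hM0 : 0 < M)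
    (hπ : ∀ᵐ h ∂π, |h| ≤ r) {Γ : ℝ}
    (hΓ : ∀ (ζ ζ1 ζ2 : ℝ → ℝ) (ℓ D : ℝ), Cut ζ ζ1 ζ2 ℓ D → ∀ t ∈ Set.Icc a b,
      ∫ p : ℝ × ℝ, ζ p.2 ^ 2 * (sg (A t (p.2 + p.1) - B t p.2) *
      ((σ - 1) * Gop μ Λ k (A t) (A2 t) (p.2 + p.1))) ∂(π.prod volume) ≤ Γ)
    {s t : ℝ} (hs : s ∈ Set.Icc a b) (ht : t ∈ Set.Icc a b) (hst : s ≤ t) :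
    (∫ p : ℝ × ℝ, |A t (p.2 + p.1) - B t p.2| ∂(π.prod volume))
    - (∫ p : ℝ × ℝ, |A s (p.2 + p.1) - B s p.2| ∂(π.prod volume)) ≤
    (Γ + ∫ x, |e x|) * (t - s) := by
  obtain ⟨c, hc, hcut⟩ := cut_exists
  set ε : ℕ → ℝ := fun n => 1 / ((n : ℝ) + 1) with hεd
  have hε : ∀ n, 0 < ε n := fun n => Nat.one_div_pos_of_nat
  have hε1 : ∀ n, ε n ≤ 1 := fun n => by
    simp only [hεd]; rw [div_le_one (by positivity)]; linarith [(Nat.cast_nonneg n : (0:ℝ) ≤ n)]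
  have hε0 : Tendsto ε atTop (nhds 0) := tendsto_one_div_add_atTop_nhds_zero_nat
  choose ζ ζ1 ζ2 hζ hζ1 using fun n => hcut (1 / ε n ^ 2) (by have := hε n; positivity)
  have t0 := (th0_D2 q).c0
  have iT : ∀ {g : ℝ → ℝ}, Integrable g → Integrable (fun p : ℝ × ℝ => g (p.2 + p.1)) (π.prod volume) :=
    fun hg => mp_int shear_mp hg
  have iS : ∀ {g : ℝ → ℝ}, Integrable g → Integrable (fun p : ℝ × ℝ => g p.2) (π.prod volume) :=
    fun hg => mp_int snd_mp hg
  have ith : ∀ {w : ℝ → ℝ}, Integrable w → Integrable (fun x => th0 q (w x)) := fun hw =>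
    (hw.abs.const_mul (thB q)).mono' (t0.comp_aestronglyMeasurable hw.aestronglyMeasurable)
      (Eventually.of_forall fun x => th0_bound hq _)
  have hlim : ∀ t, Tendsto (fun n => ∫ p : ℝ × ℝ, ζ n p.2 ^ 2 * (|A t (p.2 + p.1) - B t p.2|
      + ε n * (th0 q (A t (p.2 + p.1)) + th0 q (B t p.2))) ∂(π.prod volume)) atTop
      (nhds (∫ p : ℝ × ℝ, |A t (p.2 + p.1) - B t p.2| ∂(π.prod volume))) := by
    intro t
    have i1 := ((iT (hA.int t)).sub (iS (hB.int t))).abs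
    have i2 := (iT (ith (hA.int t))).add (iS (ith (hB.int t)))
    refine tendsto_integral_of_dominated_convergence (fun p => |A t (p.2 + p.1) - B t p.2| +
      |th0 q (A t (p.2 + p.1)) + th0 q (B t p.2)|) (fun n => ?_) (i1.add i2.abs) (fun n => ?_) ?_
    · exact ((((hζ n).c0.pow 2).measurable).comp measurable_snd).aestronglyMeasurable.mul
        (i1.add (i2.const_mul (ε n))).aestronglyMeasurable
    · refine Eventually.of_forall fun p => ?_
      rw [Real.norm_eq_abs, abs_mul, abs_of_nonneg (sq_nonneg _)]
      refine (mul_le_of_le_one_left (abs_nonneg _) ((hζ n).sq_le _)).trans ?_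
      refine (abs_add_le _ _).trans ?_
      rw [abs_abs, abs_mul, abs_of_pos (hε n)]
      exact add_le_add le_rfl (mul_le_of_le_one_left (abs_nonneg _) (hε1 n))
    · refine Eventually.of_forall fun p => ?_
      have h1 : Tendsto (fun n => |A t (p.2 + p.1) - B t p.2|
          + ε n * (th0 q (A t (p.2 + p.1)) + th0 q (B t p.2))) atTop
          (nhds (|A t (p.2 + p.1) - B t p.2| + 0 * (th0 q (A t (p.2 + p.1)) + th0 q (B t p.2)))) :=
        tendsto_const_nhds.add (hε0.mul_const _)
      rw [zero_mul, add_zero] at h1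
      refine h1.congr' ?_
      filter_upwards [eventually_ge_atTop ⌈|p.2|⌉₊] with n hn
      rw [hζ1 n p.2 ?_, one_pow, one_mul]
      have g1 : |p.2| ≤ n := (Nat.le_ceil _).trans (by exact_mod_cast hn)
      have g2 : 1 / ε n ^ 2 = ((n:ℝ) + 1) ^ 2 := by simp [hεd]
      rw [g2]; nlinarith [(Nat.cast_nonneg n : (0:ℝ) ≤ n)]
  have hrate : Tendsto (fun n => (errC q μ Λ m1 M (2 * (1 / ε n ^ 2)) (c / (1 / ε n ^ 2)) (ε n) + Γ +
      (1 + ε n * thB q) * (∫ x, |e x|)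
        + ε n * (σ - 1) * (thB q * (4 * μ * (c / (1 / ε n ^ 2)) ^ 2 * M + 2 * Λ * M))) * (t - s)) atTop
      (nhds ((Γ + ∫ x, |e x|) * (t - s))) := by
    have hcont : Continuous (fun ε : ℝ => (8 * μ * (c * ε ^ 2) ^ 2 * M * (1 + ε * thB q) + 4 * Λ * M * (c * ε ^ 2) * m1 + 4 * ε * thB q * Λ * M +
    4 * (1 + ε * thB q) * (M * (4 * c ^ 2 * ε ^ 2 + c ^ 2 * ε ^ 4 * M) +
      M ^ 2 * (4 * c ^ 2 * ε + c ^ 2 * ε ^ 3 * M) * (1 + ε * thB q) / (2 * μ)) + Γ + (1 + ε * thB q) * (∫ x, |e x|)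
        + ε * (σ - 1) * (thB q * (4 * μ * (c * ε ^ 2) ^ 2 * M + 2 * Λ * M))) * (t - s)) := by fun_prop
    have := (hcont.tendsto 0).comp hε0
    simp only [Function.comp_def] at this
    convert this using 1
    · ext n
      rw [errC_eq (hε n).ne' hμ.ne']
      have : c / (1 / ε n ^ 2) = c * ε n ^ 2 := by field_simp
      rw [this]
    · congr 1; simp
  refine le_of_tendsto_of_tendsto ((hlim t).sub (hlim s)) hrate (Eventually.of_forall fun n => ?_)
  obtain ⟨ξ, ξ1, ξ2, hξ, hξ1⟩ := hcut (2 * (1 / ε n ^ 2) + r) (by have := hε n; positivity)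
  exact pair_cc hq1 hq hμ hΛ hσ hk (hζ n) hξ hr hξ1 hA hB hM0 (hε n) hπ
    (fun t ht => hΓ _ _ _ _ _ (hζ n) t ht) hs ht hst

end lim

/-- classical curves on `[0, ∞)` -/
structure Curve (q μ Λ : ℝ) (k e : ℝ → ℝ) (w wt w1 w2 : ℝ → ℝ → ℝ) : Prop where
  int : ∀ t, 0 ≤ t → Integrable (w t)
  l1 : ∀ t0, 0 ≤ t0 → Tendsto (fun t => ∫ x, |w t x - w t0 x|) (nhdsWithin t0 (Set.Ici 0)) (nhds 0)
  d2 : ∀ t, 0 < t → D2 (w t) (w1 t) (w2 t)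
  dt : ∀ t, 0 < t → ∀ x, HasDerivAt (fun s => w s x) (wt t x) t
  cwt : ∀ x, ContinuousOn (fun t => wt t x) (Set.Ioi 0)
  eq : ∀ t, 0 < t → ∀ x, wt t x = Lop q μ Λ k (w t) (w1 t) (w2 t) x + e x
  ei : Integrable e

section curve
variable {q μ Λ σ : ℝ} {k e : ℝ → ℝ} {m1 M a b : ℝ} {w wt w1 w2 A At A1 A2 B Bt B1 B2 : ℝ → ℝ → ℝ}

lemma Curve.mwt (h : Curve q μ Λ k e w wt w1 w2) {t : ℝ} (ht : 0 < t) : Measurable (wt t) := by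
  have hε0 : Tendsto (fun n : ℕ => 1 / ((n : ℝ) + 1)) atTop (nhdsWithin 0 {0}ᶜ) :=
    tendsto_nhdsWithin_iff.2 ⟨tendsto_one_div_add_atTop_nhds_zero_nat, Eventually.of_forall fun n => by
      simp only [Set.mem_compl_iff, Set.mem_singleton_iff]; positivity⟩
  refine measurable_of_tendsto_metrizable (f := fun n : ℕ => fun x =>
    (1 / ((n : ℝ) + 1))⁻¹ • (w (t + 1 / ((n : ℝ) + 1)) x - w t x)) (fun n => ?_) ?_
  · have h1 := (h.d2 (t + 1 / ((n : ℝ) + 1)) (by positivity)).c0.measurable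
    have h2 := (h.d2 t ht).c0.measurable
    exact (h1.sub h2).const_smul (1 / ((n : ℝ) + 1))⁻¹
  · rw [tendsto_pi_nhds]
    intro x
    exact (h.dt t ht x).tendsto_slope_zero.comp hε0

/-- time clamping -/
def cl (a b t : ℝ) : ℝ := max a (min b t)

lemma cl_cont : Continuous (cl a b) := by unfold cl; fun_prop
lemma cl_mem (hab : a ≤ b) (t : ℝ) : cl a b t ∈ Set.Icc a b :=
  ⟨le_max_left _ _, max_le hab (min_le_left _ _)⟩
lemma cl_eq {t : ℝ} (ht : t ∈ Set.Icc a b) : cl a b t = t := by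
  unfold cl; rw [min_eq_right ht.2, max_eq_right ht.1]

lemma Curve.l1_cl (h : Curve q μ Λ k e w wt w1 w2) (ha : 0 < a) (hab : a ≤ b) (t0 : ℝ) :
    Tendsto (fun t => ∫ x, |w (cl a b t) x - w (cl a b t0) x|) (nhds t0) (nhds 0) := by
  refine (h.l1 (cl a b t0) (ha.le.trans (cl_mem hab t0).1)).comp (tendsto_nhdsWithin_iff.2
    ⟨cl_cont.tendsto t0, Eventually.of_forall fun t => ?_⟩)
  exact ha.le.trans (cl_mem hab t).1

lemma Curve.toCC (h : Curve q μ Λ k e w wt w1 w2) (ha : 0 < a) (hab : a ≤ b) :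
    ∃ M0, ∀ M, M0 ≤ M → CC q μ Λ k e (fun t => w (cl a b t)) (fun t => wt (cl a b t))
      (fun t => w1 (cl a b t)) (fun t => w2 (cl a b t)) a b M := by
  have hp : ∀ t, 0 < cl a b t := fun t => ha.trans_le (cl_mem hab t).1
  have hi : ∀ t, Integrable (w (cl a b t)) := fun t => h.int _ (hp t).le
  have hcn : Continuous (fun t => ∫ x, |w (cl a b t) x|) := by
    refine cont_of_l1 (g := fun t0 t => ∫ x, |w (cl a b t) x - w (cl a b t0) x|) (fun t => (hi t).abs)
      (fun t0 t => ?_) (h.l1_cl ha hab)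
    exact integral_mono (((hi t).abs.sub (hi t0).abs).abs) ((hi t).sub (hi t0)).abs
      fun x => abs_abs_sub_abs_le_abs_sub _ _
  obtain ⟨M0, hM0⟩ := (isCompact_Icc (a := a) (b := b)).exists_bound_of_continuousOn hcn.continuousOn
  refine ⟨M0, fun M hM => ⟨fun x => ?_, fun x => ?_, fun t => h.mwt (hp t), fun x t ht => ?_, hi, fun t => ?_,
    h.l1_cl ha hab, fun t => h.d2 _ (hp t), fun t x => h.eq _ (hp t) x, h.ei⟩⟩
  · have : ContinuousOn (fun t => w t x) (Set.Ioi 0) := fun t ht =>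
      (h.dt t ht x).continuousAt.continuousWithinAt
    exact this.comp_continuous cl_cont hp
  · exact (h.cwt x).comp_continuous cl_cont hp
  · have h1 := h.dt t (ha.trans ht.1) x
    have h2 : (fun s => w (cl a b s) x) =ᶠ[nhds t] fun s => w s x := by
      filter_upwards [Ioo_mem_nhds ht.1 ht.2] with s hs
      rw [cl_eq ⟨hs.1.le, hs.2.le⟩]
    have h3 := h1.congr_of_eventuallyEq h2
    simp only [cl_eq (a := a) (b := b) (t := t) ⟨ht.1.le, ht.2.le⟩]
    exact h3
  · have := hM0 (cl a b t) (cl_mem hab t)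
    rw [cl_eq (cl_mem hab t)] at this
    exact (le_abs_self _).trans (this.trans hM)

variable {π : Measure ℝ} [IsProbabilityMeasure π] {r : ℝ}

lemma Curve.pair_pos (hq1 : 1 < q) (hq : q < 2) (hμ : 0 < μ) (hΛ : 0 < Λ) (hσ : 1 ≤ σ) (hk : Ker k m1)
    (hr : 0 ≤ r)
    (hA : Curve q (σ * μ) (σ * Λ) k (fun _ => 0) A At A1 A2)
    (hB : Curve q μ Λ k e B Bt B1 B2)
    (hπ : ∀ᵐ h ∂π, |h| ≤ r) {Γ : ℝ}
    (hΓ : ∀ (ζ ζ1 ζ2 : ℝ → ℝ) (ℓ D : ℝ), Cut ζ ζ1 ζ2 ℓ D → ∀ t, 0 < t →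
      ∫ p : ℝ × ℝ, ζ p.2 ^ 2 * (sg (A t (p.2 + p.1) - B t p.2) *
      ((σ - 1) * Gop μ Λ k (A t) (A2 t) (p.2 + p.1))) ∂(π.prod volume) ≤ Γ)
    {s t : ℝ} (hs : 0 < s) (hst : s ≤ t) :
    (∫ p : ℝ × ℝ, |A t (p.2 + p.1) - B t p.2| ∂(π.prod volume))
    - (∫ p : ℝ × ℝ, |A s (p.2 + p.1) - B s p.2| ∂(π.prod volume)) ≤
    (Γ + ∫ x, |e x|) * (t - s) := by
  obtain ⟨Ma, hMa⟩ := hA.toCC hs hst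
  obtain ⟨Mb, hMb⟩ := hB.toCC hs hst
  set M := max 1 (max Ma Mb)
  have h := pair_lim (π := π) (r := r) hq1 hq hμ hΛ hσ hk hr (hMa M ((le_max_left _ _).trans (le_max_right _ _)))
    (hMb M ((le_max_right _ _).trans (le_max_right _ _))) (lt_of_lt_of_le one_pos (le_max_left _ _)) hπ
    (Γ := Γ) (fun ζ ζ1 ζ2 ℓ D hζ τ _ => hΓ ζ ζ1 ζ2 ℓ D hζ _ (hs.trans_le (cl_mem hst τ).1))
    (s := s) (t := t) ⟨le_rfl, hst⟩ ⟨hst, le_rfl⟩ hst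
  simp only [cl_eq (a := s) (b := t) (t := t) ⟨hst, le_rfl⟩, cl_eq (a := s) (b := t) (t := s) ⟨le_rfl, hst⟩] at h
  exact h

lemma Curve.pair (hq1 : 1 < q) (hq : q < 2) (hμ : 0 < μ) (hΛ : 0 < Λ) (hσ : 1 ≤ σ) (hk : Ker k m1)
    (hr : 0 ≤ r)
    (hA : Curve q (σ * μ) (σ * Λ) k (fun _ => 0) A At A1 A2)
    (hB : Curve q μ Λ k e B Bt B1 B2)
    (hπ : ∀ᵐ h ∂π, |h| ≤ r) {Γ : ℝ}
    (hΓ : ∀ (ζ ζ1 ζ2 : ℝ → ℝ) (ℓ D : ℝ), Cut ζ ζ1 ζ2 ℓ D → ∀ t, 0 < t →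
      ∫ p : ℝ × ℝ, ζ p.2 ^ 2 * (sg (A t (p.2 + p.1) - B t p.2) *
      ((σ - 1) * Gop μ Λ k (A t) (A2 t) (p.2 + p.1))) ∂(π.prod volume) ≤ Γ)
    {t : ℝ} (ht : 0 < t) :
    (∫ p : ℝ × ℝ, |A t (p.2 + p.1) - B t p.2| ∂(π.prod volume)) ≤
    (∫ p : ℝ × ℝ, |A 0 (p.2 + p.1) - B 0 p.2| ∂(π.prod volume)) + (Γ + ∫ x, |e x|) * t := by
  have iT : ∀ {g : ℝ → ℝ}, Integrable g → Integrable (fun p : ℝ × ℝ => g (p.2 + p.1)) (π.prod volume) :=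
    fun hg => mp_int shear_mp hg
  have iS : ∀ {g : ℝ → ℝ}, Integrable g → Integrable (fun p : ℝ × ℝ => g p.2) (π.prod volume) :=
    fun hg => mp_int snd_mp hg
  have iy : ∀ s, 0 ≤ s → Integrable (fun p : ℝ × ℝ => |A s (p.2 + p.1) - B s p.2|) (π.prod volume) :=
    fun s hs => ((iT (hA.int s hs)).sub (iS (hB.int s hs))).abs
  have h0 : ∀ s ∈ Set.Ioc 0 t, (∫ p : ℝ × ℝ, |A t (p.2 + p.1) - B t p.2| ∂(π.prod volume)) -
      (∫ p : ℝ × ℝ, |A 0 (p.2 + p.1) - B 0 p.2| ∂(π.prod volume)) ≤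
      (Γ + ∫ x, |e x|) * (t - s) + ((∫ x, |A s x - A 0 x|) + ∫ x, |B s x - B 0 x|) := by
    intro s hs
    have h1 := Curve.pair_pos hq1 hq hμ hΛ hσ hk hr hA hB hπ hΓ hs.1 hs.2
    have j1 := ((hA.int s hs.1.le).sub (hA.int 0 le_rfl)).abs
    have j2 := ((hB.int s hs.1.le).sub (hB.int 0 le_rfl)).abs
    have h2 : (∫ p : ℝ × ℝ, |A s (p.2 + p.1) - B s p.2| ∂(π.prod volume)) ≤
        (∫ p : ℝ × ℝ, |A 0 (p.2 + p.1) - B 0 p.2| ∂(π.prod volume)) +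
        ((∫ x, |A s x - A 0 x|) + ∫ x, |B s x - B 0 x|) := by
      have e1 := mp_eq (shear_mp (π := π)) j1
      have e2 := mp_eq (snd_mp (π := π)) j2
      have u1 := iT j1
      have u2 := iS j2
      simp only [Pi.sub_apply] at e1 e2 u1 u2
      have u12 : Integrable (fun p : ℝ × ℝ => |A s (p.2 + p.1) - A 0 (p.2 + p.1)| + |B s p.2 - B 0 p.2|)
        (π.prod volume) := u1.add u2
      rw [← e1, ← e2, ← integral_add u1 u2, ← integral_add (iy 0 le_rfl) u12]
      refine integral_mono (iy s hs.1.le) ((iy 0 le_rfl).add u12) fun p => ?_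
      simp only [Pi.add_apply]
      have := abs_add_le (A 0 (p.2 + p.1) - B 0 p.2) ((A s (p.2 + p.1) - A 0 (p.2 + p.1)) - (B s p.2 - B 0 p.2))
      have h3 := abs_sub (A s (p.2 + p.1) - A 0 (p.2 + p.1)) (B s p.2 - B 0 p.2)
      rw [show A 0 (p.2 + p.1) - B 0 p.2 + ((A s (p.2 + p.1) - A 0 (p.2 + p.1)) - (B s p.2 - B 0 p.2)) =
        A s (p.2 + p.1) - B s p.2 by ring] at this
      linarith
    linarith
  have hmono : nhdsWithin (0:ℝ) (Set.Ioi 0) ≤ nhdsWithin 0 (Set.Ici 0) :=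
    nhdsWithin_mono _ Set.Ioi_subset_Ici_self
  have l1 := (hA.l1 0 le_rfl).mono_left hmono
  have l2 := (hB.l1 0 le_rfl).mono_left hmono
  have l3 : Tendsto (fun s : ℝ => (Γ + ∫ x, |e x|) * (t - s)) (nhdsWithin 0 (Set.Ioi 0))
      (nhds ((Γ + ∫ x, |e x|) * (t - 0))) :=
    ((by fun_prop : Continuous (fun s : ℝ => (Γ + ∫ x, |e x|) * (t - s))).tendsto 0).mono_left nhdsWithin_le_nhds
  have l4 := l3.add (l1.add l2)
  have := ge_of_tendsto l4 (by
    filter_upwards [Ioc_mem_nhdsGT ht] with s hs using h0 s hs)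
  simp only [sub_zero, add_zero] at this
  linarith

/-- equal coefficients, single translation -/
lemma Curve.contr (hq1 : 1 < q) (hq : q < 2) (hμ : 0 < μ) (hΛ : 0 < Λ) (hk : Ker k m1)
    (hA : Curve q μ Λ k (fun _ => 0) A At A1 A2) (hB : Curve q μ Λ k e B Bt B1 B2) (h : ℝ)
    {t : ℝ} (ht : 0 < t) :
    (∫ x, |A t (x + h) - B t x|) ≤ (∫ x, |A 0 (x + h) - B 0 x|) + (∫ x, |e x|) * t := by
  have hA' : Curve q (1 * μ) (1 * Λ) k (fun _ => 0) A At A1 A2 := by rwa [one_mul, one_mul]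
  have := Curve.pair (π := Measure.dirac h) (r := |h|) hq1 hq hμ hΛ le_rfl hk (abs_nonneg h) hA' hB
    (by rw [ae_dirac_eq]; exact (le_refl |h| : |h| ≤ |h|)) (Γ := 0) (fun ζ ζ1 ζ2 ℓ D _ t _ => by simp) ht
  have key : ∀ s, 0 ≤ s → ∫ p : ℝ × ℝ, |A s (p.2 + p.1) - B s p.2| ∂((Measure.dirac h).prod volume) =
      ∫ x, |A s (x + h) - B s x| := by
    intro s hs
    rw [integral_prod]
    · simp
    · exact ((mp_int (shear_mp (π := Measure.dirac h)) (hA.int s hs)).sub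
        (mp_int (snd_mp (π := Measure.dirac h)) (hB.int s hs))).abs
  rw [key t ht.le, key 0 le_rfl, zero_add] at this
  exact this

end curve

/-- first difference bound in L1 -/
lemma diff_l1 {g g1 : ℝ → ℝ} (hd : ∀ x, HasDerivAt g (g1 x) x) (hc : Continuous g1) (hg : Integrable g)
    (hg1 : Integrable g1) (y : ℝ) : ∫ x, |g (x + y) - g x| ≤ |y| * ∫ x, |g1 x| := by
  have hgc : Continuous g := continuous_iff_continuousAt.2 fun x => (hd x).continuousAt
  have hpt : ∀ x, ‖g (x + y) - g x‖ₑ ≤ ∫⁻ s in Set.Ioc (0:ℝ) 1, ‖y * g1 (x + s * y)‖ₑ := by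
    intro x
    have h1 : ∫ s in (0:ℝ)..1, y * g1 (x + s * y) = g (x + y) - g x := by
      have := intervalIntegral.integral_eq_sub_of_hasDerivAt (a := 0) (b := 1) (f := fun s => g (x + s * y))
        (f' := fun s => y * g1 (x + s * y)) (fun s _ => by
          have h2 : HasDerivAt (fun s : ℝ => x + s * y) y s := by
            simpa using ((hasDerivAt_id s).mul_const y).const_add x
          exact ((hd (x + s * y)).comp s h2).congr_deriv (by ring))
        (Continuous.intervalIntegrable (by fun_prop) _ _)
      simpa using this
    rw [← h1, intervalIntegral.integral_of_le zero_le_one]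
    exact enorm_integral_le_lintegral_enorm _
  have hL : ∫⁻ x, ‖g (x + y) - g x‖ₑ ≤ ‖y‖ₑ * ∫⁻ x, ‖g1 x‖ₑ := by
    calc _ ≤ ∫⁻ x, ∫⁻ s in Set.Ioc (0:ℝ) 1, ‖y * g1 (x + s * y)‖ₑ := lintegral_mono hpt
      _ = ∫⁻ s in Set.Ioc (0:ℝ) 1, ∫⁻ x, ‖y * g1 (x + s * y)‖ₑ := by
        refine lintegral_lintegral_swap ?_
        exact (Continuous.aemeasurable (by fun_prop))
      _ = ∫⁻ s in Set.Ioc (0:ℝ) 1, ‖y‖ₑ * ∫⁻ x, ‖g1 x‖ₑ := by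
        congr 1; funext s
        simp_rw [enorm_mul]
        rw [lintegral_const_mul _ (Continuous.measurable (by fun_prop))]
        rw [lintegral_add_right_eq_self (fun x => ‖g1 x‖ₑ) (s * y)]
      _ = _ := by simp
  have e1 : ∫ x, |g (x + y) - g x| = (∫⁻ x, ‖g (x + y) - g x‖ₑ).toReal :=
    integral_norm_eq_lintegral_enorm (f := fun x => g (x + y) - g x)
      (Continuous.aestronglyMeasurable (by fun_prop))
  have e2 : ∫ x, |g1 x| = (∫⁻ x, ‖g1 x‖ₑ).toReal := integral_norm_eq_lintegral_enorm hg1.aestronglyMeasurable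
  rw [e1, e2]
  have hfin : ∫⁻ x, ‖g1 x‖ₑ ≠ ⊤ := hg1.2.ne
  calc _ ≤ (‖y‖ₑ * ∫⁻ x, ‖g1 x‖ₑ).toReal := ENNReal.toReal_mono (ENNReal.mul_ne_top (by simp) hfin) hL
    _ = _ := by rw [ENNReal.toReal_mul]; simp

lemma diff2_l1 {g g1 g2 : ℝ → ℝ} (h : D2 g g1 g2) (hg : Integrable g)
    (hg1 : Integrable g1) (hg2 : Integrable g2) (y : ℝ) :
    ∫ x, |g (x + y) + g (x - y) - 2 * g x| ≤ y ^ 2 * ∫ x, |g2 x| := by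
  have h1 := diff_l1 (g := fun x => g (x + y) - g x) (g1 := fun x => g1 (x + y) - g1 x)
    (fun x => ((h.shift y).d1 x).sub (h.d1 x)) (((h.shift y).c1).sub h.c1)
    ((hg.comp_add_right y).sub hg) ((hg1.comp_add_right y).sub hg1) (-y)
  have h2 := diff_l1 h.d2 h.c2 hg1 hg2 y
  have h3 : ∫ x, |g (x + y) + g (x - y) - 2 * g x| = ∫ x, |g (x + -y + y) - g (x + -y) - (g (x + y) - g x)| := by
    congr 1; funext x
    rw [← abs_neg]; congr 1
    rw [neg_add_cancel_right, ← sub_eq_add_neg]; ring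
  rw [h3]
  refine h1.trans ?_
  rw [abs_neg]
  calc _ ≤ |y| * (|y| * ∫ x, |g2 x|) := mul_le_mul_of_nonneg_left h2 (abs_nonneg y)
    _ = _ := by rw [← mul_assoc, abs_mul_abs_self]; ring

/-- probability measure with a density -/
noncomputable def dens (k : ℝ → ℝ) : Measure ℝ := volume.withDensity (fun y => ((k y).toNNReal : ℝ≥0∞))

section dens
variable {k g a : ℝ → ℝ} {m1 : ℝ}

lemma dens_prob (hn : ∀ x, 0 ≤ k x) (hi : Integrable k) (hm : ∫ x, k x = 1) : IsProbabilityMeasure (dens k) := by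
  constructor
  rw [dens, withDensity_apply _ MeasurableSet.univ, Measure.restrict_univ]
  have := ofReal_integral_eq_lintegral_ofReal hi (Eventually.of_forall hn)
  rw [hm] at this
  simpa [ENNReal.ofReal] using this.symm

lemma dens_eq (hn : ∀ x, 0 ≤ k x) (hi : Integrable k) (f : ℝ → ℝ) : ∫ y, f y ∂(dens k) = ∫ y, k y * f y := by
  rw [dens, integral_withDensity_eq_integral_smul₀ hi.aestronglyMeasurable.aemeasurable.real_toNNReal]
  congr 1; funext y
  rw [NNReal.smul_def, Real.coe_toNNReal _ (hn y), smul_eq_mul]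

lemma dens_int (hn : ∀ x, 0 ≤ k x) (hi : Integrable k) (f : ℝ → ℝ) :
    Integrable f (dens k) ↔ Integrable (fun y => k y * f y) := by
  rw [dens, integrable_withDensity_iff_integrable_smul₀ hi.aestronglyMeasurable.aemeasurable.real_toNNReal]
  refine integrable_congr (Eventually.of_forall fun y => ?_)
  simp only
  rw [NNReal.smul_def, Real.coe_toNNReal _ (hn y), smul_eq_mul]

lemma dens_ae {r : ℝ} (hi : Integrable k) (h : ∀ x, r < |x| → k x = 0) : ∀ᵐ y ∂(dens k), |y| ≤ r := by
  rw [dens, ae_withDensity_iff' (by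
    exact (hi.aestronglyMeasurable.aemeasurable.real_toNNReal).coe_nnreal_ennreal)]
  refine Eventually.of_forall fun y hy => ?_
  by_contra hc
  exact hy (by simp [h y (not_le.1 hc)])

lemma cv_plus (he : ∀ x, k (-x) = k x) (x : ℝ) : cv k g x = ∫ y, k y * g (x + y) := by
  unfold cv
  rw [← integral_add_left_eq_self (fun y => k (x - y) * g y) x]
  congr 1; funext y
  rw [show x - (x + y) = -y by ring, he]

lemma cv_minus (x : ℝ) : cv k g x = ∫ y, k y * g (x - y) := by
  unfold cv
  rw [← integral_sub_left_eq_self (fun y => k (x - y) * g y) volume x]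
  congr 1; funext y
  rw [show x - (x - y) = y by ring]

lemma shear_sub_mp {π : Measure ℝ} [IsProbabilityMeasure π] :
    MeasurePreserving (fun p : ℝ × ℝ => p.2 - p.1) (π.prod volume) volume := by
  have h1 : MeasurePreserving (fun p : ℝ × ℝ => (p.1, p.2 - p.1)) (π.prod volume) (π.prod volume) :=
    (MeasurePreserving.id π).skew_product (g := fun h x => x - h)
      (show Measurable (fun p : ℝ × ℝ => p.2 - p.1) from by fun_prop)
      (Eventually.of_forall fun h => (measurePreserving_sub_right (volume : Measure ℝ) h).map_eq)
  exact measurePreserving_snd.comp h1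

lemma shear2_mp {π : Measure ℝ} [SFinite π] :
    MeasurePreserving (fun p : ℝ × ℝ => (p.1, p.2 + p.1)) (π.prod volume) (π.prod volume) :=
    (MeasurePreserving.id π).skew_product (g := fun h x => x + h)
      (show Measurable (fun p : ℝ × ℝ => p.2 + p.1) from by fun_prop)
      (Eventually.of_forall fun h => (measurePreserving_add_right (volume : Measure ℝ) h).map_eq)

lemma cv_diff2 (hk : Ker k m1) (he : ∀ x, k (-x) = k x) (hk2 : Integrable (fun y => k y * y ^ 2))
    {g1 g2 : ℝ → ℝ} (h : D2 g g1 g2) (hg : Integrable g)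
    (hg1 : Integrable g1) (hg2 : Integrable g2) :
    ∫ x, |cv k g x - g x| ≤ (∫ y, k y * y ^ 2) * ∫ x, |g2 x| := by
  haveI := dens_prob hk.nn hk.int hk.mass
  have i1 := mp_int (shear_mp (π := dens k)) hg
  have i2 := mp_int (shear_sub_mp (π := dens k)) hg
  have i3 := (mp_int (snd_mp (π := dens k)) hg).const_mul 2
  have iS : Integrable (fun p : ℝ × ℝ => g (p.2 + p.1) + g (p.2 - p.1) - 2 * g p.2) ((dens k).prod volume) :=
    (i1.add i2).sub i3
  have hpt : ∀ᵐ x, |cv k g x - g x| ≤ ∫ y, |g (x + y) + g (x - y) - 2 * g x| ∂(dens k) := by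
    filter_upwards [i1.prod_left_ae, i2.prod_left_ae] with x h1 h2
    have e1 : ∫ y, (g (x + y) + g (x - y) - 2 * g x) ∂(dens k) = 2 * (cv k g x - g x) := by
      rw [integral_sub (by exact h1.add h2) (integrable_const _), integral_add h1 h2,
        dens_eq hk.nn hk.int, dens_eq hk.nn hk.int, ← cv_plus he, ← cv_minus]
      simp; ring
    have e2 : |2 * (cv k g x - g x)| ≤ ∫ y, |g (x + y) + g (x - y) - 2 * g x| ∂(dens k) := by
      rw [← e1]; exact norm_integral_le_integral_norm (μ := dens k) (fun y => g (x + y) + g (x - y) - 2 * g x)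
    rw [abs_mul, abs_two] at e2
    linarith [abs_nonneg (cv k g x - g x)]
  calc _ ≤ ∫ x, ∫ y, |g (x + y) + g (x - y) - 2 * g x| ∂(dens k) :=
        integral_mono_ae ((cv_int hk.int hg).sub hg).abs iS.abs.integral_prod_right hpt
    _ = ∫ y, (∫ x, |g (x + y) + g (x - y) - 2 * g x|) ∂(dens k) :=
        (integral_integral_swap (f := fun y x => |g (x + y) + g (x - y) - 2 * g x|) iS.abs).symm
    _ ≤ ∫ y, (y ^ 2 * (∫ x, |g2 x|)) ∂(dens k) := by
        refine integral_mono iS.abs.integral_prod_left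
          (((dens_int hk.nn hk.int _).2 hk2).mul_const _) fun y => ?_
        exact diff2_l1 h hg hg1 hg2 y
    _ = _ := by rw [integral_mul_const, dens_eq hk.nn hk.int]

end dens

/-- mollifiers supported in `[-δ, δ]` -/
structure Mol (ρ ρ1 ρ2 : ℝ → ℝ) (δ : ℝ) : Prop extends D2 ρ ρ1 ρ2 where
  z0 : ∀ x, δ < |x| → ρ x = 0
  z1 : ∀ x, δ < |x| → ρ1 x = 0
  z2 : ∀ x, δ < |x| → ρ2 x = 0
  nn : ∀ x, 0 ≤ ρ x
  mass : ∫ x, ρ x = 1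

section mol
variable {k a b : ℝ → ℝ} {m1 δ : ℝ} {ρ ρ1 ρ2 : ℝ → ℝ}

lemma Mol.i0 (h : Mol ρ ρ1 ρ2 δ) : Integrable ρ := cs_int h.c0 h.z0
lemma Mol.i1 (h : Mol ρ ρ1 ρ2 δ) : Integrable ρ1 := cs_int h.c1 h.z1
lemma Mol.i2 (h : Mol ρ ρ1 ρ2 δ) : Integrable ρ2 := cs_int h.c2 h.z2
lemma Mol.prob (h : Mol ρ ρ1 ρ2 δ) : IsProbabilityMeasure (dens ρ) := dens_prob h.nn h.i0 h.mass

lemma bd_of_cs {g : ℝ → ℝ} {r : ℝ} (hg : Continuous g) (hz : ∀ x, r < |x| → g x = 0) :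
    ∃ c, 0 ≤ c ∧ ∀ x, |g x| ≤ c := by
  obtain ⟨c, hc⟩ := (isCompact_Icc (a := -r) (b := r)).exists_bound_of_continuousOn hg.continuousOn
  refine ⟨max c 0, le_max_right _ _, fun x => ?_⟩
  by_cases hx : r < |x|
  · rw [hz x hx]; simp
  · exact (hc x (abs_le.1 (not_lt.1 hx))).trans (le_max_left _ _)

lemma sg_mul_le (α β c : ℝ) : sg (α - c) * (β - α) ≤ |β - c| - |α - c| := by
  have h1 : sg (α - c) * (β - α) = sg (α - c) * (β - c) - sg (α - c) * (α - c) := by ring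
  rw [h1, sg_mul_self]
  have h2 : sg (α - c) * (β - c) ≤ |sg (α - c) * (β - c)| := le_abs_self _
  rw [abs_mul] at h2
  have h3 := mul_le_of_le_one_left (abs_nonneg (β - c)) (abs_sg_le (α - c))
  linarith

lemma nl_gamma (hk : Ker k m1) (he : ∀ x, k (-x) = k x) (hm : Mol ρ ρ1 ρ2 δ) (ha : Integrable a)
    (hac : Continuous a) (c : ℝ) :
    Integrable (fun h => |cv k ρ h - ρ h| * (|a h| + |c|)) ∧
    ∫ h, ρ h * (sg (a h - c) * (cv k a h - a h)) ≤ ∫ h, |cv k ρ h - ρ h| * (|a h| + |c|) := by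
  haveI := dens_prob hk.nn hk.int hk.mass
  obtain ⟨c0, hc0, hb⟩ := bd_of_cs hm.c0 hm.z0
  have hρm : Measurable ρ := hm.c0.measurable
  have ham : Measurable a := hac.measurable
  have hsm := measurable_sg
  -- integrability of the two product functions
  have j1 : Integrable (fun p : ℝ × ℝ => c0 * |a (p.2 - p.1)| + |ρ p.2| * |c|) ((dens k).prod volume) :=
    ((mp_int (shear_sub_mp (π := dens k)) ha.abs).const_mul c0).add
      ((mp_int (snd_mp (π := dens k)) hm.i0.abs).mul_const _)
  have I1 : Integrable (fun p : ℝ × ℝ => ρ p.2 * |a (p.2 - p.1) - c|) ((dens k).prod volume) := by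
    refine j1.mono' (Measurable.aestronglyMeasurable (by fun_prop)) (Eventually.of_forall fun p => ?_)
    rw [norm_mul, Real.norm_eq_abs, Real.norm_eq_abs, abs_abs]
    calc |ρ p.2| * |a (p.2 - p.1) - c| ≤ |ρ p.2| * (|a (p.2 - p.1)| + |c|) :=
          mul_le_mul_of_nonneg_left (abs_sub _ _) (abs_nonneg _)
      _ = |ρ p.2| * |a (p.2 - p.1)| + |ρ p.2| * |c| := by ring
      _ ≤ _ := add_le_add (mul_le_mul_of_nonneg_right (hb _) (abs_nonneg _)) le_rfl
  have J2 : Integrable (fun h => ρ h * |a h - c|) :=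
    cs_int (ℓ := δ) (hm.c0.mul (hac.sub continuous_const).abs) fun x hx => by simp [hm.z0 x hx]
  have I2 : Integrable (fun p : ℝ × ℝ => ρ p.2 * |a p.2 - c|) ((dens k).prod volume) :=
    mp_int (snd_mp (π := dens k)) J2
  -- shifted version
  have I1s : Integrable (fun p : ℝ × ℝ => ρ (p.2 + p.1) * |a p.2 - c|) ((dens k).prod volume) := by
    have := (shear2_mp (π := dens k)).integrable_comp_of_integrable I1
    refine this.congr (Eventually.of_forall fun p => ?_)
    simp [Function.comp]
  have E1 : ∫ p : ℝ × ℝ, ρ p.2 * |a (p.2 - p.1) - c| ∂((dens k).prod volume) =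
      ∫ p : ℝ × ℝ, ρ (p.2 + p.1) * |a p.2 - c| ∂((dens k).prod volume) := by
    have h2 : AEStronglyMeasurable (fun p : ℝ × ℝ => ρ p.2 * |a (p.2 - p.1) - c|)
        (Measure.map (fun p : ℝ × ℝ => (p.1, p.2 + p.1)) ((dens k).prod volume)) := by
      rw [shear2_mp.map_eq]; exact I1.aestronglyMeasurable
    have h1 := integral_map (shear2_mp (π := dens k)).measurable.aemeasurable h2
    rw [shear2_mp.map_eq] at h1
    simpa using h1
  have cvρ : ∀ x, |cv k ρ x| ≤ c0 := fun x => by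
    rw [cv_plus he, ← dens_eq hk.nn hk.int]
    refine (norm_integral_le_of_norm_le_const (μ := dens k) (f := fun y => ρ (x + y)) (C := c0) (Eventually.of_forall fun y => hb _)).trans ?_
    simp
  have I3 : Integrable (fun h => |cv k ρ h - ρ h| * (|a h| + |c|)) := by
    have hd : Integrable (fun h => |cv k ρ h - ρ h|) := ((cv_int hk.int hm.i0).sub hm.i0).abs
    have : Integrable (fun h => |cv k ρ h - ρ h| * |a h|) :=
      ha.abs.bdd_mul (c := c0 + c0) hd.aestronglyMeasurable (Eventually.of_forall fun x => by
        rw [Real.norm_eq_abs, abs_abs]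
        exact (abs_sub _ _).trans (add_le_add (cvρ x) (hb x)))
    refine (this.add (hd.mul_const |c|)).congr (Eventually.of_forall fun h => ?_)
    simp only [Pi.add_apply]; ring
  have ID := I1.sub I2
  have I4 : Integrable (fun h => ρ h * (sg (a h - c) * (cv k a h - a h))) := by
    refine ((cv_int hk.int ha).sub ha).bdd_mul (c := c0)
      (f := fun h => ρ h * sg (a h - c)) (Measurable.aestronglyMeasurable (by fun_prop))
      (Eventually.of_forall fun h => ?_) |>.congr (Eventually.of_forall fun h => ?_)
    · rw [Real.norm_eq_abs, abs_mul]
      exact (mul_le_of_le_one_right (abs_nonneg _) (abs_sg_le _)).trans (hb h)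
    · simp only [Pi.sub_apply]; ring
  have hpt : ∀ᵐ h, ρ h * (sg (a h - c) * (cv k a h - a h)) ≤
      ∫ y, (ρ h * |a (h - y) - c| - ρ h * |a h - c|) ∂(dens k) := by
    filter_upwards [(mp_int (shear_sub_mp (π := dens k)) ha).prod_left_ae, ID.prod_left_ae] with h h1 h2
    have e1 : cv k a h - a h = ∫ y, (a (h - y) - a h) ∂(dens k) := by
      rw [integral_sub h1 (integrable_const _), dens_eq hk.nn hk.int, ← cv_minus]
      simp
    rw [e1, ← integral_const_mul, ← integral_const_mul]
    refine integral_mono (((h1.sub (integrable_const _)).const_mul _).const_mul _) h2 fun y => ?_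
    calc _ ≤ ρ h * (|a (h - y) - c| - |a h - c|) :=
          mul_le_mul_of_nonneg_left (sg_mul_le _ _ _) (hm.nn h)
      _ = _ := by ring
  refine ⟨I3, ?_⟩
  calc _ ≤ ∫ h, ∫ y, (ρ h * |a (h - y) - c| - ρ h * |a h - c|) ∂(dens k) :=
        integral_mono_ae I4 ID.integral_prod_right hpt
    _ = ∫ p : ℝ × ℝ, (ρ p.2 * |a (p.2 - p.1) - c| - ρ p.2 * |a p.2 - c|) ∂((dens k).prod volume) :=
        (integral_prod_symm _ ID).symm
    _ = ∫ p : ℝ × ℝ, (ρ (p.2 + p.1) * |a p.2 - c| - ρ p.2 * |a p.2 - c|) ∂((dens k).prod volume) := by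
        rw [integral_sub I1 I2, E1, integral_sub I1s I2]
    _ = ∫ h, ∫ y, (ρ (h + y) * |a h - c| - ρ h * |a h - c|) ∂(dens k) :=
        integral_prod_symm _ (I1s.sub I2)
    _ ≤ _ := by
        refine integral_mono_ae (I1s.sub I2).integral_prod_right I3 (Eventually.of_forall fun h => ?_)
        simp only [Pi.sub_apply]
        have i5 : Integrable (fun y => ρ (h + y)) (dens k) :=
          Integrable.of_bound (C := c0) (Measurable.aestronglyMeasurable (by fun_prop))
            (Eventually.of_forall fun y => hb _)
        have e1 : ∫ y, (ρ (h + y) * |a h - c| - ρ h * |a h - c|) ∂(dens k) =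
            (cv k ρ h - ρ h) * |a h - c| := by
          rw [integral_sub (i5.mul_const _) (integrable_const _), integral_mul_const, dens_eq hk.nn hk.int,
            ← cv_plus he]
          simp; ring
        rw [e1]
        exact mul_le_mul (le_abs_self _) (abs_sub _ _) (abs_nonneg _) (abs_nonneg _)

lemma gam_inner (hk : Ker k m1) (he : ∀ x, k (-x) = k x) (hm : Mol ρ ρ1 ρ2 δ) {a1 a2 : ℝ → ℝ}
    (hA : D2 a a1 a2) (ha : Integrable a) {μ Λ : ℝ} (hμ : 0 ≤ μ) (hΛ : 0 ≤ Λ) (x c : ℝ) :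
    ∫ h, ρ h * (sg (a (x + h) - c) * Gop μ Λ k a a2 (x + h)) ≤
    ∫ h, (μ * |ρ2 h| + Λ * |cv k ρ h - ρ h|) * (|a (x + h)| + |c|) := by
  simp only [add_comm x]
  have hS := hA.shift x
  have haS := ha.comp_add_right x
  obtain ⟨I3, h3⟩ := nl_gamma hk he hm haS hS.c0 c
  simp only [cv_shift] at h3
  have hw : D2 (fun h => a (h + x) - c) (fun h => a1 (h + x)) (fun h => a2 (h + x)) :=
    ⟨fun h => (hS.d1 h).sub_const c, hS.d2, hS.c2⟩
  have h4 := kato_abs hm.toD2 hm.z0 hm.z1 hm.z2 hm.nn hw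
  have hρm : Measurable ρ := hm.c0.measurable
  have ham : Measurable a := hA.c0.measurable
  have hsm := measurable_sg
  obtain ⟨c0, hc0, hb⟩ := bd_of_cs hm.c0 hm.z0
  have c2 := hm.c2; have ca := hA.c0; have ca2 := hA.c2; have cρ := hm.c0
  have J1 : Integrable (fun h => ρ h * (sg (a (h + x) - c) * a2 (h + x))) := by
    have : Integrable (fun h => ρ h * a2 (h + x)) :=
      cs_int (ℓ := δ) (by fun_prop) fun h hh => by simp [hm.z0 h hh]
    refine (this.bdd_mul (c := 1) (f := fun h => sg (a (h + x) - c))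
      (Measurable.aestronglyMeasurable (by fun_prop)) (Eventually.of_forall fun h => abs_sg_le _)).congr
      (Eventually.of_forall fun h => ?_)
    simp only; ring
  have J2 : Integrable (fun h => ρ h * (sg (a (h + x) - c) * (cv k a (h + x) - a (h + x)))) := by
    refine (((cv_int hk.int ha).comp_add_right x).sub haS).bdd_mul (c := c0)
      (f := fun h => ρ h * sg (a (h + x) - c)) (Measurable.aestronglyMeasurable (by fun_prop))
      (Eventually.of_forall fun h => ?_) |>.congr (Eventually.of_forall fun h => ?_)
    · rw [Real.norm_eq_abs, abs_mul]
      exact (mul_le_of_le_one_right (abs_nonneg _) (abs_sg_le _)).trans (hb h)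
    · simp only [Pi.sub_apply]; ring
  have K1 : Integrable (fun h => ρ2 h * |a (h + x) - c|) :=
    cs_int (ℓ := δ) (by fun_prop) fun h hh => by simp [hm.z2 h hh]
  have K2 : Integrable (fun h => |ρ2 h| * (|a (h + x)| + |c|)) :=
    cs_int (ℓ := δ) (by fun_prop) fun h hh => by simp [hm.z2 h hh]
  have h5 : ∫ h, ρ2 h * |a (h + x) - c| ≤ ∫ h, |ρ2 h| * (|a (h + x)| + |c|) :=
    integral_mono K1 K2 fun h => mul_le_mul (le_abs_self _) (abs_sub _ _) (abs_nonneg _) (abs_nonneg _)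
  have L : ∫ h, ρ h * (sg (a (h + x) - c) * Gop μ Λ k a a2 (h + x)) =
      μ * (∫ h, ρ h * (sg (a (h + x) - c) * a2 (h + x))) +
      Λ * ∫ h, ρ h * (sg (a (h + x) - c) * (cv k a (h + x) - a (h + x))) := by
    rw [← integral_const_mul, ← integral_const_mul, ← integral_add (J1.const_mul _) (J2.const_mul _)]
    congr 1; funext h; unfold Gop; ring
  have R : ∫ h, (μ * |ρ2 h| + Λ * |cv k ρ h - ρ h|) * (|a (h + x)| + |c|) =
      μ * (∫ h, |ρ2 h| * (|a (h + x)| + |c|)) + Λ * ∫ h, |cv k ρ h - ρ h| * (|a (h + x)| + |c|) := by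
    rw [← integral_const_mul, ← integral_const_mul, ← integral_add (K2.const_mul _) (I3.const_mul _)]
    congr 1; funext h; ring
  rw [L, R]
  exact add_le_add (mul_le_mul_of_nonneg_left (h4.trans h5) hμ) (mul_le_mul_of_nonneg_left h3 hΛ)

lemma gam (hk : Ker k m1) (he : ∀ x, k (-x) = k x) (hk2 : Integrable (fun y => k y * y ^ 2))
    (hm : Mol ρ ρ1 ρ2 δ) (hδ : 0 ≤ δ) {a1 a2 : ℝ → ℝ}
    (hA : D2 a a1 a2) (ha : Integrable a) (hb : Integrable b) (hbm : Measurable b)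
    {μ Λ σ : ℝ} (hμ : 0 ≤ μ) (hΛ : 0 ≤ Λ) (hσ : 1 ≤ σ) {ζ ζ1 ζ2 : ℝ → ℝ} {ℓ D : ℝ} (hζ : Cut ζ ζ1 ζ2 ℓ D) :
    ∫ p : ℝ × ℝ, ζ p.2 ^ 2 * (sg (a (p.2 + p.1) - b p.2) *
      ((σ - 1) * Gop μ Λ k a a2 (p.2 + p.1))) ∂((dens ρ).prod volume) ≤
    (σ - 1) * ((μ + Λ * ∫ y, k y * y ^ 2) * (∫ x, |ρ2 x|) * ((∫ x, |a x|) + ∫ x, |b x|)) := by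
  haveI := hm.prob
  obtain ⟨cc, hcc, hcut⟩ := cut_exists
  have hℓ := hζ.hℓ
  obtain ⟨ξ, ξ1, ξ2, hξ, hξ1⟩ := hcut (ℓ + δ) (by positivity)
  have ham : Measurable a := hA.c0.measurable
  have hsm := measurable_sg
  have iF := pr_shift (π := dens ρ) (r := δ) (g := fun x => (σ - 1) * Gop μ Λ k a a2 x)
    (s := fun p => sg (a (p.2 + p.1) - b p.2)) (c := 1) (dens_ae hm.i0 hm.z0) hζ hξ1
    (((Gop_int (μ := μ) (Λ := Λ) hk.int hξ hA ha).const_mul (σ - 1)).congr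
      (Eventually.of_forall fun x => by simp only; ring)) (by fun_prop) (fun p => abs_sg_le _)
  set Θ : ℝ → ℝ := fun h => μ * |ρ2 h| + Λ * |cv k ρ h - ρ h| with hΘ
  have hd : Integrable (fun h => |cv k ρ h - ρ h|) := ((cv_int hk.int hm.i0).sub hm.i0).abs
  have iΘ : Integrable Θ := (hm.i2.abs.const_mul μ).add (hd.const_mul Λ)
  have T1 : Integrable (fun p : ℝ × ℝ => Θ p.1 * |a (p.2 + p.1)|) (volume.prod volume) :=
    (shear2_mp (π := volume)).integrable_comp_of_integrable (iΘ.mul_prod ha.abs)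
  have T2 : Integrable (fun p : ℝ × ℝ => Θ p.1 * |b p.2|) (volume.prod volume) := iΘ.mul_prod hb.abs
  have T : Integrable (fun p : ℝ × ℝ => Θ p.1 * (|a (p.2 + p.1)| + |b p.2|)) (volume.prod volume) :=
    (T1.add T2).congr (Eventually.of_forall fun p => by simp only [Pi.add_apply]; ring)
  have Θn : ∀ h, 0 ≤ Θ h := fun h => by simp only [hΘ]; positivity
  rw [integral_prod_symm _ iF]
  calc _ ≤ ∫ x, (σ - 1) * ∫ h, Θ h * (|a (x + h)| + |b x|) := by
        refine integral_mono iF.integral_prod_right (T.integral_prod_right.const_mul _) fun x => ?_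
        simp only
        rw [dens_eq hm.nn hm.i0]
        have e1 : ∫ h, ρ h * (ζ x ^ 2 * (sg (a (x + h) - b x) * ((σ - 1) * Gop μ Λ k a a2 (x + h)))) =
            (σ - 1) * (ζ x ^ 2 * ∫ h, ρ h * (sg (a (x + h) - b x) * Gop μ Λ k a a2 (x + h))) := by
          rw [← integral_const_mul, ← integral_const_mul]
          congr 1; funext h; ring
        rw [e1]
        refine mul_le_mul_of_nonneg_left ?_ (by linarith)
        have h1 := gam_inner hk he hm hA ha hμ hΛ x (b x)
        have h2 : 0 ≤ ∫ h, Θ h * (|a (x + h)| + |b x|) :=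
          integral_nonneg fun h => mul_nonneg (Θn h) (by positivity)
        exact (mul_le_mul_of_nonneg_left h1 (sq_nonneg _)).trans (mul_le_of_le_one_left h2 (hζ.sq_le x))
    _ = (σ - 1) * ((∫ h, Θ h) * ((∫ x, |a x|) + ∫ x, |b x|)) := by
        rw [integral_const_mul]
        congr 1
        have := integral_integral_swap (f := fun h x => Θ h * (|a (x + h)| + |b x|)) T
        rw [← this, ← integral_mul_const]
        congr 1; funext h
        rw [integral_const_mul, integral_add (ha.abs.comp_add_right h) hb.abs,
          integral_add_right_eq_self (fun x => |a x|) h]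
    _ ≤ _ := by
        refine mul_le_mul_of_nonneg_left ?_ (by linarith)
        refine mul_le_mul_of_nonneg_right ?_
          (add_nonneg (integral_nonneg fun _ => abs_nonneg _) (integral_nonneg fun _ => abs_nonneg _))
        have h6 := cv_diff2 hk he hk2 hm.toD2 hm.i0 hm.i1 hm.i2
        have : ∫ h, Θ h = μ * (∫ h, |ρ2 h|) + Λ * ∫ h, |cv k ρ h - ρ h| := by
          rw [← integral_const_mul, ← integral_const_mul, ← integral_add (hm.i2.abs.const_mul _) (hd.const_mul _)]
        rw [this]
        nlinarith [mul_le_mul_of_nonneg_left h6 hΛ]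

end mol

lemma mol_exists : ∃ c > 0, ∀ δ > 0, ∃ ρ ρ1 ρ2 : ℝ → ℝ, Mol ρ ρ1 ρ2 δ ∧ (∀ x, ρ x ≤ c / δ) ∧
    ∫ x, |ρ1 x| ≤ c / δ ∧ ∫ x, |ρ2 x| ≤ c / δ ^ 2 := by
  obtain ⟨η, η1, η2, c, hc, h1⟩ := bump_exists
  have iη : Integrable η := cs_int hc.c0 hc.z0
  have I0 : 0 < ∫ x, η x := by
    have h2 : ∫ x in Set.Icc (-1:ℝ) 1, (1:ℝ) ≤ ∫ x, η x := by
      calc ∫ x in Set.Icc (-1:ℝ) 1, (1:ℝ) = ∫ x in Set.Icc (-1:ℝ) 1, η x :=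
            setIntegral_congr_fun measurableSet_Icc fun x hx => (h1 x (abs_le.2 hx)).symm
        _ ≤ _ := setIntegral_le_integral iη (Eventually.of_forall hc.nn)
    have h3 : ∫ x in Set.Icc (-1:ℝ) 1, (1:ℝ) = 2 := by
      simp; norm_num
    linarith
  set I := ∫ x, η x with hI
  set N1 := ∫ x, |η1 x|
  set N2 := ∫ x, |η2 x|
  have n1 : 0 ≤ N1 := integral_nonneg fun _ => abs_nonneg _
  have n2 : 0 ≤ N2 := integral_nonneg fun _ => abs_nonneg _
  refine ⟨(2 + 2 * N1 + 4 * N2) / I, by positivity, fun δ hδ => ?_⟩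
  have hs : 0 < 2 / δ := by positivity
  have hz : ∀ x, δ < |x| → 2 < |2 / δ * x| := fun x hx => by
    rw [abs_mul, abs_of_pos hs, div_mul_eq_mul_div, lt_div_iff₀ hδ]; linarith
  refine ⟨_, _, _, ⟨(hc.toD2.scale (2 / δ)).cmul (2 / δ / I), ?_, ?_, ?_, ?_, ?_⟩, ?_, ?_, ?_⟩
  · intro x hx; rw [hc.z0 _ (hz x hx)]; simp
  · intro x hx; rw [hc.z1 _ (hz x hx)]; simp
  · intro x hx; rw [hc.z2 _ (hz x hx)]; simp
  · intro x; have := hc.nn (2 / δ * x); positivity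
  · rw [integral_const_mul, Measure.integral_comp_mul_left (fun x => η x), abs_of_pos (inv_pos.2 hs), smul_eq_mul, ← hI]
    field_simp
  · intro x
    calc 2 / δ / I * η (2 / δ * x) ≤ 2 / δ / I * 1 :=
          mul_le_mul_of_nonneg_left (hc.le1 _) (by positivity)
      _ = 2 / I / δ := by field_simp
      _ ≤ _ := by gcongr; linarith
  · have : ∀ x, |2 / δ / I * (2 / δ * η1 (2 / δ * x))| = 2 / δ / I * (2 / δ) * |η1 (2 / δ * x)| := fun x => by
      rw [← mul_assoc, abs_mul, abs_of_pos (by positivity)]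
    simp only [this]
    rw [integral_const_mul, Measure.integral_comp_mul_left (fun x => |η1 x|), abs_of_pos (inv_pos.2 hs), smul_eq_mul]
    calc _ = (2 * N1) / I / δ := by field_simp; rfl
      _ ≤ _ := by gcongr; linarith
  · have : ∀ x, |2 / δ / I * ((2 / δ) ^ 2 * η2 (2 / δ * x))| = 2 / δ / I * (2 / δ) ^ 2 * |η2 (2 / δ * x)| := fun x => by
      rw [← mul_assoc, abs_mul, abs_of_pos (by positivity)]
    simp only [this]
    rw [integral_const_mul, Measure.integral_comp_mul_left (fun x => |η2 x|), abs_of_pos (inv_pos.2 hs), smul_eq_mul]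
    calc _ = (4 * N2) / I / δ ^ 2 := by
          have : (∫ x, |η2 x|) = N2 := rfl
          rw [this]; field_simp; norm_num; ring
      _ ≤ _ := by gcongr; linarith

section conv
variable {r r1 g ρ ρ1 ρ2 : ℝ → ℝ} {δ : ℝ}

lemma cv_l1 (hr : Integrable r) (hg : Integrable g) : ∫ x, |cv r g x| ≤ (∫ x, |r x|) * ∫ x, |g x| := by
  have hp := cv_prod hr.abs hg.abs
  calc ∫ x, |cv r g x| ≤ ∫ x, cv (fun y => |r y|) (fun y => |g y|) x := by
        refine integral_mono (cv_int hr hg).abs (cv_int hr.abs hg.abs) fun x => ?_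
        unfold cv
        rw [← Real.norm_eq_abs]
        refine (norm_integral_le_integral_norm _).trans (le_of_eq ?_)
        congr 1; funext y; rw [norm_mul]; rfl
    _ = ∫ y, ∫ x, |r (x - y)| * |g y| := integral_integral_swap hp
    _ = _ := by
        rw [← integral_const_mul]
        congr 1; funext y
        rw [integral_mul_const, integral_sub_right_eq_self (fun x => |r x|) y]

lemma cv_bd {c : ℝ} (hb : ∀ x, |r x| ≤ c) (hg : Integrable g) (x : ℝ) : |cv r g x| ≤ c * ∫ y, |g y| := by
  unfold cv
  rw [← integral_const_mul, ← Real.norm_eq_abs]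
  refine norm_integral_le_of_norm_le (hg.abs.const_mul c) (Eventually.of_forall fun y => ?_)
  rw [norm_mul]
  exact mul_le_mul_of_nonneg_right (hb _) (abs_nonneg _)

lemma cv_meas (hc : Continuous r) (hg : Integrable g) (x : ℝ) :
    AEStronglyMeasurable (fun y => r (x - y) * g y) :=
  (Continuous.aestronglyMeasurable (by fun_prop)).mul hg.aestronglyMeasurable

lemma cv_cont {c : ℝ} (hc : Continuous r) (hb : ∀ x, |r x| ≤ c) (hg : Integrable g) : Continuous (cv r g) := by
  refine continuous_of_dominated (bound := fun y => c * |g y|) (fun x => cv_meas hc hg x) (fun x => ?_)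
    (hg.abs.const_mul c) (Eventually.of_forall fun y => by fun_prop)
  refine Eventually.of_forall fun y => ?_
  rw [norm_mul]
  exact mul_le_mul_of_nonneg_right (hb _) (abs_nonneg _)

lemma cv_deriv {c c' : ℝ} (hd : ∀ x, HasDerivAt r (r1 x) x) (hc1 : Continuous r1) (hb : ∀ x, |r x| ≤ c)
    (hb1 : ∀ x, |r1 x| ≤ c') (hg : Integrable g) (x : ℝ) : HasDerivAt (cv r g) (cv r1 g x) x := by
  have hc : Continuous r := continuous_iff_continuousAt.2 fun x => (hd x).continuousAt
  refine (hasDerivAt_integral_of_dominated_loc_of_deriv_le (bound := fun y => c' * |g y|)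
    (F := fun x y => r (x - y) * g y) (F' := fun x y => r1 (x - y) * g y) (s := Set.univ) univ_mem
    (Eventually.of_forall fun x => cv_meas hc hg x) ?_ (cv_meas hc1 hg x) ?_ (hg.abs.const_mul c') ?_).2
  · refine (hg.abs.const_mul c).mono' (cv_meas hc hg x) (Eventually.of_forall fun y => ?_)
    rw [norm_mul]
    exact mul_le_mul_of_nonneg_right (hb _) (abs_nonneg _)
  · refine Eventually.of_forall fun y z _ => ?_
    rw [norm_mul]
    exact mul_le_mul_of_nonneg_right (hb1 _) (abs_nonneg _)
  · refine Eventually.of_forall fun y z _ => ?_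
    have h1 : HasDerivAt (fun z : ℝ => z - y) 1 z := (hasDerivAt_id z).sub_const y
    have := ((hd (z - y)).comp z h1).mul_const (g y)
    rw [mul_one] at this
    exact this

lemma Mol.cvD2 (h : Mol ρ ρ1 ρ2 δ) (hg : Integrable g) : D2 (cv ρ g) (cv ρ1 g) (cv ρ2 g) := by
  obtain ⟨c0, _, h0⟩ := bd_of_cs h.c0 h.z0
  obtain ⟨c1, _, h1⟩ := bd_of_cs h.c1 h.z1
  obtain ⟨c2, _, h2⟩ := bd_of_cs h.c2 h.z2
  exact ⟨cv_deriv h.d1 h.c1 h0 h1 hg, cv_deriv h.d2 h.c2 h1 h2 hg, cv_cont h.c2 h2 hg⟩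

lemma avg_le {π : Measure ℝ} [IsProbabilityMeasure π] {F : ℝ × ℝ → ℝ} {W : ℝ}
    (hF : Integrable F (π.prod volume)) (h : ∀ᵐ y ∂π, ∫ x, F (y, x) ≤ W) : ∫ p, F p ∂(π.prod volume) ≤ W := by
  rw [integral_prod _ hF]
  calc _ ≤ ∫ _, W ∂π := integral_mono_ae hF.integral_prod_left (integrable_const _) h
    _ = W := by simp

lemma Mol.cv_close (h : Mol ρ ρ1 ρ2 δ) (hg : Integrable g) {W : ℝ}
    (hW : ∀ y, |y| ≤ δ → ∫ x, |g (x + y) - g x| ≤ W) : ∫ x, |cv ρ g x - g x| ≤ W := by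
  haveI := h.prob
  have hF : Integrable (fun p : ℝ × ℝ => g (p.2 - p.1) - g p.2) ((dens ρ).prod volume) :=
    (mp_int shear_sub_mp hg).sub (mp_int snd_mp hg)
  calc ∫ x, |cv ρ g x - g x| ≤ ∫ x, ∫ y, |g (x - y) - g x| ∂(dens ρ) := by
        refine integral_mono_ae ((cv_int h.i0 hg).sub hg).abs hF.abs.integral_prod_right ?_
        filter_upwards [(mp_int (shear_sub_mp (π := dens ρ)) hg).prod_left_ae] with x hx
        have e1 : cv ρ g x - g x = ∫ y, (g (x - y) - g x) ∂(dens ρ) := by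
          rw [integral_sub hx (integrable_const _), dens_eq h.nn h.i0, ← cv_minus]
          simp
        rw [e1, ← Real.norm_eq_abs]
        exact norm_integral_le_integral_norm _
    _ = ∫ p : ℝ × ℝ, |g (p.2 - p.1) - g p.2| ∂((dens ρ).prod volume) := (integral_prod_symm _ hF.abs).symm
    _ ≤ W := by
        refine avg_le hF.abs ?_
        filter_upwards [dens_ae h.i0 h.z0] with y hy
        have := hW (-y) (by rwa [abs_neg])
        simpa [sub_eq_add_neg] using this

end conv

section app
variable {q μ Λ σ δ : ℝ} {k ρ ρ1 ρ2 : ℝ → ℝ} {m1 : ℝ} {u ut u1 u2 : ℝ → ℝ → ℝ}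

lemma Curve.zero : Curve q μ Λ k (fun _ => 0) (fun _ _ => 0) (fun _ _ => 0) (fun _ _ => 0) (fun _ _ => 0) := by
  refine ⟨fun _ _ => integrable_zero _ _ _, fun t0 _ => ?_, fun t _ => ?_, fun t _ x => hasDerivAt_const _ _,
    fun x => continuousOn_const, fun t _ x => ?_, integrable_zero _ _ _⟩
  · simpa using tendsto_const_nhds
  · exact ⟨fun x => hasDerivAt_const _ _, fun x => hasDerivAt_const _ _, continuous_const⟩
  · simp [Lop, cv]

lemma Curve.mass (hq1 : 1 < q) (hq : q < 2) (hμ : 0 < μ) (hΛ : 0 < Λ) (hk : Ker k m1)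
    (hu : Curve q μ Λ k (fun _ => 0) u ut u1 u2) {t : ℝ} (ht : 0 ≤ t) : ∫ x, |u t x| ≤ ∫ x, |u 0 x| := by
  rcases ht.eq_or_lt with h | h
  · rw [← h]
  · have := Curve.contr hq1 hq hμ hΛ hk hu Curve.zero 0 h
    simpa using this

lemma Curve.transl (hq1 : 1 < q) (hq : q < 2) (hμ : 0 < μ) (hΛ : 0 < Λ) (hk : Ker k m1)
    (hu : Curve q μ Λ k (fun _ => 0) u ut u1 u2) {t : ℝ} (ht : 0 < t) (h : ℝ) :
    ∫ x, |u t (x + h) - u t x| ≤ ∫ x, |u 0 (x + h) - u 0 x| := by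
  have := Curve.contr hq1 hq hμ hΛ hk hu hu h ht
  simpa using this

lemma Curve.tshift (hu : Curve q μ Λ k (fun _ => 0) u ut u1 u2) {a : ℝ} (ha : 0 ≤ a) :
    Curve q μ Λ k (fun _ => 0) (fun s => u (s + a)) (fun s => ut (s + a)) (fun s => u1 (s + a))
      (fun s => u2 (s + a)) := by
  refine ⟨fun t ht => hu.int _ (by linarith), fun t0 ht0 => ?_, fun t ht => hu.d2 _ (by linarith),
    fun t ht x => ?_, fun x => ?_, fun t ht x => hu.eq _ (by linarith) x, integrable_zero _ _ _⟩
  · refine (hu.l1 (t0 + a) (by linarith)).comp (tendsto_nhdsWithin_iff.2 ⟨?_, ?_⟩)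
    · exact ((continuous_id.add continuous_const).tendsto t0).mono_left nhdsWithin_le_nhds
    · filter_upwards [self_mem_nhdsWithin] with s hs
      have : (0:ℝ) ≤ s := hs
      simp only [Set.mem_Ici]; linarith
  · have h1 : HasDerivAt (fun s : ℝ => s + a) 1 t := (hasDerivAt_id t).add_const a
    have := (hu.dt (t + a) (by linarith) x).comp t h1
    rw [mul_one] at this
    exact this
  · refine (hu.cwt x).comp (continuousOn_id.add continuousOn_const) fun s hs => ?_
    have : (0:ℝ) < s := hs
    simp only [Set.mem_Ioi, id]; linarith

lemma Curve.time0 (hq1 : 1 < q) (hq : q < 2) (hμ : 0 < μ) (hΛ : 0 < Λ) (hk : Ker k m1)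
    (hu : Curve q μ Λ k (fun _ => 0) u ut u1 u2) {t κ : ℝ} (ht : 0 < t) (hκ : 0 ≤ κ) :
    ∫ x, |u (t + κ) x - u t x| ≤ ∫ x, |u κ x - u 0 x| := by
  have := Curve.contr hq1 hq hμ hΛ hk (hu.tshift hκ) hu 0 ht
  simpa using this

lemma Curve.stat {ψ ψ1 ψ2 : ℝ → ℝ} (h : D2 ψ ψ1 ψ2) (hi : Integrable ψ) (hL : Integrable (Lop q μ Λ k ψ ψ1 ψ2)) :
    Curve q μ Λ k (fun x => - Lop q μ Λ k ψ ψ1 ψ2 x) (fun _ => ψ) (fun _ _ => 0) (fun _ => ψ1) (fun _ => ψ2) := by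
  refine ⟨fun _ _ => hi, fun t0 _ => ?_, fun t _ => h, fun t _ x => hasDerivAt_const _ _,
    fun x => continuousOn_const, fun t _ x => by ring, hL.neg⟩
  simpa using tendsto_const_nhds

lemma Lop_l1 (hq1 : 1 < q) (hμ : 0 < μ) (hΛ : 0 < Λ) (hk : Ker k m1) (he : ∀ x, k (-x) = k x)
    (hk2 : Integrable (fun y => k y * y ^ 2))
    {ψ ψ1 ψ2 : ℝ → ℝ} (h : D2 ψ ψ1 ψ2) (hi : Integrable ψ) (hi1 : Integrable ψ1) (hi2 : Integrable ψ2)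
    {M : ℝ} (hM : ∀ x, |ψ x| ≤ M) :
    Integrable (Lop q μ Λ k ψ ψ1 ψ2) ∧
    ∫ x, |Lop q μ Λ k ψ ψ1 ψ2 x| ≤ (μ + Λ * ∫ y, k y * y ^ 2) * (∫ x, |ψ2 x|) + M ^ (q - 1) * ∫ x, |ψ1 x| := by
  have M0 : 0 ≤ M := (abs_nonneg _).trans (hM 0)
  have hpM : ∀ x, |pw q (ψ x)| ≤ M ^ (q - 1) := fun x => by
    rw [abs_of_nonneg (pw_nonneg _ _)]
    exact Real.rpow_le_rpow (abs_nonneg _) (hM x) (by linarith)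
  have i1 : Integrable (fun x => pw q (ψ x) * ψ1 x) :=
    hi1.bdd_mul (c := M ^ (q - 1)) ((pw_cont hq1).comp h.c0).aestronglyMeasurable
      (Eventually.of_forall hpM)
  have id : Integrable (fun x => cv k ψ x - ψ x) := (cv_int hk.int hi).sub hi
  have ja : Integrable (fun x => μ * |ψ2 x|) := hi2.abs.const_mul μ
  have jb : Integrable (fun x => Λ * |cv k ψ x - ψ x|) := id.abs.const_mul Λ
  have jc : Integrable (fun x => μ * |ψ2 x| + Λ * |cv k ψ x - ψ x|) := ja.add jb
  have iL : Integrable (Lop q μ Λ k ψ ψ1 ψ2) := ((hi2.const_mul μ).add (id.const_mul Λ)).sub i1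
  refine ⟨iL, ?_⟩
  have h6 := cv_diff2 hk he hk2 h hi hi1 hi2
  calc ∫ x, |Lop q μ Λ k ψ ψ1 ψ2 x|
      ≤ ∫ x, (μ * |ψ2 x| + Λ * |cv k ψ x - ψ x| + M ^ (q - 1) * |ψ1 x|) := by
        refine integral_mono iL.abs (((hi2.abs.const_mul μ).add (id.abs.const_mul Λ)).add (hi1.abs.const_mul _))
          fun x => ?_
        simp only
        unfold Lop
        refine (abs_sub _ _).trans (add_le_add ((abs_add_le _ _).trans (le_of_eq ?_)) ?_)
        · rw [abs_mul, abs_mul, abs_of_pos hμ, abs_of_pos hΛ]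
        · rw [abs_mul]; exact mul_le_mul_of_nonneg_right (hpM x) (abs_nonneg _)
    _ = μ * (∫ x, |ψ2 x|) + Λ * (∫ x, |cv k ψ x - ψ x|) + M ^ (q - 1) * ∫ x, |ψ1 x| := by
        rw [integral_add jc (hi1.abs.const_mul _), integral_add ja jb, integral_const_mul, integral_const_mul,
          integral_const_mul]
    _ ≤ _ := by nlinarith [mul_le_mul_of_nonneg_left h6 hΛ.le]

lemma int_le2 {α : Type*} [MeasurableSpace α] {ν : Measure α} {f g h : α → ℝ} (hf : Integrable f ν)
    (hg : Integrable g ν) (hh : Integrable h ν) (hp : ∀ x, f x ≤ g x + h x) :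
    ∫ x, f x ∂ν ≤ (∫ x, g x ∂ν) + ∫ x, h x ∂ν := by
  rw [← integral_add hg hh]
  exact integral_mono hf (hg.add hh) hp

lemma tri3 {f g h : ℝ → ℝ} (hf : Integrable f) (hg : Integrable g) (hh : Integrable h) :
    ∫ x, |f x - h x| ≤ (∫ x, |f x - g x|) + ∫ x, |g x - h x| :=
  int_le2 (hf.sub hh).abs (hf.sub hg).abs (hg.sub hh).abs fun x => abs_sub_le _ _ _

lemma Curve.small (hq1 : 1 < q) (hq : q < 2) (hμ : 0 < μ) (hΛ : 0 < Λ) (hk : Ker k m1)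
    (he : ∀ x, k (-x) = k x) (hk2 : Integrable (fun y => k y * y ^ 2))
    (hu : Curve q μ Λ k (fun _ => 0) u ut u1 u2) (hm : Mol ρ ρ1 ρ2 δ) {c0 W κ : ℝ}
    (hc0 : ∀ x, ρ x ≤ c0) (hW : ∀ y, |y| ≤ δ → ∫ x, |u 0 (x + y) - u 0 x| ≤ W) (hκ : 0 < κ) :
    ∫ x, |u κ x - u 0 x| ≤ 2 * W + κ * ((μ + Λ * ∫ y, k y * y ^ 2) * ((∫ x, |ρ2 x|) * ∫ x, |u 0 x|) +
      (c0 * ∫ x, |u 0 x|) ^ (q - 1) * ((∫ x, |ρ1 x|) * ∫ x, |u 0 x|)) := by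
  have i0 := hu.int 0 le_rfl
  have hD := hm.cvD2 i0
  have iψ := cv_int hm.i0 i0
  have hρb : ∀ x, |ρ x| ≤ c0 := fun x => by rw [abs_of_nonneg (hm.nn x)]; exact hc0 x
  have c00 : 0 ≤ c0 := (abs_nonneg _).trans (hρb 0)
  have K0 : 0 ≤ ∫ x, |u 0 x| := integral_nonneg fun _ => abs_nonneg _
  obtain ⟨hL, hL1⟩ := Lop_l1 (M := c0 * ∫ x, |u 0 x|) hq1 hμ hΛ hk he hk2 hD iψ (cv_int hm.i1 i0) (cv_int hm.i2 i0)
    (cv_bd hρb i0)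
  have h1 := Curve.contr hq1 hq hμ hΛ hk hu (Curve.stat hD iψ hL) 0 hκ
  simp only [add_zero, abs_neg] at h1
  have h2 := hm.cv_close i0 hW
  have h3 := tri3 (hu.int κ hκ.le) iψ i0
  have h4 : ∫ x, |u 0 x - cv ρ (u 0) x| = ∫ x, |cv ρ (u 0) x - u 0 x| := by
    congr 1; funext x; exact abs_sub_comm _ _
  rw [h4] at h1
  have m2 : 0 ≤ ∫ y, k y * y ^ 2 := integral_nonneg fun y => mul_nonneg (hk.nn y) (sq_nonneg y)
  have h5 : ∫ x, |Lop q μ Λ k (cv ρ (u 0)) (cv ρ1 (u 0)) (cv ρ2 (u 0)) x| ≤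
      (μ + Λ * ∫ y, k y * y ^ 2) * ((∫ x, |ρ2 x|) * ∫ x, |u 0 x|) +
      (c0 * ∫ x, |u 0 x|) ^ (q - 1) * ((∫ x, |ρ1 x|) * ∫ x, |u 0 x|) := by
    refine hL1.trans (add_le_add (mul_le_mul_of_nonneg_left (cv_l1 hm.i2 i0) (by positivity))
      (mul_le_mul_of_nonneg_left (cv_l1 hm.i1 i0) (by positivity)))
  nlinarith [mul_le_mul_of_nonneg_right h5 hκ.le]

lemma Curve.scale (hq1 : 1 < q) (hσ : 0 < σ) (hu : Curve q μ Λ k (fun _ => 0) u ut u1 u2) :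
    Curve q (σ * μ) (σ * Λ) k (fun _ => 0) (fun s x => σ ^ (1 / (q - 1)) * u (σ * s) x)
      (fun s x => σ ^ (1 / (q - 1)) * (σ * ut (σ * s) x)) (fun s x => σ ^ (1 / (q - 1)) * u1 (σ * s) x)
      (fun s x => σ ^ (1 / (q - 1)) * u2 (σ * s) x) := by
  set S := σ ^ (1 / (q - 1)) with hS
  have S0 : 0 < S := Real.rpow_pos_of_pos hσ _
  refine ⟨fun t ht => (hu.int _ (by positivity)).const_mul S, fun t0 ht0 => ?_,
    fun t ht => (hu.d2 _ (by positivity)).cmul S,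
    fun t ht x => ?_, fun x => ?_, fun t ht x => ?_, integrable_zero _ _ _⟩
  · have h1 : Tendsto (fun t : ℝ => σ * t) (nhdsWithin t0 (Set.Ici 0)) (nhdsWithin (σ * t0) (Set.Ici 0)) := by
      refine tendsto_nhdsWithin_iff.2 ⟨?_, ?_⟩
      · exact ((continuous_const.mul continuous_id).tendsto t0).mono_left nhdsWithin_le_nhds
      · filter_upwards [self_mem_nhdsWithin] with s hs
        exact mul_nonneg hσ.le hs
    have h2 := ((hu.l1 (σ * t0) (by positivity)).comp h1).const_mul S
    rw [mul_zero] at h2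
    refine h2.congr fun t => ?_
    simp only [Function.comp]
    rw [← integral_const_mul]
    congr 1; funext x
    rw [← mul_sub, abs_mul, abs_of_pos S0]
  · have h1 : HasDerivAt (fun s : ℝ => σ * s) σ t := by simpa using (hasDerivAt_id t).const_mul σ
    have := ((hu.dt (σ * t) (by positivity) x).comp t h1).const_mul S
    rw [mul_comm σ]
    exact this
  · refine continuousOn_const.mul (continuousOn_const.mul ((hu.cwt x).comp
      (continuousOn_const.mul continuousOn_id) fun s hs => ?_))
    exact mul_pos hσ hs
  · have h1 := hu.eq (σ * t) (by positivity) x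
    have h2 : pw q (S * u (σ * t) x) = σ * pw q (u (σ * t) x) := by
      unfold pw
      rw [abs_mul, abs_of_pos S0, Real.mul_rpow S0.le (abs_nonneg _), hS, ← Real.rpow_mul hσ.le,
        one_div_mul_cancel (by linarith), Real.rpow_one]
    have h3 : cv k (fun x => S * u (σ * t) x) x = S * cv k (u (σ * t)) x := by
      unfold cv
      rw [← integral_const_mul]
      congr 1; funext y; ring
    rw [h1]
    unfold Lop
    simp only [h2, h3]
    ring

lemma Curve.large (hq1 : 1 < q) (hq : q < 2) (hμ : 0 < μ) (hΛ : 0 < Λ) (hk : Ker k m1)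
    (he : ∀ x, k (-x) = k x) (hk2 : Integrable (fun y => k y * y ^ 2))
    (hu : Curve q μ Λ k (fun _ => 0) u ut u1 u2) (hm : Mol ρ ρ1 ρ2 δ) (hδ : 0 ≤ δ) {W κ t S : ℝ}
    (hW : ∀ y, |y| ≤ δ → ∫ x, |u 0 (x + y) - u 0 x| ≤ W) (hκ : 0 < κ) (ht : 0 < t)
    (hS : S = (1 + κ / t) ^ (1 / (q - 1))) :
    ∫ x, |u (t + κ) x - u t x| ≤ 2 * W + 2 * (S - 1) * (∫ x, |u 0 x|) +
      κ * ((μ + Λ * ∫ y, k y * y ^ 2) * (∫ x, |ρ2 x|) * ((S + 1) * ∫ x, |u 0 x|)) := by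
  haveI := hm.prob
  set σ := 1 + κ / t with hσd
  have hσ : 1 ≤ σ := by rw [hσd]; have : 0 < κ / t := by positivity
                        linarith
  have hσ0 : 0 < σ := by linarith
  have hS1 : 1 ≤ S := by rw [hS]; exact Real.one_le_rpow hσ (div_nonneg zero_le_one (by linarith))
  have hsc := hu.scale hq1 hσ0
  rw [← hS] at hsc
  set K := ∫ x, |u 0 x| with hK
  have hmass : ∀ t, 0 ≤ t → ∫ x, |u t x| ≤ K := fun t ht => Curve.mass hq1 hq hμ hΛ hk hu ht
  have m2 : 0 ≤ ∫ y, k y * y ^ 2 := integral_nonneg fun y => mul_nonneg (hk.nn y) (sq_nonneg y)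
  have r2 : 0 ≤ ∫ x, |ρ2 x| := integral_nonneg fun _ => abs_nonneg _
  have hp := Curve.pair (π := dens ρ) (r := δ) (Γ := (σ - 1) * ((μ + Λ * ∫ y, k y * y ^ 2) * (∫ x, |ρ2 x|) * ((S + 1) * K)))
    hq1 hq hμ hΛ hσ hk hδ hsc hu (dens_ae hm.i0 hm.z0) (fun ζ ζ1 ζ2 ℓ D hζ s hs => by
      refine (gam (a := fun x => S * u (σ * s) x) (a1 := fun x => S * u1 (σ * s) x) hk he hk2 hm hδ (hsc.d2 s hs) (hsc.int s hs.le) (hu.int s hs.le)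
        (hu.d2 s hs).c0.measurable hμ.le hΛ.le hσ hζ).trans ?_
      refine mul_le_mul_of_nonneg_left (mul_le_mul_of_nonneg_left ?_ (by positivity)) (by linarith)
      have e1 : ∫ x, |S * u (σ * s) x| = S * ∫ x, |u (σ * s) x| := by
        rw [← integral_const_mul]
        congr 1; funext x; rw [abs_mul, abs_of_nonneg (by linarith : 0 ≤ S)]
      rw [e1]
      have h1 := hmass (σ * s) (by positivity)
      have h2 := hmass s hs.le
      nlinarith) ht
  have est : σ * t = t + κ := by rw [hσd]; field_simp
  simp only [est, mul_zero, abs_zero, integral_zero, add_zero] at hp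
  -- translation averages
  have tr : ∀ s, 0 ≤ s → ∫ p : ℝ × ℝ, |u s (p.2 + p.1) - u s p.2| ∂((dens ρ).prod volume) ≤ W := by
    intro s hs
    have hi := hu.int s hs
    refine avg_le (F := fun p => |u s (p.2 + p.1) - u s p.2|) ((mp_int shear_mp hi).sub (mp_int snd_mp hi)).abs ?_
    filter_upwards [dens_ae hm.i0 hm.z0] with y hy
    rcases hs.eq_or_lt with h | h
    · rw [← h]; exact hW y hy
    · exact (Curve.transl hq1 hq hμ hΛ hk hu h y).trans (hW y hy)
  have sc : ∀ s, 0 ≤ s → ∫ p : ℝ × ℝ, |(S - 1) * u s (p.2 + p.1)| ∂((dens ρ).prod volume) ≤ (S - 1) * K := by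
    intro s hs
    have hi := hu.int s hs
    rw [mp_eq (shear_mp (π := dens ρ)) (f := fun x => |(S - 1) * u s x|) (hi.const_mul _).abs]
    have : ∫ x, |(S - 1) * u s x| = (S - 1) * ∫ x, |u s x| := by
      rw [← integral_const_mul]
      congr 1; funext x; rw [abs_mul, abs_of_nonneg (by linarith : 0 ≤ S - 1)]
    rw [this]
    exact mul_le_mul_of_nonneg_left (hmass s hs) (by linarith)
  have I : ∀ s, 0 ≤ s → Integrable (fun p : ℝ × ℝ => u s (p.2 + p.1)) ((dens ρ).prod volume) :=
    fun s hs => mp_int shear_mp (hu.int s hs)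
  have I' : ∀ s, 0 ≤ s → Integrable (fun p : ℝ × ℝ => u s p.2) ((dens ρ).prod volume) :=
    fun s hs => mp_int snd_mp (hu.int s hs)
  have z : (0:ℝ) ≤ 0 := le_rfl
  have tk : 0 ≤ t + κ := by linarith
  have h0 : ∫ p : ℝ × ℝ, |S * u 0 (p.2 + p.1) - u 0 p.2| ∂((dens ρ).prod volume) ≤ (S - 1) * K + W := by
    refine le_trans ?_ (add_le_add (sc 0 z) (tr 0 z))
    refine int_le2 (((I 0 z).const_mul _).sub (I' 0 z)).abs ((I 0 z).const_mul _).abs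
      ((I 0 z).sub (I' 0 z)).abs fun p => ?_
    refine le_trans (le_of_eq ?_) (abs_add_le _ _)
    congr 1; ring
  have h1 : ∫ x, |u (t + κ) x - u t x| ≤ (S - 1) * K +
      (∫ p : ℝ × ℝ, |S * u (t + κ) (p.2 + p.1) - u t p.2| ∂((dens ρ).prod volume)) + W := by
    rw [← mp_eq (shear_mp (π := dens ρ)) (f := fun x => |u (t + κ) x - u t x|)
      ((hu.int _ tk).sub (hu.int t ht.le)).abs]
    refine le_trans ?_ (add_le_add (add_le_add (sc (t + κ) tk) le_rfl) (tr t ht.le))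
    have a1 : Integrable (fun p : ℝ × ℝ => |(S - 1) * u (t + κ) (p.2 + p.1)|) ((dens ρ).prod volume) :=
      ((I (t + κ) tk).const_mul (S - 1)).abs
    have a2 : Integrable (fun p : ℝ × ℝ => |S * u (t + κ) (p.2 + p.1) - u t p.2|) ((dens ρ).prod volume) :=
      (((I (t + κ) tk).const_mul S).sub (I' t ht.le)).abs
    have a3 : Integrable (fun p : ℝ × ℝ => |u t (p.2 + p.1) - u t p.2|) ((dens ρ).prod volume) :=
      ((I t ht.le).sub (I' t ht.le)).abs
    rw [← integral_add a1 a2]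
    refine int_le2 ((I (t + κ) tk).sub (I t ht.le)).abs (a1.add a2) a3 fun p => ?_
    set α := u (t + κ) (p.2 + p.1)
    set β := u t (p.2 + p.1)
    set γ := u t p.2
    have e : α - β = (-((S - 1) * α) + (S * α - γ)) + (-(β - γ)) := by ring
    rw [e]
    refine (abs_add_le _ _).trans (add_le_add ((abs_add_le _ _).trans ?_) ?_)
    · rw [abs_neg]
    · rw [abs_neg]
  have e3 : (σ - 1) * ((μ + Λ * ∫ y, k y * y ^ 2) * (∫ x, |ρ2 x|) * ((S + 1) * K)) * t =
      κ * ((μ + Λ * ∫ y, k y * y ^ 2) * (∫ x, |ρ2 x|) * ((S + 1) * K)) := by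
    have : (σ - 1) * t = κ := by linarith
    rw [← this]; ring
  rw [e3] at hp
  linarith

end app

section fin
variable {J φ ω : ℝ → ℝ} {q lam μ : ℝ} {u : ℝ → ℝ → ℝ}

lemma J2_int (hJint : Integrable J) (hJ2 : Integrable (fun x => (1 + |x| ^ 2) * J x)) :
    Integrable (fun y => J y * y ^ 2) := by
  refine (hJ2.sub hJint).congr (Eventually.of_forall fun x => ?_)
  simp only [Pi.sub_apply, sq_abs]; ring

lemma ker_of (hJpos : ∀ x, 0 ≤ J x) (hJint : Integrable J) (hJmass : ∫ x, J x = 1)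
    (hJ2 : Integrable (fun x => (1 + |x| ^ 2) * J x)) (hl : 0 < lam) :
    Ker (fun x => lam * J (lam * x)) (∫ x, |x| * (lam * J (lam * x))) := by
  have i1 : Integrable (fun x => |x| * J x) := by
    refine hJ2.mono' ((continuous_abs.aestronglyMeasurable).mul hJint.aestronglyMeasurable)
      (Eventually.of_forall fun x => ?_)
    rw [norm_mul, Real.norm_eq_abs, Real.norm_eq_abs, abs_abs, abs_of_nonneg (hJpos x)]
    refine mul_le_mul_of_nonneg_right ?_ (hJpos x)
    nlinarith [sq_nonneg (|x| - 1), abs_nonneg x]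
  refine ⟨fun x => mul_nonneg hl.le (hJpos _), (hJint.comp_mul_left' hl.ne').const_mul lam, ?_, ?_, le_rfl⟩
  · rw [integral_const_mul, Measure.integral_comp_mul_left (fun x => J x), abs_of_pos (inv_pos.2 hl), hJmass]
    simp [hl.ne']
  · refine (i1.comp_mul_left' hl.ne').congr (Eventually.of_forall fun x => ?_)
    simp only [abs_mul, abs_of_pos hl]; ring

lemma k2_of (hi : Integrable (fun y => J y * y ^ 2)) (hl : 0 < lam) :
    Integrable (fun y => lam * J (lam * y) * y ^ 2) ∧
    lam ^ q * (∫ y, lam * J (lam * y) * y ^ 2) = lam ^ (q - 2) * ∫ y, J y * y ^ 2 := by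
  have e : (fun y => lam * J (lam * y) * y ^ 2) = fun y => lam⁻¹ * (J (lam * y) * (lam * y) ^ 2) := by
    funext y; field_simp
  rw [e]
  refine ⟨(hi.comp_mul_left' hl.ne').const_mul _, ?_⟩
  rw [integral_const_mul, Measure.integral_comp_mul_left (fun y => J y * y ^ 2), abs_of_pos (inv_pos.2 hl),
    smul_eq_mul, Real.rpow_sub hl, Real.rpow_two]
  field_simp

lemma curve_of (hu : IsRescaledSol J q lam μ φ u) :
    Curve q μ (lam ^ q) (fun x => lam * J (lam * x)) (fun _ => 0) u (fun t x => deriv (fun s => u s x) t)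
      (fun t => deriv (u t)) (fun t => deriv (deriv (u t))) := by
  obtain ⟨h1, h2, h3, h4, h5, h6⟩ := hu
  refine ⟨h1, h2, fun t ht => D2.of_contDiff (h3 t ht), fun t ht x => ?_, fun x => ?_, fun t ht x => ?_,
    integrable_zero _ _ _⟩
  · exact (((h4 x).differentiableOn one_ne_zero).differentiableAt (Ioi_mem_nhds ht)).hasDerivAt
  · exact (h4 x).continuousOn_deriv_of_isOpen isOpen_Ioi le_rfl
  · have := h5 t ht x
    unfold Lop pw cv
    simp only
    linarith

lemma init_mass (hl : 0 < lam) (hu : IsRescaledSol J q lam μ φ u) : ∫ x, |u 0 x| = ∫ y, |φ y| := by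
  have h6 := hu.2.2.2.2.2
  have e : ∫ x, |u 0 x| = ∫ x, lam * |φ (lam * x)| := by
    refine integral_congr_ae ?_
    filter_upwards [h6] with x hx
    rw [hx, abs_mul, abs_of_pos hl]
  rw [e, integral_const_mul, Measure.integral_comp_mul_left (fun x => |φ x|), abs_of_pos (inv_pos.2 hl), smul_eq_mul]
  field_simp

lemma init_mod (hl : 0 < lam) (hω : IsL1Modulus φ ω) (hu : IsRescaledSol J q lam μ φ u) (h : ℝ) :
    ∫ x, |u 0 (x + h) - u 0 x| ≤ ω (lam * |h|) := by
  have h6 := hu.2.2.2.2.2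
  have h7 := (measurePreserving_add_right volume h).quasiMeasurePreserving.tendsto_ae.eventually h6
  have e : ∫ x, |u 0 (x + h) - u 0 x| = ∫ x, lam * |φ (lam * x + lam * h) - φ (lam * x)| := by
    refine integral_congr_ae ?_
    filter_upwards [h6, h7] with x hx hx'
    rw [hx, hx', ← mul_sub, abs_mul, abs_of_pos hl, mul_add]
  rw [e, integral_const_mul, Measure.integral_comp_mul_left (fun x => |φ (x + lam * h) - φ x|),
    abs_of_pos (inv_pos.2 hl), smul_eq_mul, mul_inv_cancel_left₀ hl.ne']
  have := hω.2.2.2 (lam * h)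
  rwa [abs_mul, abs_of_pos hl] at this

/-- `(1+x)^p ≤ 1 + 2^p x` on `[0,1]` -/
lemma rpow_lin {p x : ℝ} (hp : 1 ≤ p) (h0 : 0 ≤ x) (h1 : x ≤ 1) :
    (1 + x) ^ p ≤ 1 + 2 ^ p * x := by
  have h := (convexOn_rpow hp).2 (Set.mem_Ici.2 zero_le_one) (Set.mem_Ici.2 zero_le_two)
    (sub_nonneg.2 h1) h0 (by ring)
  simp only [smul_eq_mul, Real.one_rpow, mul_one] at h
  rw [show 1 - x + x * 2 = 1 + x by ring] at h
  nlinarith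

lemma time_A {t κ : ℝ} (hq : 0 < q) (ht : 0 < t) (hκ : 0 < κ) (h : κ ^ (q / 3) ≤ t) :
    κ / t ≤ κ ^ ((2 : ℝ) / 3) * t ^ (-1 + 1 / q) := by
  have h1 : κ ^ ((1 : ℝ) / 3) ≤ t ^ (1 / q) := by
    have := Real.rpow_le_rpow (by positivity) h (by positivity : 0 ≤ 1 / q)
    rw [← Real.rpow_mul hκ.le] at this
    rwa [show q / 3 * (1 / q) = 1 / 3 by field_simp] at this
  have h2 : κ = κ ^ ((2 : ℝ) / 3) * κ ^ ((1 : ℝ) / 3) := by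
    rw [← Real.rpow_add hκ]; norm_num
  have h3 : t ^ (-1 + 1 / q) = t⁻¹ * t ^ (1 / q) := by
    rw [Real.rpow_add ht, Real.rpow_neg_one]
  rw [h3]
  calc κ / t = κ ^ ((2 : ℝ) / 3) * (t⁻¹ * κ ^ ((1 : ℝ) / 3)) := by
        rw [div_eq_mul_inv]; nth_rewrite 1 [h2]; ring
    _ ≤ _ := by gcongr

lemma exp_neg (hq1 : 1 < q) : -1 + 1 / q ≤ 0 := by
  have : 1 / q ≤ 1 := by rw [div_le_one (by linarith)]; exact hq1.le
  linarith

lemma time_B {t κ : ℝ} (hq1 : 1 < q) (hq2 : q < 2) (ht : 0 < t) (h : t ≤ κ) (h1 : 1 ≤ κ) :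
    1 ≤ κ ^ ((2 : ℝ) / 3) * t ^ (-1 + 1 / q) := by
  have hκ : 0 < κ := by linarith
  have h2 := Real.rpow_le_rpow_of_nonpos ht h (exp_neg hq1)
  calc (1:ℝ) ≤ κ ^ ((2 : ℝ) / 3 + (-1 + 1 / q)) := by
        refine Real.one_le_rpow h1 ?_
        have : 1 / 2 ≤ 1 / q := by gcongr
        linarith
    _ = κ ^ ((2 : ℝ) / 3) * κ ^ (-1 + 1 / q) := Real.rpow_add hκ _ _
    _ ≤ _ := by gcongr

lemma time_C {t κ : ℝ} (hq1 : 1 < q) (ht : 0 < t) (hκ : 0 < κ) (h : t ≤ κ ^ (q / 3)) :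
    κ ^ (1 - q / 3) ≤ κ ^ ((2 : ℝ) / 3) * t ^ (-1 + 1 / q) := by
  have h2 := Real.rpow_le_rpow_of_nonpos ht h (exp_neg hq1)
  rw [← Real.rpow_mul hκ.le] at h2
  calc κ ^ (1 - q / 3) = κ ^ ((2 : ℝ) / 3) * κ ^ (q / 3 * (-1 + 1 / q)) := by
        rw [← Real.rpow_add hκ]
        congr 1; field_simp; ring
    _ ≤ _ := by gcongr

end fin

set_option maxHeartbeats 2000000

theorem stmt16
    (J : ℝ → ℝ) (hJpos : ∀ x, 0 ≤ J x) (hJeven : ∀ x, J (-x) = J x)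
    (hJint : Integrable J) (hJmass : ∫ x, J x = 1)
    (hJ2 : Integrable (fun x => (1 + |x| ^ 2) * J x))
    (q K : ℝ) (hq1 : 1 < q) (hq2 : q < 2) (hK : 0 ≤ K) :
    -- (i) translations in space, with the rescaled modulus ω_λ(r) = ω(λ r)
    (∀ (φ ω : ℝ → ℝ) (lam μ : ℝ) (u : ℝ → ℝ → ℝ),
      0 < lam → 0 < μ → Integrable φ → IsL1Modulus φ ω →
      IsRescaledSol J q lam μ φ u →
      ∀ t : ℝ, 0 < t → ∀ h : ℝ,
        (∫ x, |u t (x + h) - u t x|) ≤ ω (lam * |h|)) ∧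
    -- (ii) translations in time, with a constant C(q, J, ‖φ‖₁)
    (∃ C : ℝ, 0 < C ∧
      ∀ (φ ω : ℝ → ℝ) (lam μ : ℝ) (u : ℝ → ℝ → ℝ),
        0 < lam → 0 < μ → Integrable φ → (∫ y, |φ y|) = K → IsL1Modulus φ ω →
        IsRescaledSol J q lam μ φ u →
        ∀ t : ℝ, 0 < t → ∀ k : ℝ, 0 < k →
          (∫ x, |u (t + k) x - u t x|)
            ≤ C * ((lam ^ (q - 2) + μ) * k ^ ((1 : ℝ) / 3)
                + k ^ ((2 : ℝ) / 3) * t ^ (-1 + 1 / q))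
              + 4 * ω (lam * k ^ ((1 : ℝ) / 3))) := by
  have hM2i := J2_int hJint hJ2
  refine ⟨fun φ ω lam μ u hl hμ hφ hω hu t ht h => ?_, ?_⟩
  · have hk := ker_of hJpos hJint hJmass hJ2 hl
    exact (Curve.transl hq1 hq2 hμ (Real.rpow_pos_of_pos hl q) hk (curve_of hu) ht h).trans
      (init_mod hl hω hu h)
  obtain ⟨c, hc, hmol⟩ := mol_exists
  set M2 := ∫ y, J y * y ^ 2 with hM2
  have M20 : 0 ≤ M2 := integral_nonneg fun y => mul_nonneg (hJpos y) (sq_nonneg y)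
  set P : ℝ := 2 ^ (1 / (q - 1)) with hP
  have P0 : 0 < P := by positivity
  set Q : ℝ := (c * K) ^ (q - 1) * (c * K) with hQ
  have Q0 : 0 ≤ Q := by positivity
  have hp1 : 1 ≤ 1 / (q - 1) := by rw [le_div_iff₀ (by linarith)]; linarith
  set C1 : ℝ := (1 + M2) * c * (P + 2) * K with hC1
  have C10 : 0 ≤ C1 := by positivity
  refine ⟨C1 + (2 * K + 2 * P * K + Q) + 1, by positivity, fun φ ω lam μ u hl hμ hφ hφK hω hu t ht κ hκ => ?_⟩
  have hk := ker_of hJpos hJint hJmass hJ2 hl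
  have hΛ : 0 < lam ^ q := Real.rpow_pos_of_pos hl q
  obtain ⟨hk2, hk2e⟩ := k2_of (q := q) hM2i hl
  have he : ∀ x, lam * J (lam * -x) = lam * J (lam * x) := fun x => by rw [mul_neg, hJeven]
  have hcu := curve_of hu
  have hK0 : ∫ x, |u 0 x| = K := (init_mass hl hu).trans hφK
  set δ := κ ^ ((1 : ℝ) / 3) with hδd
  have hδ : 0 < δ := Real.rpow_pos_of_pos hκ _
  set Ω := ω (lam * δ) with hΩ
  have Ω0 : 0 ≤ Ω := hω.1 _
  have hW : ∀ y, |y| ≤ δ → ∫ x, |u 0 (x + y) - u 0 x| ≤ Ω := fun y hy =>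
    (init_mod hl hω hu y).trans (hω.2.1 _ _ (by positivity) (by gcongr))
  set N := lam ^ (q - 2) + μ with hN
  have l0 : 0 < lam ^ (q - 2) := Real.rpow_pos_of_pos hl _
  have N0 : 0 < N := by positivity
  have hNN : μ + lam ^ (q - 2) * M2 ≤ (1 + M2) * N := by rw [hN]; nlinarith [mul_nonneg M20 hμ.le]
  set Y := κ ^ ((2 : ℝ) / 3) * t ^ (-1 + 1 / q) with hY
  have Y0 : 0 < Y := by positivity
  obtain ⟨ρ, ρ1, ρ2, hm, hρ, hρ1, hρ2⟩ := hmol δ hδ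
  have κδ : κ / δ ^ 2 = δ := by
    rw [div_eq_iff (by positivity), hδd, ← pow_succ', ← Real.rpow_natCast, ← Real.rpow_mul hκ.le]
    norm_num
  have r2 : 0 ≤ ∫ x, |ρ2 x| := integral_nonneg fun _ => abs_nonneg _
  have n0 : 0 ≤ μ + lam ^ (q - 2) * M2 := by positivity
  -- the diffusive term
  have dif : κ * ((μ + lam ^ (q - 2) * M2) * (∫ x, |ρ2 x|)) ≤ (1 + M2) * c * (N * δ) := by
    calc κ * ((μ + lam ^ (q - 2) * M2) * (∫ x, |ρ2 x|)) ≤ κ * ((1 + M2) * N * (c / δ ^ 2)) := by gcongr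
      _ = (1 + M2) * c * (N * (κ / δ ^ 2)) := by ring
      _ = _ := by rw [κδ]
  have dif0 : 0 ≤ κ * ((μ + lam ^ (q - 2) * M2) * (∫ x, |ρ2 x|)) := by positivity
  have Nδ : 0 ≤ N * δ := by positivity
  have C1e : C1 = (1 + M2) * c * ((P + 2) * K) := by rw [hC1]; ring
  have C1N : (1 + M2) * c * (N * δ) * ((P + 2) * K) = C1 * (N * δ) := by rw [C1e]; ring
  have PK : 0 ≤ P * K := by positivity
  have X1 : 0 ≤ (2 * K + 2 * P * K + Q + 1) * (N * δ) := by positivity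
  have X2 : 0 ≤ (C1 + 1) * Y := by positivity
  have KY : 0 ≤ K * Y := by positivity
  have PKY : 0 ≤ P * K * Y := by positivity
  have QY : 0 ≤ Q * Y := by positivity
  by_cases hA1 : t < κ ^ (q / 3)
  · -- small times
    have h1 := Curve.time0 hq1 hq2 hμ hΛ hk hcu ht hκ.le
    have h2 := Curve.small hq1 hq2 hμ hΛ hk he hk2 hcu hm hρ hW hκ
    simp only [hK0, hk2e] at h2
    have h3 := time_C hq1 ht hκ hA1.le
    have h4 : κ * ((c / δ * K) ^ (q - 1) * ((∫ x, |ρ1 x|) * K)) ≤ Q * κ ^ (1 - q / 3) := by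
      calc κ * ((c / δ * K) ^ (q - 1) * ((∫ x, |ρ1 x|) * K)) ≤ κ * ((c / δ * K) ^ (q - 1) * ((c / δ) * K)) := by
            gcongr
        _ = Q * (κ * (δ ^ (-(q - 1)) * δ⁻¹)) := by
            rw [show c / δ * K = c * K * δ⁻¹ by ring, Real.mul_rpow (by positivity) (by positivity),
              Real.inv_rpow hδ.le, Real.rpow_neg hδ.le, hQ]
            ring
        _ = Q * κ ^ (1 - q / 3) := by
            congr 1
            rw [← Real.rpow_neg_one δ, ← Real.rpow_add hδ, hδd, ← Real.rpow_mul hκ.le]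
            nth_rewrite 1 [← Real.rpow_one κ]
            rw [← Real.rpow_add hκ]
            congr 1; ring
    have h5 : Q * κ ^ (1 - q / 3) ≤ Q * Y := by gcongr
    have h6 := mul_le_mul_of_nonneg_right dif (by positivity : 0 ≤ (P + 2) * K)
    rw [C1N] at h6
    have h7 : κ * ((μ + lam ^ (q - 2) * M2) * ((∫ x, |ρ2 x|) * K)) ≤
        κ * ((μ + lam ^ (q - 2) * M2) * (∫ x, |ρ2 x|)) * ((P + 2) * K) := by
      have : κ * ((μ + lam ^ (q - 2) * M2) * ((∫ x, |ρ2 x|) * K)) =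
        κ * ((μ + lam ^ (q - 2) * M2) * (∫ x, |ρ2 x|)) * (1 * K) := by ring
      rw [this]
      gcongr
      linarith
    rw [mul_add] at h2
    linarith
  · have hA1 := not_lt.1 hA1
    by_cases hA2 : κ ≤ t
    · -- large times
      have hx1 : κ / t ≤ 1 := by rw [div_le_one ht]; exact hA2
      have hx0 : 0 < κ / t := by positivity
      set S := (1 + κ / t) ^ (1 / (q - 1)) with hS
      have h2 := Curve.large hq1 hq2 hμ hΛ hk he hk2 hcu hm hδ.le hW hκ ht hS
      simp only [hK0, hk2e] at h2
      have h3 := time_A (by linarith : 0 < q) ht hκ hA1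
      have S1 : S ≤ 1 + P * (κ / t) := rpow_lin hp1 hx0.le hx1
      have S2 : S + 1 ≤ P + 2 := by nlinarith
      have S3 : S - 1 ≤ P * Y := by
        have := mul_le_mul_of_nonneg_left h3 P0.le
        linarith
      have h6 := mul_le_mul_of_nonneg_right dif (by positivity : 0 ≤ (P + 2) * K)
      rw [C1N] at h6
      have h7 : κ * ((μ + lam ^ (q - 2) * M2) * (∫ x, |ρ2 x|) * ((S + 1) * K)) ≤
          κ * ((μ + lam ^ (q - 2) * M2) * (∫ x, |ρ2 x|)) * ((P + 2) * K) := by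
        rw [← mul_assoc]
        gcongr
      have h8 : 2 * (S - 1) * K ≤ 2 * P * K * Y := by
        calc 2 * (S - 1) * K ≤ 2 * (P * Y) * K := by gcongr
          _ = _ := by ring
      linarith
    · -- long steps
      have hA2 := not_le.1 hA2
      have k1 : 1 ≤ κ := by
        by_contra hlt
        have hlt := not_le.1 hlt
        have := Real.rpow_le_rpow_of_exponent_ge hκ hlt.le (by linarith : q / 3 ≤ 1)
        rw [Real.rpow_one] at this
        linarith
      have h3 := time_B hq1 hq2 ht hA2.le k1
      have m1 := Curve.mass hq1 hq2 hμ hΛ hk hcu ht.le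
      have m2 := Curve.mass hq1 hq2 hμ hΛ hk hcu (by linarith : 0 ≤ t + κ)
      rw [hK0] at m1 m2
      have h4 := int_le2 (((hcu.int (t + κ) (by linarith)).sub (hcu.int t ht.le)).abs)
        (hcu.int (t + κ) (by linarith)).abs (hcu.int t ht.le).abs fun x => abs_sub _ _
      simp only [Pi.sub_apply] at h4
      have h5 : K * 1 ≤ K * Y := mul_le_mul_of_nonneg_left h3 hK
      have h6 : 0 ≤ C1 * (N * δ) := by positivity
      linarith
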